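/- Fix parameters α,β>0, γ,δ≥0, 0≤q<1, and let a,b,c,d be defined from them via φ±; assume ab<1. Fix d∈ℕ and 0<θ₁<…<θ_d<θ_{d+1}=1. For each N≥1 let μ_N be a stationary probability measure for the open ASEP generator on {0,1}^N and h_N the random height profile as above. Then the random vectors (h_N(θ₁),…,h_N(θ_{d+1})) ∈ ℝ^{d+1} satisfy the large deviation principle with good rate function I^{(a,b)}_{θ₁,…,θ_{d+1}}: for every closed C ⊆ ℝ^{d+1}, limsup_{N→∞}(1/N) log μ_N((h_N(θ₁),…,h_N(θ_{d+1}))∈C) ≤ −inf_{x∈C} I^{(a,b)}_{θ₁,…,θ_{d+1}}(x), and for every open U ⊆ ℝ^{d+1}, liminf_{N→∞}(1/N) log μ_N((h_N(θ₁),…,h_N(θ_{d+1}))∈U) ≥ −inf_{x∈U} I^{(a,b)}_{θ₁,…,θ_{d+1}}(x). -/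

import Mathlib

/-- `φ₊(x,y) = (1/(2x))(1-q-x+y + √((1-q-x+y)² + 4xy))`. -/
noncomputable def phiPlus (q x y : ℝ) : ℝ :=
  (1 / (2 * x)) * (1 - q - x + y + Real.sqrt ((1 - q - x + y) ^ 2 + 4 * x * y))

/-- `φ₋(x,y) = (1/(2x))(1-q-x+y - √((1-q-x+y)² + 4xy))`. -/
noncomputable def phiMinus (q x y : ℝ) : ℝ :=
  (1 / (2 * x)) * (1 - q - x + y - Real.sqrt ((1 - q - x + y) ^ 2 + 4 * x * y))

/-- Off-diagonal jump rates of the open ASEP on `{1,…,N}` with parameters `α,β,γ,δ,q`: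
bulk right jumps at rate `1`, bulk left jumps at rate `q`, entry/exit at the left boundary at
rates `α`/`γ`, and entry/exit at the right boundary at rates `δ`/`β`. -/
noncomputable def asepJump (N : ℕ) (α β γ δ q : ℝ) (τ τ' : Fin N → Bool) : ℝ :=
  (∑ i : Fin N, ∑ j : Fin N,
    if (j : ℕ) = (i : ℕ) + 1 ∧ τ i = true ∧ τ j = false ∧
        τ' = Function.update (Function.update τ i false) j true then (1 : ℝ) else 0) +
  q * (∑ i : Fin N, ∑ j : Fin N,
    if (j : ℕ) = (i : ℕ) + 1 ∧ τ i = false ∧ τ j = true ∧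
        τ' = Function.update (Function.update τ i true) j false then (1 : ℝ) else 0) +
  α * (∑ i : Fin N,
    if (i : ℕ) = 0 ∧ τ i = false ∧ τ' = Function.update τ i true then (1 : ℝ) else 0) +
  γ * (∑ i : Fin N,
    if (i : ℕ) = 0 ∧ τ i = true ∧ τ' = Function.update τ i false then (1 : ℝ) else 0) +
  δ * (∑ i : Fin N,
    if (i : ℕ) = N - 1 ∧ τ i = false ∧ τ' = Function.update τ i true then (1 : ℝ) else 0) +
  β * (∑ i : Fin N,
    if (i : ℕ) = N - 1 ∧ τ i = true ∧ τ' = Function.update τ i false then (1 : ℝ) else 0)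

/-- The generator matrix `Q` of the open ASEP on `{0,1}^N`. -/
noncomputable def asepGen (N : ℕ) (α β γ δ q : ℝ) (τ τ' : Fin N → Bool) : ℝ :=
  if τ' = τ then -∑ σ ∈ Finset.univ.filter (fun σ => σ ≠ τ), asepJump N α β γ δ q τ σ
  else asepJump N α β γ δ q τ τ'

/-- `μ` is a stationary measure for the open ASEP generator: `∑_τ μ(τ) Q(τ,τ') = 0` for all
`τ'`. -/
noncomputable def IsStationaryASEP (N : ℕ) (α β γ δ q : ℝ) (μ : (Fin N → Bool) → ℝ) : Prop :=
  ∀ τ' : Fin N → Bool, ∑ τ : Fin N → Bool, μ τ * asepGen N α β γ δ q τ τ' = 0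

open scoped Classical

/-- The space `C₀([0,1],ℝ)` of continuous functions on `[0,1]` vanishing at `0`, with the
supremum-norm (uniform) topology. -/
abbrev C0Sp : Type := {f : C(Set.Icc (0:ℝ) 1, ℝ) // f ⟨0, Set.left_mem_Icc.mpr zero_le_one⟩ = 0}

/-- Extension of `f : C([0,1],ℝ)` to `ℝ` by clamping the argument to `[0,1]`. -/
noncomputable def extendF (f : C(Set.Icc (0:ℝ) 1, ℝ)) : ℝ → ℝ :=
  fun t => f (Set.projIcc 0 1 zero_le_one t)

/-- Evaluation of `f ∈ C₀([0,1],ℝ)` at `t ∈ [0,1]`. -/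
noncomputable def evalC0 (f : C0Sp) (t : ℝ) : ℝ := extendF f.val t

/-- The convex envelope on `[0,1]`: the largest convex function below `F` on `[0,1]`. -/
noncomputable def convEnv (F : ℝ → ℝ) : ℝ → ℝ := fun x =>
  sSup {y : ℝ | ∃ g : ℝ → ℝ, ConvexOn ℝ (Set.Icc (0:ℝ) 1) g ∧
    (∀ t ∈ Set.Icc (0:ℝ) 1, g t ≤ F t) ∧ y = g x}

/-- The entropy function `H(x) = x log x + (1-x) log(1-x)` (for `x ∈ [0,1]`;
note `Real.log 0 = 0` implements the convention `0·log 0 = 0`). -/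
noncomputable def Hent (x : ℝ) : ℝ := x * Real.log x + (1 - x) * Real.log (1 - x)

/-- `J(a,b)`. -/
noncomputable def Jfun (a b : ℝ) : ℝ :=
  if 1 < a then a / (1 + a) ^ 2 else if 1 < b then b / (1 + b) ^ 2 else 1 / 4

/-- `G_*(x) = min(max(f̃'(x), a/(1+a)), 1/(1+b))`, where `f̃` is the convex envelope of `F`. -/
noncomputable def Gstar (a b : ℝ) (F : ℝ → ℝ) (x : ℝ) : ℝ :=
  min (max (deriv (convEnv F) x) (a / (1 + a))) (1 / (1 + b))

/-- The rate function `I^{(a,b)} : C₀([0,1],ℝ) → [0,∞]` of Theorem 1.2.  A function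
`f : [0,1] → ℝ` with `f(0)=0` is absolutely continuous with `0 ≤ f' ≤ 1` a.e. if and only if
it is nondecreasing and 1-Lipschitz, in which case `f'` (defined a.e.) is `deriv f`. -/
noncomputable def rateI (a b : ℝ) (f : C0Sp) : EReal :=
  if MonotoneOn (extendF f.val) (Set.Icc (0:ℝ) 1) ∧
      LipschitzOnWith 1 (extendF f.val) (Set.Icc (0:ℝ) 1) then
    (((∫ x in (0:ℝ)..1, Hent (deriv (extendF f.val) x)) +
      (∫ x in (0:ℝ)..1,
        (deriv (convEnv (extendF f.val)) x * Real.log (Gstar a b (extendF f.val) x) +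
          (1 - deriv (convEnv (extendF f.val)) x) *
            Real.log (1 - Gstar a b (extendF f.val) x))) -
      Real.log (Jfun a b) : ℝ) : EReal)
  else ⊤

/-- The finite-dimensional rate function
`I^{(a,b)}_{θ₁,…,θ_{d+1}}(x) = inf{ I^{(a,b)}(f) : f ∈ C₀([0,1],ℝ), f(θ_j) = x_j ∀j }`. -/
noncomputable def rateFd (a b : ℝ) (k : ℕ) (θ : Fin (k+1) → ℝ) (x : Fin (k+1) → ℝ) : EReal :=
  ⨅ f : {f : C0Sp // ∀ j, evalC0 f (θ j) = x j}, rateI a b f.val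

/-- The logarithm with values in `EReal`, with `log x = -∞` for `x ≤ 0`. -/
noncomputable def elog (x : ℝ) : EReal := if x ≤ 0 then ⊥ else ((Real.log x : ℝ) : EReal)

/-- The rescaled height profile `h_N ∈ C₀([0,1],ℝ)` of a configuration `τ ∈ {0,1}^N`:
`h_N(k/N) = (1/N) ∑_{i=1}^k τ_i`, with linear interpolation in between. -/
noncomputable def heightC0 (N : ℕ) (τ : Fin N → Bool) : C0Sp :=
  ⟨⟨fun t => (N : ℝ)⁻¹ * ∑ k : Fin N,
      (if τ k = true then (1 : ℝ) else 0) * min 1 (max 0 ((N : ℝ) * (t : ℝ) - (k : ℕ))),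
    by
      apply Continuous.mul continuous_const
      apply continuous_finset_sum
      intro k _
      exact continuous_const.mul
        (Continuous.min continuous_const
          (Continuous.max continuous_const
            ((continuous_const.mul continuous_subtype_val).sub continuous_const)))⟩,
    by
      simp only [ContinuousMap.coe_mk]
      have h : ∀ k : Fin N,
          (if τ k = true then (1 : ℝ) else 0) *
            min 1 (max 0 ((N : ℝ) *
              ((⟨0, Set.left_mem_Icc.mpr zero_le_one⟩ : Set.Icc (0:ℝ) 1) : ℝ) - (k : ℕ))) = 0 := by
        intro k
        have h1 : ((⟨0, Set.left_mem_Icc.mpr zero_le_one⟩ : Set.Icc (0:ℝ) 1) : ℝ) = 0 := rfl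
        rw [h1]
        have h2 : (N : ℝ) * 0 - ((k : ℕ) : ℝ) ≤ 0 := by
          simp
        rw [max_eq_left h2, min_eq_right zero_le_one, mul_zero]
      rw [Finset.sum_congr rfl fun k _ => h k]
      simp⟩

/-- Linear inequalities satisfied by super-solutions of the (normalised) matrix-ansatz recursion
on words in `{0,1}`. -/
structure IsSuper (q p s p' s' : ℝ) (B : List Bool → ℝ) : Prop where
  bulk : ∀ u v, q * B (u ++ false :: true :: v) +
    (1 - q) * (B (u ++ true :: v) + B (u ++ false :: v)) ≤ B (u ++ true :: false :: v)
  left : ∀ v, p * B (true :: v) + s * B v ≤ B (false :: v)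
  right : ∀ u, p' * B (u ++ [false]) + s' * B u ≤ B (u ++ [true])

lemma exists_move : ∀ l : List Bool, l ≠ [] →
    (∃ v, l = false :: v) ∨ (∃ u, l = u ++ [true]) ∨ (∃ u v, l = u ++ true :: false :: v)
  | [], h => absurd rfl h
  | false :: v, _ => Or.inl ⟨v, rfl⟩
  | [true], _ => Or.inr (Or.inl ⟨[], rfl⟩)
  | true :: y :: l, _ => by
    rcases exists_move (y :: l) (by simp) with ⟨v, h⟩ | ⟨u, h⟩ | ⟨u, v, h⟩
    · exact Or.inr (Or.inr ⟨[], v, by simp [h]⟩)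
    · exact Or.inr (Or.inl ⟨true :: u, by simp [h]⟩)
    · exact Or.inr (Or.inr ⟨true :: u, v, by simp [h]⟩)

lemma IsSuper.nonneg {q p s p' s' : ℝ} {B : List Bool → ℝ} (hB : IsSuper q p s p' s' B)
    (hq0 : 0 ≤ q) (hq1 : q < 1) (hp : 0 ≤ p) (hs : 0 ≤ s) (hp' : 0 ≤ p') (hs' : 0 ≤ s')
    (hpp : p * p' < 1) (h0 : 0 ≤ B []) : ∀ l, 0 ≤ B l := by
  suffices H : ∀ n, ∀ l : List Bool, l.length = n → 0 ≤ B l from fun l => H _ l rfl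
  intro n
  induction n with
  | zero => intro l hl; rw [List.length_eq_zero_iff] at hl; rwa [hl]
  | succ n ih =>
    obtain ⟨w, hw0, hwp, hwp'⟩ : ∃ w : ℝ, 0 < w ∧ p * w < 1 ∧ p' < w := by
      by_cases hp0 : p = 0
      · exact ⟨p' + 1, by linarith, by simp [hp0], by linarith⟩
      · have hpos : 0 < p := lt_of_le_of_ne hp (Ne.symm hp0)
        have h1 : p' < 1 / p := by rw [lt_div_iff₀ hpos]; linarith
        obtain ⟨w, h2, h3⟩ := exists_between h1
        refine ⟨w, by linarith, ?_, h2⟩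
        rw [lt_div_iff₀ hpos] at h3; linarith
    have hfin : {l : List Bool | l.length = n + 1}.Finite := List.finite_length_eq Bool (n + 1)
    obtain ⟨l, hl, hmin⟩ := Set.exists_min_image _ (fun l => B l / w ^ (l.count true)) hfin
      ⟨List.replicate (n + 1) true, by simp⟩
    have hl' : l.length = n + 1 := hl
    set lam := B l / w ^ (l.count true) with hlam
    have key : ∀ l' : List Bool, l'.length = n + 1 → lam * w ^ (l'.count true) ≤ B l' := by
      intro l' h'
      have := hmin l' h'
      rwa [le_div_iff₀ (by positivity)] at this
    have hBl : B l = lam * w ^ (l.count true) := by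
      rw [hlam, div_mul_cancel₀]; positivity
    suffices hlam0 : 0 ≤ lam by
      intro l' h'
      exact le_trans (by positivity) (key l' h')
    by_contra! hneg
    rcases exists_move l (by intro h; simp [h] at hl') with ⟨v, rfl⟩ | ⟨u, rfl⟩ | ⟨u, v, rfl⟩
    · have h1 := hB.left v
      have h2 := key (true :: v) (by simpa using hl')
      have h3 := ih v (by simpa using hl')
      simp only [List.count_cons_self, List.count_cons_of_ne (show (false : Bool) ≠ true by simp)]
        at h2 hBl
      have h4 : 0 < w ^ (v.count true) := by positivity
      have h5 := mul_le_mul_of_nonneg_left h2 hp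
      have h6 := mul_nonneg hs h3
      rw [pow_succ] at h5
      nlinarith [mul_pos (neg_pos.2 hneg) (mul_pos h4 (sub_pos.2 hwp))]
    · have h1 := hB.right u
      have h2 := key (u ++ [false]) (by simpa using hl')
      have h3 := ih u (by simpa using hl')
      simp only [List.count_append, List.count_singleton_self] at h2 hBl
      have e : List.count true [false] = 0 := by decide
      rw [e] at h2
      rw [pow_succ] at hBl
      rw [add_zero] at h2
      have h4 : 0 < w ^ (u.count true) := by positivity
      have h5 := mul_le_mul_of_nonneg_left h2 hp'
      have h6 := mul_nonneg hs' h3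
      nlinarith [mul_pos (neg_pos.2 hneg) (mul_pos h4 (sub_pos.2 hwp'))]
    · have h1 := hB.bulk u v
      have h2 := key (u ++ false :: true :: v) (by simpa using hl')
      have h3 := ih (u ++ true :: v) (by simp at hl' ⊢; omega)
      have h3' := ih (u ++ false :: v) (by simp at hl' ⊢; omega)
      have e1 : List.count true (u ++ false :: true :: v)
        = List.count true (u ++ true :: false :: v) := by simp [List.count_append]
      rw [e1] at h2
      have h4 : 0 < w ^ ((u ++ true :: false :: v).count true) := by positivity
      have h5 := mul_le_mul_of_nonneg_left h2 hq0
      have h6 := mul_nonneg (sub_pos.2 hq1).le (add_nonneg h3 h3')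
      nlinarith [mul_pos (neg_pos.2 hneg) (mul_pos h4 (sub_pos.2 hq1))]

/-- Parameters in the fan region. -/
structure FanParams (a b c d q : ℝ) : Prop where
  ha : 0 ≤ a
  hb : 0 ≤ b
  hc0 : c ≤ 0
  hc1 : -1 < c
  hd0 : d ≤ 0
  hd1 : -1 < d
  hab : a * b < 1
  hq0 : 0 ≤ q
  hq1 : q < 1

lemma FanParams.symm {a b c d q : ℝ} (h : FanParams a b c d q) : FanParams b a d c q :=
  ⟨h.hb, h.ha, h.hd0, h.hd1, h.hc0, h.hc1, by rw [mul_comm]; exact h.hab, h.hq0, h.hq1⟩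

lemma FanParams.cd_lt {a b c d q : ℝ} (h : FanParams a b c d q) :
    -(a * c) * -(b * d) < 1 := by
  have h1 : 0 ≤ a * b := mul_nonneg h.ha h.hb
  have h2 : 0 ≤ c * d := mul_nonneg_of_nonpos_of_nonpos h.hc0 h.hd0
  have h3 : c * d ≤ 1 := by nlinarith [h.hc0, h.hc1, h.hd0, h.hd1]
  have := h.hab
  nlinarith

/-- Matrix-ansatz weights on words, normalised by `(1-q)^N`. -/
structure IsMPA (a b c d q : ℝ) (F : List Bool → ℝ) : Prop where
  nil : F [] = 1
  bulk : ∀ u v, F (u ++ true :: false :: v) = q * F (u ++ false :: true :: v) +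
    (1 - q) * (F (u ++ true :: v) + F (u ++ false :: v))
  left : ∀ v, F (false :: v) = -(a * c) * F (true :: v) + (1 + a) * (1 + c) * F v
  right : ∀ u, F (u ++ [true]) = -(b * d) * F (u ++ [false]) + (1 + b) * (1 + d) * F u

namespace IsMPA

variable {a b c d q : ℝ} {F : List Bool → ℝ}

/-- Particle-hole symmetry combined with reflection. -/
lemma symm (h : IsMPA a b c d q F) :
    IsMPA b a d c q (fun l => F (l.map not).reverse) where
  nil := by simpa using h.nil
  bulk u v := by
    have := h.bulk (v.map not).reverse (u.map not).reverse
    simp only [List.map_append, List.map_cons, List.reverse_append, List.reverse_cons,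
      Bool.not_true, Bool.not_false, List.append_assoc, List.cons_append, List.nil_append] at this ⊢
    rw [this]; ring
  left v := by
    have := h.right (v.map not).reverse
    simpa using this
  right u := by
    have := h.left (u.map not).reverse
    simpa using this

lemma isSuper (h : IsMPA a b c d q F) :
    IsSuper q (-(a * c)) ((1 + a) * (1 + c)) (-(b * d)) ((1 + b) * (1 + d)) F :=
  ⟨fun u v => (h.bulk u v).ge, fun v => (h.left v).ge, fun u => (h.right u).ge⟩

lemma nonneg_of_isSuper (hP : FanParams a b c d q) {B : List Bool → ℝ}
    (hB : IsSuper q (-(a * c)) ((1 + a) * (1 + c)) (-(b * d)) ((1 + b) * (1 + d)) B)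
    (h0 : 0 ≤ B []) (l : List Bool) : 0 ≤ B l := by
  have := hP.ha; have := hP.hb
  refine hB.nonneg hP.hq0 hP.hq1 ?_ ?_ ?_ ?_ hP.cd_lt h0 l
  · nlinarith [hP.ha, hP.hc0]
  · exact mul_nonneg (by linarith) (by linarith [hP.hc1])
  · nlinarith [hP.hb, hP.hd0]
  · exact mul_nonneg (by linarith) (by linarith [hP.hd1])

lemma nonneg (h : IsMPA a b c d q F) (hP : FanParams a b c d q) (l : List Bool) : 0 ≤ F l :=
  nonneg_of_isSuper hP h.isSuper (by rw [h.nil]; norm_num) l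

lemma pos (h : IsMPA a b c d q F) (hP : FanParams a b c d q) (l : List Bool) : 0 < F l := by
  suffices H : ∀ n, ∀ l : List Bool, l.length = n → 0 < F l from H _ l rfl
  have := hP.ha; have := hP.hb; have := hP.hc0; have := hP.hc1; have := hP.hd0
  have := hP.hd1; have := hP.hq0; have := hP.hq1
  intro n
  induction n with
  | zero => intro l hl; rw [List.length_eq_zero_iff] at hl; rw [hl, h.nil]; norm_num
  | succ n ih =>
    intro l hl
    rcases exists_move l (by intro h; simp [h] at hl) with ⟨v, rfl⟩ | ⟨u, rfl⟩ | ⟨u, v, rfl⟩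
    · rw [h.left]
      have h1 := ih v (by simpa using hl)
      have h2 := h.nonneg hP (true :: v)
      have h3 : 0 ≤ -(a * c) := by nlinarith
      have h4 : 0 < (1 + a) * (1 + c) := mul_pos (by linarith) (by linarith)
      positivity
    · rw [h.right]
      have h1 := ih u (by simpa using hl)
      have h2 := h.nonneg hP (u ++ [false])
      have h3 : 0 ≤ -(b * d) := by nlinarith
      have h4 : 0 < (1 + b) * (1 + d) := mul_pos (by linarith) (by linarith)
      positivity
    · rw [h.bulk]
      have h1 := ih (u ++ true :: v) (by simp at hl ⊢; omega)
      have h2 := h.nonneg hP (u ++ false :: true :: v)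
      have h3 := h.nonneg hP (u ++ false :: v)
      have h4 : 0 < 1 - q := by linarith
      positivity

lemma one_particle (h : IsMPA a b c d q F) :
    (1 - a * b * c * d) * ((1 + a) - a * F [true]) = (1 - a * b) * (1 - a * d) := by
  have h1 := h.left []
  have h2 := h.right []
  simp only [List.nil_append, h.nil] at h1 h2
  rw [h1] at h2
  linear_combination -a * h2

/-- The density at the left boundary is at most that of the left reservoir. -/
lemma left_density (h : IsMPA a b c d q F) (hP : FanParams a b c d q) (v : List Bool) :
    a * F (true :: v) ≤ (1 + a) * F v := by
  have := hP.ha; have := hP.hb; have := hP.hc0; have := hP.hc1; have := hP.hd0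
  have := hP.hd1; have := hP.hq0; have := hP.hq1
  have hqa : FanParams (q * a) b c d q :=
    ⟨by positivity, hP.hb, hP.hc0, hP.hc1, hP.hd0, hP.hd1, by
      have := hP.hab
      have h1 : 0 ≤ a * b := by positivity
      nlinarith, hP.hq0, hP.hq1⟩
  have hB : IsSuper q (-((q * a) * c)) ((1 + q * a) * (1 + c)) (-(b * d)) ((1 + b) * (1 + d))
      (fun v => (1 + a) * F v - a * F (true :: v)) := by
    refine ⟨fun u v => ?_, fun v => ?_, fun u => ?_⟩
    · have h1 := h.bulk u v
      have h2 := h.bulk (true :: u) v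
      simp only [List.cons_append] at h2
      rw [h1, h2]; apply le_of_eq; ring
    · have h1 := h.bulk [] v
      have h2 := h.left v
      have h3 := h.left (true :: v)
      simp only [List.nil_append] at h1
      rw [h1, h3, h2]; apply le_of_eq; ring
    · have h1 := h.right u
      have h2 := h.right (true :: u)
      simp only [List.cons_append] at h2
      rw [h1, h2]; apply le_of_eq; ring
  have h0 : 0 ≤ (1 + a) * F [] - a * F [true] := by
    rw [h.nil, mul_one]
    have h1 := h.one_particle
    have h2 : 0 < 1 - a * b * c * d := by have := hP.cd_lt; nlinarith
    have h3 : 0 ≤ (1 - a * b) * (1 - a * d) :=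
      mul_nonneg (by linarith [hP.hab]) (by nlinarith)
    rw [← h1] at h3
    exact nonneg_of_mul_nonneg_right h3 h2
  have := nonneg_of_isSuper hqa hB h0 v
  linarith

/-- After a prefix of `M` particles the left boundary parameter `c` becomes `q^M c`. -/
lemma left_shift (h : IsMPA a b c d q F) (hP : FanParams a b c d q) (M : ℕ) (v : List Bool) :
    -(a * (q ^ M * c)) * F (List.replicate M true ++ true :: v)
      + (1 + a) * (1 + q ^ M * c) * F (List.replicate M true ++ v)
      ≤ F (List.replicate M true ++ false :: v) := by
  have := hP.ha; have := hP.hc0; have := hP.hc1; have := hP.hq0; have := hP.hq1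
  induction M generalizing v with
  | zero => simpa using (h.left v).ge
  | succ M ih =>
    have rep : ∀ w, List.replicate (M + 1) true ++ w = List.replicate M true ++ true :: w := by
      intro w; rw [List.replicate_succ']; simp
    rw [rep, rep, rep, h.bulk]
    have h1 := ih (true :: v)
    have h2 := ih v
    have h3 := h.left_density hP (List.replicate M true ++ v)
    have h5 : true :: (List.replicate M true ++ v) = List.replicate M true ++ true :: v := by
      rw [← rep, List.replicate_succ, List.cons_append]
    rw [h5] at h3
    have hqM : 0 ≤ q ^ M := by positivity
    have hqM1 : q ^ M ≤ 1 := pow_le_one₀ hP.hq0 hP.hq1.le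
    have h6 : 0 ≤ 1 + q ^ M * c := by nlinarith
    have h7 := mul_le_mul_of_nonneg_left h1 hP.hq0
    have h8 := mul_le_mul_of_nonneg_left h2 (sub_pos.2 hP.hq1).le
    have h9 := mul_le_mul_of_nonneg_left h3 (mul_nonneg (sub_pos.2 hP.hq1).le h6)
    rw [pow_succ]
    nlinarith

end IsMPA

/-- Creation operator of the `q`-oscillator algebra. -/
noncomputable def qUp : (ℕ →₀ ℝ) →ₗ[ℝ] (ℕ →₀ ℝ) :=
  Finsupp.linearCombination ℝ fun n => Finsupp.single (n + 1) 1

/-- Annihilation operator of the `q`-oscillator algebra, in the module generated by a vector `V`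
with `d V = (b + d) V - b d e V`. -/
noncomputable def qDown (b d q : ℝ) : (ℕ →₀ ℝ) →ₗ[ℝ] (ℕ →₀ ℝ) :=
  Finsupp.linearCombination ℝ fun n =>
    (q ^ n * (b + d)) • Finsupp.single n 1 - (q ^ n * (b * d)) • Finsupp.single (n + 1) 1
      + (1 - q ^ n) • Finsupp.single (n - 1) 1

/-- The word in the matrices of the ansatz, applied to the right vector. -/
noncomputable def wordVec (b d q : ℝ) : List Bool → (ℕ →₀ ℝ)
  | [] => Finsupp.single 0 1
  | true :: v => wordVec b d q v + qDown b d q (wordVec b d q v)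
  | false :: v => wordVec b d q v + qUp (wordVec b d q v)

/-- Pairs of consecutive moments of the left functional on powers of the creation operator. -/
noncomputable def leftMomentPair (a b c d q : ℝ) : ℕ → ℝ × ℝ
  | 0 => (0, 1)
  | n + 1 => ((leftMomentPair a b c d q n).2,
      ((a + c - a * c * (b + d) * q ^ n) * (leftMomentPair a b c d q n).2
        - a * c * (1 - q ^ n) * (leftMomentPair a b c d q n).1) / (1 - a * b * c * d * q ^ n))

/-- The left functional of the matrix ansatz. -/
noncomputable def leftFunctional (a b c d q : ℝ) : (ℕ →₀ ℝ) →ₗ[ℝ] ℝ :=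
  Finsupp.linearCombination ℝ fun n => (leftMomentPair a b c d q n).2

/-- The matrix-ansatz weight of a word. -/
noncomputable def mpaWeight (a b c d q : ℝ) (l : List Bool) : ℝ :=
  leftFunctional a b c d q (wordVec b d q l)

lemma qUp_single (n : ℕ) : qUp (Finsupp.single n 1) = Finsupp.single (n + 1) 1 := by
  simp [qUp]

lemma qDown_single (b d q : ℝ) (n : ℕ) : qDown b d q (Finsupp.single n 1) =
    (q ^ n * (b + d)) • Finsupp.single n 1 - (q ^ n * (b * d)) • Finsupp.single (n + 1) 1
      + (1 - q ^ n) • Finsupp.single (n - 1) 1 := by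
  simp [qDown]

lemma qDown_qUp (b d q : ℝ) (p : ℕ →₀ ℝ) :
    qDown b d q (qUp p) = q • qUp (qDown b d q p) + (1 - q) • p := by
  have : qDown b d q ∘ₗ qUp = q • (qUp ∘ₗ qDown b d q) + (1 - q) • LinearMap.id := by
    refine Finsupp.lhom_ext' fun n => LinearMap.ext_ring ?_
    simp only [LinearMap.coe_comp, Function.comp_apply, Finsupp.lsingle_apply, LinearMap.add_apply,
      LinearMap.smul_apply, LinearMap.id_apply, qUp_single, qDown_single, map_add, map_sub,
      map_smul]
    rcases n with _ | n
    · ext i; simp [Finsupp.single_apply]; ring_nf; split_ifs <;> ring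
    · ext i; simp [Finsupp.single_apply]; ring_nf; split_ifs <;> ring
  exact LinearMap.congr_fun this p

lemma leftFunctional_qUp {a b c d q : ℝ} (hP : FanParams a b c d q) (p : ℕ →₀ ℝ) :
    leftFunctional a b c d q (qUp p) + a * c * leftFunctional a b c d q (qDown b d q p) =
      (a + c) * leftFunctional a b c d q p := by
  have : leftFunctional a b c d q ∘ₗ qUp + (a * c) • (leftFunctional a b c d q ∘ₗ qDown b d q) =
      (a + c) • leftFunctional a b c d q := by
    refine Finsupp.lhom_ext' fun n => LinearMap.ext_ring ?_
    have hL : ∀ n, leftFunctional a b c d q (Finsupp.single n 1)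
        = (leftMomentPair a b c d q n).2 := fun n => by simp [leftFunctional]
    simp only [LinearMap.coe_comp, Function.comp_apply, Finsupp.lsingle_apply, LinearMap.add_apply,
      LinearMap.smul_apply, qUp_single, qDown_single, map_add, map_sub,
      map_smul, hL, smul_eq_mul]
    have h0 : (leftMomentPair a b c d q (n + 1)).2 * (1 - a * b * c * d * q ^ n) =
        (a + c - a * c * (b + d) * q ^ n) * (leftMomentPair a b c d q n).2
        - a * c * (1 - q ^ n) * (leftMomentPair a b c d q n).1 := by
      have h1 := hP.cd_lt
      have h2 : 0 ≤ a * b * (c * d) := mul_nonneg (mul_nonneg hP.ha hP.hb)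
        (mul_nonneg_of_nonpos_of_nonpos hP.hc0 hP.hd0)
      have h3 : q ^ n ≤ 1 := pow_le_one₀ hP.hq0 hP.hq1.le
      have h4 : 0 ≤ q ^ n := pow_nonneg hP.hq0 n
      have h5 : 1 - a * b * c * d * q ^ n ≠ 0 := by nlinarith
      rw [leftMomentPair, div_mul_cancel₀ _ h5]
    rcases n with _ | n
    · simp only [pow_zero] at h0 ⊢
      linear_combination h0
    · have h6 : (leftMomentPair a b c d q (n + 1)).1 = (leftMomentPair a b c d q n).2 := rfl
      rw [h6] at h0
      simp only [Nat.add_sub_cancel]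
      linear_combination h0
  exact LinearMap.congr_fun this p

lemma isMPA_mpaWeight {a b c d q : ℝ} (hP : FanParams a b c d q) :
    IsMPA a b c d q (mpaWeight a b c d q) where
  nil := by simp [mpaWeight, wordVec, leftFunctional, leftMomentPair]
  bulk u v := by
    have H : wordVec b d q (u ++ true :: false :: v) = q • wordVec b d q (u ++ false :: true :: v)
        + (1 - q) • (wordVec b d q (u ++ true :: v) + wordVec b d q (u ++ false :: v)) := by
      induction u with
      | nil =>
        simp only [List.nil_append, wordVec, map_add, qDown_qUp]
        module
      | cons x u ih =>
        cases x <;> simp only [List.cons_append, wordVec, ih, map_add, map_smul] <;> module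
    simp only [mpaWeight, H, map_add, map_smul, smul_eq_mul]
  left v := by
    have := leftFunctional_qUp hP (wordVec b d q v)
    simp only [mpaWeight, wordVec, map_add]
    linear_combination this
  right u := by
    have H : wordVec b d q (u ++ [true]) = (-(b * d)) • wordVec b d q (u ++ [false])
        + ((1 + b) * (1 + d)) • wordVec b d q u := by
      induction u with
      | nil =>
        simp only [List.nil_append, wordVec, qUp_single, qDown_single]
        simp only [pow_zero, sub_self, zero_smul]
        module
      | cons x u ih =>
        cases x <;> simp only [List.cons_append, wordVec, ih, map_add, map_smul] <;> module
    simp only [mpaWeight, H, map_add, map_smul, smul_eq_mul]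

/-- Weight of the occupation `x` at a site with parameter `g`. -/
noncomputable def siteWeight (x : Bool) (g : ℝ) : ℝ := if x then 1 / g else 1 / (1 - g)

/-- Product of site weights. -/
noncomputable def prodWeight (l : List (Bool × ℝ)) : ℝ :=
  (l.map fun p => siteWeight p.1 p.2).prod

/-- Nondecreasing site parameters within the reservoir bounds. -/
def Admissible (a b : ℝ) (l : List (Bool × ℝ)) : Prop :=
  (l.map Prod.snd).Pairwise (· ≤ ·) ∧
    ∀ p ∈ l, 0 < p.2 ∧ p.2 < 1 ∧ a * (1 - p.2) ≤ p.2 ∧ b * p.2 ≤ 1 - p.2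

/-- Infimum of `prodWeight` over admissible site parameters. -/
noncomputable def infWeight (a b : ℝ) (w : List Bool) : ℝ :=
  sInf (prodWeight '' {l | l.map Prod.fst = w ∧ Admissible a b l})

lemma siteWeight_pos {x : Bool} {g : ℝ} (h0 : 0 < g) (h1 : g < 1) : 0 < siteWeight x g := by
  unfold siteWeight; split_ifs
  · positivity
  · have : 0 < 1 - g := by linarith
    positivity

lemma prodWeight_pos {a b : ℝ} {l : List (Bool × ℝ)} (h : Admissible a b l) :
    0 < prodWeight l := by
  apply List.prod_pos
  intro x hx
  obtain ⟨p, hp, rfl⟩ := List.mem_map.1 hx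
  exact siteWeight_pos (h.2 p hp).1 (h.2 p hp).2.1

lemma Admissible.sublist {a b : ℝ} {l l' : List (Bool × ℝ)} (h : Admissible a b l)
    (hs : l'.Sublist l) : Admissible a b l' :=
  ⟨h.1.sublist (hs.map _), fun p hp => h.2 p (hs.subset hp)⟩

lemma Admissible.congr {a b : ℝ} {l l' : List (Bool × ℝ)} (h : Admissible a b l)
    (hs : l'.map Prod.snd = l.map Prod.snd) : Admissible a b l' := by
  refine ⟨hs ▸ h.1, fun p hp => ?_⟩
  have : p.2 ∈ l.map Prod.snd := hs ▸ List.mem_map_of_mem hp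
  obtain ⟨p', hp', e⟩ := List.mem_map.1 this
  rw [← e]; exact h.2 p' hp'

lemma infWeight_le {a b : ℝ} {l : List (Bool × ℝ)} (h : Admissible a b l) {w : List Bool}
    (hw : l.map Prod.fst = w) : infWeight a b w ≤ prodWeight l :=
  csInf_le ⟨0, by rintro _ ⟨l', h', rfl⟩; exact (prodWeight_pos h'.2).le⟩ ⟨l, ⟨hw, h⟩, rfl⟩

lemma le_infWeight {a b : ℝ} (ha : 0 ≤ a) (hb : 0 ≤ b) (hab : a * b < 1) {w : List Bool} {m : ℝ}
    (H : ∀ l : List (Bool × ℝ), l.map Prod.fst = w → Admissible a b l → m ≤ prodWeight l) :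
    m ≤ infWeight a b w := by
  apply le_csInf
  · obtain ⟨g, h1, h2⟩ : ∃ g, a / (1 + a) < g ∧ g < 1 / (1 + b) := by
      apply exists_between
      rw [div_lt_div_iff₀ (by linarith) (by linarith)]; nlinarith
    rw [div_lt_iff₀ (by linarith)] at h1
    rw [lt_div_iff₀ (by linarith)] at h2
    have hg0 : 0 < g := by nlinarith
    refine ⟨_, w.map (fun x => (x, g)), ⟨by simp [Function.comp_def], ?_, ?_⟩, rfl⟩
    · rw [List.map_map]
      have : (Prod.snd ∘ fun x : Bool => (x, g)) = fun _ => g := rfl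
      rw [this, List.map_const', List.pairwise_replicate]; right; exact le_rfl
    · intro p hp
      obtain ⟨x, -, rfl⟩ := List.mem_map.1 hp
      refine ⟨hg0, ?_, ?_, ?_⟩ <;> simp only <;> nlinarith
  · rintro _ ⟨l, ⟨h1, h2⟩, rfl⟩; exact H l h1 h2

lemma prodWeight_append (l l' : List (Bool × ℝ)) :
    prodWeight (l ++ l') = prodWeight l * prodWeight l' := by simp [prodWeight]

lemma prodWeight_cons (p : Bool × ℝ) (l : List (Bool × ℝ)) :
    prodWeight (p :: l) = siteWeight p.1 p.2 * prodWeight l := by simp [prodWeight]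

lemma isSuper_infWeight {a b c d q : ℝ} (hP : FanParams a b c d q) :
    IsSuper q (-(a * c)) ((1 + a) * (1 + c)) (-(b * d)) ((1 + b) * (1 + d)) (infWeight a b) := by
  have ha := hP.ha; have hb := hP.hb; have hc0 := hP.hc0; have hc1 := hP.hc1
  have hd0 := hP.hd0
  have hd1 := hP.hd1; have hq0 := hP.hq0; have hq1 := hP.hq1
  refine ⟨fun u v => ?_, fun v => ?_, fun u => ?_⟩
  · refine le_infWeight ha hb hP.hab fun l hl hA => ?_
    obtain ⟨lu, l2, rfl, hu, h2⟩ := List.map_eq_append_iff.1 hl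
    obtain ⟨⟨x, g⟩, l3, rfl, hx, h3⟩ := List.map_eq_cons_iff.1 h2
    obtain ⟨⟨y, g'⟩, lv, rfl, hy, hv⟩ := List.map_eq_cons_iff.1 h3
    simp only at hx hy
    subst hx hy
    obtain ⟨hg0, hg1, -, -⟩ := hA.2 (true, g) (by simp)
    obtain ⟨hg0', hg1', -, -⟩ := hA.2 (false, g') (by simp)
    simp only at hg0 hg1 hg0' hg1'
    have hgg : g ≤ g' := by
      have := hA.1
      simp only [List.map_append, List.map_cons, List.pairwise_append, List.pairwise_cons] at this
      exact this.2.1.1 g' (by simp)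
    have hA1 : Admissible a b (lu ++ (true, g) :: lv) := hA.sublist (by simp)
    have hA0 : Admissible a b (lu ++ (false, g) :: lv) := hA1.congr (by simp)
    have hA01 : Admissible a b (lu ++ (false, g) :: (true, g) :: lv) := by
      refine ⟨?_, ?_⟩
      · have := hA1.1
        simp only [List.map_append, List.map_cons, List.pairwise_append,
          List.pairwise_cons, List.mem_cons, forall_eq_or_imp] at this ⊢
        exact ⟨this.1, ⟨⟨le_rfl, this.2.1.1⟩, this.2.1⟩, fun r hr =>
          ⟨(this.2.2 r hr).1, this.2.2 r hr⟩⟩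
      · intro p hp
        simp only [List.mem_append, List.mem_cons] at hp
        rcases hp with hp | rfl | hp
        · exact hA1.2 p (by simp [hp])
        · exact hA1.2 (true, g) (by simp)
        · exact hA1.2 p (by simp [hp])
    have b1 := infWeight_le hA1 (w := u ++ true :: v) (by simp [hu, hv])
    have b0 := infWeight_le hA0 (w := u ++ false :: v) (by simp [hu, hv])
    have b01 := infWeight_le hA01 (w := u ++ false :: true :: v) (by simp [hu, hv])
    have pu : 0 < prodWeight lu := prodWeight_pos (hA.sublist (by simp))
    have pv : 0 < prodWeight lv := prodWeight_pos (hA.sublist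
      (((List.sublist_cons_self _ _).trans (List.sublist_cons_self _ _)).trans
        (List.sublist_append_right _ _)))
    simp only [prodWeight_append, prodWeight_cons, siteWeight, if_true, Bool.false_eq_true,
      if_false] at b1 b0 b01 ⊢
    set R := prodWeight lu * prodWeight lv with hR
    have hRpos : 0 < R := mul_pos pu pv
    have hg : 0 < 1 - g := by linarith
    have hg' : 0 < 1 - g' := by linarith
    have e1 : 1 / (1 - g) ≤ 1 / (1 - g') := one_div_le_one_div_of_le hg' (by linarith)
    have e2 : 1 / g * (1 / (1 - g)) = 1 / g + 1 / (1 - g) := by field_simp; ring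
    have e3 : 0 < 1 / g := by positivity
    have e4 : R * (1 / g * (1 / (1 - g))) ≤ R * (1 / g * (1 / (1 - g'))) := by gcongr
    have c1 : q * infWeight a b (u ++ false :: true :: v) ≤ q * (R * (1 / g * (1 / (1 - g)))) :=
      mul_le_mul_of_nonneg_left (by rw [hR]; linarith) hq0
    have c2 : (1 - q) * (infWeight a b (u ++ true :: v) + infWeight a b (u ++ false :: v)) ≤
        (1 - q) * (R * (1 / g * (1 / (1 - g)))) :=
      mul_le_mul_of_nonneg_left (by rw [hR, e2]; linarith) (by linarith)
    have : prodWeight lu * (1 / g * (1 / (1 - g') * prodWeight lv)) =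
      R * (1 / g * (1 / (1 - g'))) := by rw [hR]; ring
    rw [this]; linarith
  · refine le_infWeight ha hb hP.hab fun l hl hA => ?_
    obtain ⟨⟨x, g⟩, lv, rfl, hx, hv⟩ := List.map_eq_cons_iff.1 hl
    simp only at hx
    subst hx
    obtain ⟨hg0, hg1, hga, -⟩ := hA.2 (false, g) (by simp)
    simp only at hg0 hg1 hga
    have hAv : Admissible a b lv := hA.sublist (by simp)
    have hA1 : Admissible a b ((true, g) :: lv) := hA.congr (by simp)
    have b1 := infWeight_le hA1 (w := true :: v) (by simp [hv])
    have bv := infWeight_le hAv hv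
    have pv := prodWeight_pos hAv
    simp only [prodWeight_cons, siteWeight, if_true, Bool.false_eq_true, if_false] at b1 ⊢
    have hg : 0 < 1 - g := by linarith
    have e1 : (1 + a) ≤ 1 / (1 - g) := by rw [le_div_iff₀ hg]; linarith
    have e2 : a * (1 / g) ≤ 1 / (1 - g) := by
      rw [mul_one_div, div_le_div_iff₀ hg0 hg]; linarith
    have c1 : -(a * c) * infWeight a b (true :: v) ≤ -c * (1 / (1 - g) * prodWeight lv) := by
      calc _ ≤ -(a * c) * (1 / g * prodWeight lv) :=
            mul_le_mul_of_nonneg_left b1 (by nlinarith)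
        _ = -c * (a * (1 / g) * prodWeight lv) := by ring
        _ ≤ _ := by
          apply mul_le_mul_of_nonneg_left _ (by linarith)
          exact mul_le_mul_of_nonneg_right e2 pv.le
    have c2 : (1 + a) * (1 + c) * infWeight a b v ≤ (1 + c) * (1 / (1 - g) * prodWeight lv) := by
      calc _ ≤ (1 + a) * (1 + c) * prodWeight lv :=
            mul_le_mul_of_nonneg_left bv (mul_nonneg (by linarith) (by linarith))
        _ = (1 + c) * ((1 + a) * prodWeight lv) := by ring
        _ ≤ _ := by
          apply mul_le_mul_of_nonneg_left _ (by linarith)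
          exact mul_le_mul_of_nonneg_right e1 pv.le
    linarith
  · refine le_infWeight ha hb hP.hab fun l hl hA => ?_
    obtain ⟨lu, l2, rfl, hu, h2⟩ := List.map_eq_append_iff.1 hl
    obtain ⟨⟨x, g⟩, l3, rfl, hx, h3⟩ := List.map_eq_cons_iff.1 h2
    obtain rfl := List.map_eq_nil_iff.1 h3
    simp only at hx
    subst hx
    obtain ⟨hg0, hg1, -, hgb⟩ := hA.2 (true, g) (by simp)
    simp only at hg0 hg1 hgb
    have hAu : Admissible a b lu := hA.sublist (by simp)
    have hA0 : Admissible a b (lu ++ [(false, g)]) := hA.congr (by simp)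
    have b0 := infWeight_le hA0 (w := u ++ [false]) (by simp [hu])
    have bu := infWeight_le hAu hu
    have pu := prodWeight_pos hAu
    have enil : prodWeight [] = 1 := by simp [prodWeight]
    simp only [prodWeight_append, prodWeight_cons, enil, siteWeight, if_true, Bool.false_eq_true,
      if_false, mul_one] at b0 ⊢
    have hg : 0 < 1 - g := by linarith
    have e1 : (1 + b) ≤ 1 / g := by rw [le_div_iff₀ hg0]; linarith
    have e2 : b * (1 / (1 - g)) ≤ 1 / g := by
      rw [mul_one_div, div_le_div_iff₀ hg hg0]; linarith
    have c1 : -(b * d) * infWeight a b (u ++ [false]) ≤ -d * (prodWeight lu * (1 / g)) := by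
      calc _ ≤ -(b * d) * (prodWeight lu * (1 / (1 - g))) :=
            mul_le_mul_of_nonneg_left b0 (by nlinarith)
        _ = -d * (prodWeight lu * (b * (1 / (1 - g)))) := by ring
        _ ≤ _ := by
          apply mul_le_mul_of_nonneg_left _ (by linarith)
          exact mul_le_mul_of_nonneg_left e2 pu.le
    have c2 : (1 + b) * (1 + d) * infWeight a b u ≤ (1 + d) * (prodWeight lu * (1 / g)) := by
      calc _ ≤ (1 + b) * (1 + d) * prodWeight lu :=
            mul_le_mul_of_nonneg_left bu (mul_nonneg (by linarith) (by linarith))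
        _ = (1 + d) * (prodWeight lu * (1 + b)) := by ring
        _ ≤ _ := by
          apply mul_le_mul_of_nonneg_left _ (by linarith)
          exact mul_le_mul_of_nonneg_left e1 pu.le
    linarith

/-- Matrix-ansatz weights are dominated by admissible product weights. -/
lemma IsMPA.le_prodWeight {a b c d q : ℝ} {F : List Bool → ℝ} (h : IsMPA a b c d q F)
    (hP : FanParams a b c d q) {l : List (Bool × ℝ)} (hl : Admissible a b l) :
    F (l.map Prod.fst) ≤ prodWeight l := by
  refine le_trans ?_ (infWeight_le hl rfl)
  have hS := isSuper_infWeight hP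
  have hB : IsSuper q (-(a * c)) ((1 + a) * (1 + c)) (-(b * d)) ((1 + b) * (1 + d))
      (fun w => infWeight a b w - F w) := by
    refine ⟨fun u v => ?_, fun v => ?_, fun u => ?_⟩
    · have := hS.bulk u v; have := h.bulk u v; linarith
    · have := hS.left v; have := h.left v; linarith
    · have := hS.right u; have := h.right u; linarith
  have h0 : F [] ≤ infWeight a b [] := by
    refine le_infWeight hP.ha hP.hb hP.hab fun l hl _ => ?_
    rw [List.map_eq_nil_iff.1 hl, h.nil]; simp [prodWeight]
  have := IsMPA.nonneg_of_isSuper hP hB (by linarith) (l.map Prod.fst)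
  linarith

/-- Weighted number of lattice paths reading the word `w` from height `n`: a particle allows a
rest or an up step (from `n`, of weight `1 - q^(n+1)`), a hole a rest or a down step, and ending
at height `n'` contributes `b^n'`. -/
noncomputable def pathWeight (q b : ℝ) : ℕ → List Bool → ℝ
  | n, [] => b ^ n
  | n, true :: v => pathWeight q b n v + (1 - q ^ (n + 1)) * pathWeight q b (n + 1) v
  | n, false :: v => pathWeight q b n v + if n = 0 then 0 else pathWeight q b (n - 1) v

section PathWeight

variable {q b : ℝ}

lemma pathWeight_nonneg (hq0 : 0 ≤ q) (hq1 : q < 1) (hb : 0 ≤ b) (n : ℕ) (w : List Bool) :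
    0 ≤ pathWeight q b n w := by
  induction w generalizing n with
  | nil => exact pow_nonneg hb n
  | cons x w ih =>
    have h1 : q ^ (n + 1) ≤ 1 := pow_le_one₀ hq0 hq1.le
    cases x
    · simp only [pathWeight]; split_ifs
      · simpa using ih n
      · exact add_nonneg (ih n) (ih _)
    · exact add_nonneg (ih n) (mul_nonneg (by linarith) (ih _))

lemma pathWeight_bulk (u v : List Bool) (n : ℕ) :
    pathWeight q b n (u ++ true :: false :: v) = q * pathWeight q b n (u ++ false :: true :: v) +
      (1 - q) * (pathWeight q b n (u ++ true :: v) + pathWeight q b n (u ++ false :: v)) := by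
  induction u generalizing n with
  | nil =>
    rcases n with _ | n
    · simp [pathWeight]; ring
    · simp [pathWeight]; ring
  | cons x u ih =>
    cases x
    · rcases n with _ | n
      · simp [pathWeight, ih]
      · simp [pathWeight, ih]; ring
    · simp [pathWeight, ih]; ring

lemma pathWeight_right (hq0 : 0 ≤ q) (hq1 : q < 1) (hb : 0 ≤ b) (u : List Bool) (n : ℕ) :
    pathWeight q b n (u ++ [true]) ≤ (1 + b) * pathWeight q b n u := by
  induction u generalizing n with
  | nil =>
    simp only [List.nil_append, pathWeight]
    have h1 : 0 ≤ q ^ (n + 1) * b ^ (n + 1) := by positivity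
    rw [pow_succ b] at *; nlinarith
  | cons x u ih =>
    have h1 : q ^ (n + 1) ≤ 1 := pow_le_one₀ hq0 hq1.le
    cases x
    · simp only [List.cons_append, pathWeight]
      have := ih n
      split_ifs
      · simpa using this
      · have := ih (n - 1); linarith
    · simp only [List.cons_append, pathWeight]
      have h2 := mul_le_mul_of_nonneg_left (ih (n + 1)) (sub_nonneg.2 h1)
      have := ih n
      linarith

lemma sum_pathWeight_left (hq0 : 0 ≤ q) (hq1 : q < 1) (hb : 0 ≤ b) {a : ℝ} (ha : 0 ≤ a)
    (T : ℕ) (v : List Bool) :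
    ∑ n ∈ Finset.range (T + 1), a ^ n * pathWeight q b n (false :: v) ≤
      (1 + a) * ∑ n ∈ Finset.range (T + 1), a ^ n * pathWeight q b n v := by
  simp only [pathWeight, mul_add, Finset.sum_add_distrib, add_mul, one_mul]
  gcongr
  rw [Finset.sum_range_succ']
  simp only [Nat.add_eq_zero_iff, one_ne_zero, and_false, if_false, if_true, mul_zero, add_zero,
    Nat.add_sub_cancel]
  rw [Finset.sum_range_succ, mul_add, Finset.mul_sum]
  have h1 : 0 ≤ a * (a ^ T * pathWeight q b T v) :=
    mul_nonneg ha (mul_nonneg (pow_nonneg ha _) (pathWeight_nonneg hq0 hq1 hb _ _))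
  have h2 : ∀ n, a ^ (n + 1) * pathWeight q b n v = a * (a ^ n * pathWeight q b n v) := by
    intro n; ring
  simp only [h2]
  linarith

lemma pathWeight_block {h₀ : ℕ} (hq0 : 0 ≤ q) (hq1 : q < 1) (hb : 0 ≤ b) (w rest : List Bool)
    (n n' u z : ℕ) (hn : h₀ + w.count false ≤ n) (hn' : n' + z = n + u) :
    (1 - q ^ h₀) ^ w.length * ((w.count true).choose u * (w.count false).choose z : ℝ) *
      pathWeight q b n' rest ≤ pathWeight q b n (w ++ rest) := by
  have r0 : 0 ≤ 1 - q ^ h₀ := by linarith [pow_le_one₀ (n := h₀) hq0 hq1.le]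
  have r1 : 1 - q ^ h₀ ≤ 1 := by linarith [pow_nonneg hq0 h₀]
  have hP := pathWeight_nonneg hq0 hq1 hb
  induction w generalizing n n' u z with
  | nil =>
    rcases u with _ | u
    · rcases z with _ | z
      · obtain rfl : n' = n := by omega
        simp
      · simpa using hP n rest
    · simpa using hP n rest
  | cons x w ih =>
    have hpow : (1 - q ^ h₀) ^ (w.length + 1) ≤ (1 - q ^ h₀) ^ w.length :=
      pow_le_pow_of_le_one r0 r1 (Nat.le_succ _)
    have hpow0 : 0 ≤ (1 - q ^ h₀) ^ w.length := pow_nonneg r0 _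
    cases x
    · simp only [List.count_cons_self, List.length_cons] at hn ⊢
      rw [List.count_cons_of_ne (by decide)]
      simp only [List.cons_append, pathWeight, if_neg (show n ≠ 0 by omega)]
      rcases z with _ | z
      · have h1 := ih n n' u 0 (by omega) hn'
        simp only [Nat.choose_zero_right, Nat.cast_one, mul_one] at h1 ⊢
        refine le_trans ?_ (h1.trans (le_add_of_nonneg_right (hP _ _)))
        gcongr
        exact hP _ _
      · have h1 := ih n n' u (z + 1) (by omega) hn'
        have h2 := ih (n - 1) n' u z (by omega) (by omega)
        rw [Nat.choose_succ_succ, Nat.cast_add]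
        refine le_trans ?_ (add_le_add h1 h2)
        have h3 := mul_le_mul_of_nonneg_right hpow (mul_nonneg (mul_nonneg
          (Nat.cast_nonneg (α := ℝ) ((w.count true).choose u))
          (add_nonneg (Nat.cast_nonneg (α := ℝ) ((w.count false).choose z))
            (Nat.cast_nonneg (α := ℝ) ((w.count false).choose (z + 1))))) (hP n' rest))
        linarith
    · simp only [List.count_cons_self, List.length_cons]
      rw [List.count_cons_of_ne (by decide)] at hn ⊢
      simp only [List.cons_append, pathWeight]
      have hr : 1 - q ^ h₀ ≤ 1 - q ^ (n + 1) := by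
        have := pow_le_pow_of_le_one hq0 hq1.le (show h₀ ≤ n + 1 by omega)
        linarith
      rcases u with _ | u
      · have h1 := ih n n' 0 z hn hn'
        simp only [Nat.choose_zero_right, Nat.cast_one, one_mul] at h1 ⊢
        refine le_trans ?_ (h1.trans (le_add_of_nonneg_right (mul_nonneg (r0.trans hr) (hP _ _))))
        gcongr
        exact hP _ _
      · have h1 := ih n n' (u + 1) z hn hn'
        have h2 := ih (n + 1) n' u z (by omega) (by omega)
        have h4 := (mul_le_mul_of_nonneg_left h2 r0).trans
          (mul_le_mul_of_nonneg_right hr (hP (n + 1) (w ++ rest)))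
        rw [Nat.choose_succ_succ, Nat.cast_add]
        refine le_trans ?_ (add_le_add h1 h4)
        have h3 := mul_le_mul_of_nonneg_right hpow (mul_nonneg (mul_nonneg
          (Nat.cast_nonneg (α := ℝ) ((w.count true).choose (u + 1)))
            (Nat.cast_nonneg (α := ℝ) ((w.count false).choose z))) (hP n' rest))
        rw [pow_succ] at h3 ⊢
        linarith

lemma pathWeight_replicate_true (hq0 : 0 ≤ q) (hq1 : q < 1) (hb : 0 ≤ b) (K n : ℕ)
    (v : List Bool) :
    (1 - q) ^ K * pathWeight q b (n + K) v ≤ pathWeight q b n (List.replicate K true ++ v) := by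
  induction K generalizing n with
  | zero => simp
  | succ K ih =>
    rw [List.replicate_succ, List.cons_append, pathWeight]
    have h1 := ih (n + 1)
    have h2 : q ^ (n + 1) ≤ q := pow_le_of_le_one hq0 hq1.le (by omega)
    have h3 := pathWeight_nonneg hq0 hq1 hb n (List.replicate K true ++ v)
    have h4 := pathWeight_nonneg hq0 hq1 hb (n + 1) (List.replicate K true ++ v)
    rw [show n + (K + 1) = n + 1 + K by ring, pow_succ]
    have h5 := mul_le_mul_of_nonneg_left h1 (sub_nonneg.2 hq1.le)
    nlinarith

lemma pathWeight_replicate_false (hq0 : 0 ≤ q) (hq1 : q < 1) (hb : 0 ≤ b) (K n n' : ℕ)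
    (h1 : n' ≤ n) (h2 : n ≤ n' + K) :
    b ^ n' ≤ pathWeight q b n (List.replicate K false) := by
  induction K generalizing n with
  | zero => obtain rfl : n' = n := by omega
            simp [pathWeight]
  | succ K ih =>
    rw [List.replicate_succ, pathWeight]
    by_cases h : n = n'
    · refine (ih n h1 (by omega)).trans (le_add_of_nonneg_right ?_)
      split_ifs
      · exact le_rfl
      · exact pathWeight_nonneg hq0 hq1 hb _ _
    · rw [if_neg (by omega)]
      exact (ih (n - 1) (by omega) (by omega)).trans
        (le_add_of_nonneg_left (pathWeight_nonneg hq0 hq1 hb _ _))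

end PathWeight

namespace IsMPA

variable {a b c d q : ℝ} {F : List Bool → ℝ}

lemma right_shift (h : IsMPA a b c d q F) (hP : FanParams a b c d q) (M : ℕ) (u : List Bool) :
    (1 + b) * (1 + q ^ M * d) * F (u ++ List.replicate M false)
      ≤ F (u ++ true :: List.replicate M false) := by
  have h1 := h.symm.left_shift hP.symm M (u.map not).reverse
  have h2 : 0 ≤ -(b * (q ^ M * d)) := by
    have : 0 ≤ b * q ^ M := mul_nonneg hP.hb (pow_nonneg hP.hq0 _)
    nlinarith [hP.hd0]
  simp only [List.map_append, List.map_replicate, List.map_cons, Bool.not_true, Bool.not_false,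
    List.map_reverse, List.map_map, List.reverse_append, List.reverse_cons, List.reverse_reverse,
    List.reverse_replicate, List.append_assoc, List.singleton_append] at h1
  rw [show (not ∘ not) = id by ext x; simp, List.map_id] at h1
  have h3 := mul_nonneg h2 (h.nonneg hP (u ++ false :: List.replicate M false))
  linarith

/-- Lower bound on the weights by lattice path weights. -/
lemma pathWeight_le (h : IsMPA a b c d q F) (hP : FanParams a b c d q) {κ : ℝ} (hκ : κ < 1)
    (hκ0 : 0 ≤ κ) :
    ∃ M : ℕ, ∃ C : ℝ, 0 < C ∧ ∀ (v : List Bool) (n : ℕ),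
      C * κ ^ v.length * (a ^ n * pathWeight q b n v) ≤
        F (List.replicate M true ++ (v ++ List.replicate M false)) := by
  obtain ⟨ha, hb, hc0, hc1, hd0, hd1, hab, hq0, hq1⟩ := id hP
  have hlim : Filter.Tendsto (fun M : ℕ => (1 + q ^ M * c) * (1 + q ^ M * d)) Filter.atTop
      (nhds 1) := by
    have h0 := tendsto_pow_atTop_nhds_zero_of_lt_one hq0 hq1
    have := ((h0.mul_const c).const_add 1).mul ((h0.mul_const d).const_add 1)
    simpa using this
  obtain ⟨M, hM⟩ := ((tendsto_order.1 hlim).1 κ hκ).exists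
  have hqM : 0 ≤ q ^ M := pow_nonneg hq0 _
  have hqM1 : q ^ M ≤ 1 := pow_le_one₀ hq0 hq1.le
  have c1 : 0 ≤ 1 + q ^ M * c := by nlinarith
  have c2 : 1 + q ^ M * c ≤ 1 := by nlinarith
  have d1 : 0 ≤ 1 + q ^ M * d := by nlinarith
  have d2 : 1 + q ^ M * d ≤ 1 := by nlinarith
  have kc : κ ≤ 1 + q ^ M * c := by nlinarith
  have kd : κ ≤ 1 + q ^ M * d := by nlinarith
  set A : List Bool → ℝ := fun v => F (List.replicate M true ++ (v ++ List.replicate M false))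
    with hA
  have hA0 : 0 < A [] := h.pos hP _
  refine ⟨M, A [] * (1 - a * b), mul_pos hA0 (by linarith), fun v n => ?_⟩
  set G : List Bool → ℝ := fun v => ∑ m ∈ Finset.range (n + 1), a ^ m * pathWeight q b m v with hG
  have hG0 : ∀ v, 0 ≤ G v := fun v => Finset.sum_nonneg fun m _ =>
    mul_nonneg (pow_nonneg ha _) (pathWeight_nonneg hq0 hq1 hb _ _)
  have hB : IsSuper q 0 ((1 + a) * (1 + q ^ M * c)) 0 ((1 + b) * (1 + q ^ M * d))
      (fun v => A v * G [] - A [] * (κ ^ v.length * G v)) := by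
    refine ⟨fun u v => ?_, fun v => ?_, fun u => ?_⟩
    · have e1 : A (u ++ true :: false :: v) = q * A (u ++ false :: true :: v) +
          (1 - q) * (A (u ++ true :: v) + A (u ++ false :: v)) := by
        have := h.bulk (List.replicate M true ++ u) (v ++ List.replicate M false)
        simpa [hA] using this
      have e2 : G (u ++ true :: false :: v) = q * G (u ++ false :: true :: v) +
          (1 - q) * (G (u ++ true :: v) + G (u ++ false :: v)) := by
        simp only [hG, pathWeight_bulk, Finset.mul_sum, mul_add, Finset.sum_add_distrib]
        congr 1
        · exact Finset.sum_congr rfl fun _ _ => by ring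
        · congr 1 <;> exact Finset.sum_congr rfl fun _ _ => by ring
      rw [e1, e2]
      simp only [List.length_append, List.length_cons]
      set L := u.length + v.length with hL
      rw [show u.length + (v.length + 1 + 1) = L + 2 by omega,
        show u.length + (v.length + 1) = L + 1 by omega]
      have hk : κ ^ (L + 2) ≤ κ ^ (L + 1) := pow_le_pow_of_le_one hκ0 hκ.le (by omega)
      have := mul_le_mul_of_nonneg_right hk (mul_nonneg hA0.le
        (mul_nonneg (sub_nonneg.2 hq1.le) (add_nonneg (hG0 (u ++ true :: v))
          (hG0 (u ++ false :: v)))))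
      nlinarith
    · have e1 : (1 + a) * (1 + q ^ M * c) * A v ≤ A (false :: v) := by
        have := h.left_shift hP M (v ++ List.replicate M false)
        have h3 : 0 ≤ -(a * (q ^ M * c)) := by
          have : 0 ≤ a * q ^ M := mul_nonneg ha hqM
          nlinarith
        have h4 := mul_nonneg h3
          (h.nonneg hP (List.replicate M true ++ true :: (v ++ List.replicate M false)))
        simp only [hA, List.cons_append]; linarith
      have e2 : G (false :: v) ≤ (1 + a) * G v := sum_pathWeight_left hq0 hq1 hb ha n v
      have e3 : κ ^ (v.length + 1) * G (false :: v) ≤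
          (1 + a) * (1 + q ^ M * c) * (κ ^ v.length * G v) := by
        rw [pow_succ]
        calc κ ^ v.length * κ * G (false :: v)
            ≤ κ ^ v.length * (1 + q ^ M * c) * ((1 + a) * G v) := by
              apply mul_le_mul _ e2 (hG0 _) (by positivity)
              exact mul_le_mul_of_nonneg_left kc (by positivity)
          _ = _ := by ring
      have e4 := mul_le_mul_of_nonneg_right e1 (hG0 [])
      have e5 := mul_le_mul_of_nonneg_left e3 hA0.le
      simp only [List.length_cons]
      linarith
    · have e1 : (1 + b) * (1 + q ^ M * d) * A u ≤ A (u ++ [true]) := by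
        have := h.right_shift hP M (List.replicate M true ++ u)
        simpa [hA] using this
      have e2 : G (u ++ [true]) ≤ (1 + b) * G u := by
        simp only [hG, Finset.mul_sum]
        refine Finset.sum_le_sum fun m _ => ?_
        have := mul_le_mul_of_nonneg_left (pathWeight_right hq0 hq1 hb u m) (pow_nonneg ha m)
        linarith
      have e3 : κ ^ (u.length + 1) * G (u ++ [true]) ≤
          (1 + b) * (1 + q ^ M * d) * (κ ^ u.length * G u) := by
        rw [pow_succ]
        calc κ ^ u.length * κ * G (u ++ [true])
            ≤ κ ^ u.length * (1 + q ^ M * d) * ((1 + b) * G u) := by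
              apply mul_le_mul _ e2 (hG0 _) (by positivity)
              exact mul_le_mul_of_nonneg_left kd (by positivity)
          _ = _ := by ring
      have e4 := mul_le_mul_of_nonneg_right e1 (hG0 [])
      have e5 := mul_le_mul_of_nonneg_left e3 hA0.le
      simp only [List.length_append, List.length_singleton]
      linarith
  have key := hB.nonneg hq0 hq1 le_rfl (by positivity) le_rfl (by positivity) (by norm_num)
    (by simp) v
  have hGn : a ^ n * pathWeight q b n v ≤ G v :=
    Finset.single_le_sum (f := fun m => a ^ m * pathWeight q b m v)
      (fun m _ => mul_nonneg (pow_nonneg ha _) (pathWeight_nonneg hq0 hq1 hb _ _))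
      (Finset.mem_range.2 (Nat.lt_succ_self n))
  have hGnil : (1 - a * b) * G [] ≤ 1 := by
    have : G [] = ∑ m ∈ Finset.range (n + 1), (a * b) ^ m := by
      simp [hG, pathWeight, mul_pow]
    rw [this, mul_comm, geom_sum_mul_neg]
    have : 0 ≤ (a * b) ^ (n + 1) := by positivity
    linarith
  have hAv : 0 ≤ A v := h.nonneg hP _
  calc A [] * (1 - a * b) * κ ^ v.length * (a ^ n * pathWeight q b n v)
      ≤ A [] * (1 - a * b) * κ ^ v.length * G v := by
        apply mul_le_mul_of_nonneg_left hGn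
        have : 0 ≤ 1 - a * b := by linarith
        positivity
    _ = (1 - a * b) * (A [] * (κ ^ v.length * G v)) := by ring
    _ ≤ (1 - a * b) * (A v * G []) := mul_le_mul_of_nonneg_left (by linarith) (by linarith)
    _ = A v * ((1 - a * b) * G []) := by ring
    _ ≤ A v := mul_le_of_le_one_right hAv hGnil

end IsMPA

/-- Sum of `g` over all words of length `n`. -/
noncomputable def wordSum : ℕ → (List Bool → ℝ) → ℝ
  | 0, g => g []
  | n + 1, g => wordSum n (fun w => g (true :: w)) + wordSum n (fun w => g (false :: w))

lemma wordSum_mono {n : ℕ} {g g' : List Bool → ℝ} (h : ∀ w, w.length = n → g w ≤ g' w) :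
    wordSum n g ≤ wordSum n g' := by
  induction n generalizing g g' with
  | zero => exact h [] rfl
  | succ n ih =>
    exact add_le_add (ih fun w hw => h _ (by simp [hw])) (ih fun w hw => h _ (by simp [hw]))

lemma wordSum_congr {n : ℕ} {g g' : List Bool → ℝ} (h : ∀ w, w.length = n → g w = g' w) :
    wordSum n g = wordSum n g' :=
  le_antisymm (wordSum_mono fun w hw => (h w hw).le) (wordSum_mono fun w hw => (h w hw).ge)

lemma wordSum_mul_left (n : ℕ) (x : ℝ) (g : List Bool → ℝ) :
    wordSum n (fun w => x * g w) = x * wordSum n g := by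
  induction n generalizing g with
  | zero => rfl
  | succ n ih => simp only [wordSum, ih, mul_add]

lemma wordSum_nonneg {n : ℕ} {g : List Bool → ℝ} (h : ∀ w, 0 ≤ g w) : 0 ≤ wordSum n g := by
  have := wordSum_mono (n := n) (g := fun w => 0 * g w) (g' := g) (fun w _ => by simpa using h w)
  rwa [wordSum_mul_left, zero_mul] at this

lemma wordSum_add (m n : ℕ) (g : List Bool → ℝ) :
    wordSum (m + n) g = wordSum m (fun u => wordSum n (fun v => g (u ++ v))) := by
  induction m generalizing g with
  | zero => simp [wordSum]
  | succ m ih =>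
    rw [show m + 1 + n = m + n + 1 by ring]
    simp only [wordSum, ih, List.cons_append]

lemma le_wordSum {g : List Bool → ℝ} (h : ∀ w, 0 ≤ g w) (w : List Bool) :
    g w ≤ wordSum w.length g := by
  induction w generalizing g with
  | nil => exact le_rfl
  | cons x w ih =>
    have h1 : ∀ x, 0 ≤ wordSum w.length (fun w => g (x :: w)) :=
      fun x => wordSum_nonneg fun w => h _
    cases x
    · exact (ih fun w => h (false :: w)).trans (le_add_of_nonneg_left (h1 _))
    · exact (ih fun w => h (true :: w)).trans (le_add_of_nonneg_right (h1 _))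

lemma sum_ofFn (n : ℕ) (g : List Bool → ℝ) :
    ∑ τ : Fin n → Bool, g (List.ofFn τ) = wordSum n g := by
  induction n generalizing g with
  | zero => simp [wordSum]
  | succ n ih =>
    rw [← (Fin.consEquiv fun _ => Bool).sum_comp, Fintype.sum_prod_type, Fintype.sum_bool]
    simp only [Fin.consEquiv, Equiv.coe_fn_mk, List.ofFn_succ, Fin.cons_zero, Fin.cons_succ,
      wordSum]
    rw [ih fun w => g (true :: w), ih fun w => g (false :: w)]

lemma wordSum_count (m k : ℕ) :
    wordSum m (fun w => if w.count true = k then 1 else 0) = m.choose k := by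
  induction m generalizing k with
  | zero => cases k <;> simp [wordSum]
  | succ m ih =>
    rcases k with _ | k
    · simp only [wordSum, List.count_cons_self, Nat.add_eq_zero_iff, one_ne_zero, and_false, if_false]
      have h0 := wordSum_mul_left m 0 (fun _ => 0)
      simp only [mul_zero, zero_mul] at h0
      have : ∀ w : List Bool, (false :: w).count true = w.count true := fun w =>
        List.count_cons_of_ne (by decide)
      simp only [h0, this, ih]; simp
    · have : ∀ w : List Bool, (false :: w).count true = w.count true := fun w =>
        List.count_cons_of_ne (by decide)
      simp only [wordSum, List.count_cons_self, this, Nat.add_right_cancel_iff, ih]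
      rw [Nat.choose_succ_succ]; push_cast; ring

/-- Words whose `r`-th block, of length `m r`, contains `k r` particles for all `r < B`. -/
def BlockCounts (m k : ℕ → ℕ) (B : ℕ) (w : List Bool) : Prop :=
  ∀ r ≤ B, (w.take (∑ s ∈ Finset.range r, m s)).count true = ∑ s ∈ Finset.range r, k s

lemma blockCounts_append {m k : ℕ → ℕ} {B : ℕ} {u v : List Bool}
    (hu : u.length = ∑ s ∈ Finset.range B, m s) (hv : v.length = m B) :
    BlockCounts m k (B + 1) (u ++ v) ↔ BlockCounts m k B u ∧ v.count true = k B := by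
  have hpre : ∀ r ≤ B, (u ++ v).take (∑ s ∈ Finset.range r, m s) =
      u.take (∑ s ∈ Finset.range r, m s) := by
    intro r hr
    apply List.take_append_of_le_length
    rw [hu]
    exact Finset.sum_le_sum_of_subset (Finset.range_mono hr)
  have hall : (u ++ v).take (∑ s ∈ Finset.range (B + 1), m s) = u ++ v := by
    apply List.take_of_length_le
    rw [List.length_append, hu, hv, Finset.sum_range_succ]
  constructor
  · intro h
    have h1 : BlockCounts m k B u := fun r hr => by rw [← hpre r hr]; exact h r (by omega)
    refine ⟨h1, ?_⟩
    have h2 := h (B + 1) le_rfl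
    have h3 := h1 B le_rfl
    rw [hall, List.count_append, Finset.sum_range_succ] at h2
    rw [List.take_of_length_le hu.le] at h3
    omega
  · rintro ⟨h1, h2⟩ r hr
    rcases Nat.lt_or_ge B r with h | h
    · obtain rfl : r = B + 1 := by omega
      have h3 := h1 B le_rfl
      rw [List.take_of_length_le hu.le] at h3
      rw [hall, List.count_append, Finset.sum_range_succ, h3, h2]
    · rw [hpre r h]; exact h1 r h

lemma wordSum_blockCounts (m k : ℕ → ℕ) (B : ℕ) :
    wordSum (∑ s ∈ Finset.range B, m s) (fun w => if BlockCounts m k B w then 1 else 0) =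
      ∏ s ∈ Finset.range B, ((m s).choose (k s) : ℝ) := by
  induction B with
  | zero => simp [wordSum, BlockCounts]
  | succ B ih =>
    rw [Finset.sum_range_succ, wordSum_add, Finset.prod_range_succ, ← ih, mul_comm,
      ← wordSum_mul_left]
    refine wordSum_congr fun u hu => ?_
    rw [← wordSum_count, mul_comm, ← wordSum_mul_left]
    refine wordSum_congr fun v hv => ?_
    rw [blockCounts_append hu hv]
    by_cases h1 : BlockCounts m k B u <;> by_cases h2 : v.count true = k B <;> simp [h1, h2]

lemma pathWeight_blocks {q b : ℝ} {h₀ : ℕ} (hq0 : 0 ≤ q) (hq1 : q < 1) (hb : 0 ≤ b)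
    (m k u z n : ℕ → ℕ) (B : ℕ) (w rest : List Bool)
    (hw : w.length = ∑ s ∈ Finset.range B, m s) (hc : BlockCounts m k B w)
    (hn : ∀ r < B, h₀ + (m r - k r) ≤ n r) (hn' : ∀ r < B, n (r + 1) + z r = n r + u r) :
    (1 - q ^ h₀) ^ w.length *
      (∏ r ∈ Finset.range B, ((k r).choose (u r) * (m r - k r).choose (z r) : ℝ)) *
      pathWeight q b (n B) rest ≤ pathWeight q b (n 0) (w ++ rest) := by
  induction B generalizing w rest with
  | zero =>
    have : w = [] := by simpa using hw
    subst this; simp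
  | succ B ih =>
    rw [Finset.sum_range_succ] at hw
    obtain ⟨x, y, rfl, hx, hy⟩ : ∃ x y, w = x ++ y ∧
        x.length = ∑ s ∈ Finset.range B, m s ∧ y.length = m B :=
      ⟨w.take (∑ s ∈ Finset.range B, m s), w.drop (∑ s ∈ Finset.range B, m s), by simp,
        by simp [hw], by simp [hw]⟩
    obtain ⟨h1, h2⟩ := (blockCounts_append hx hy).1 hc
    have h3 : y.count false = m B - k B := by
      have : y.count true + y.count false = y.length := by simp [List.count_true_add_count_false]
      omega
    have key := ih x (y ++ rest) hx h1 (fun r hr => hn r (by omega)) (fun r hr => hn' r (by omega))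
    have hblk := pathWeight_block (h₀ := h₀) hq0 hq1 hb y rest (n B) (n (B + 1)) (u B) (z B)
      (by rw [h3]; exact hn B (by omega)) (hn' B (by omega))
    rw [h2, h3] at hblk
    rw [List.append_assoc]
    refine le_trans ?_ key
    have r0 : 0 ≤ 1 - q ^ h₀ := by linarith [pow_le_one₀ (n := h₀) hq0 hq1.le]
    have h4 : 0 ≤ (1 - q ^ h₀) ^ x.length *
      (∏ r ∈ Finset.range B, ((k r).choose (u r) * (m r - k r).choose (z r) : ℝ)) :=
      mul_nonneg (pow_nonneg r0 _) (Finset.prod_nonneg fun _ _ => by positivity)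
    refine le_trans (le_of_eq ?_) (mul_le_mul_of_nonneg_left hblk h4)
    rw [List.length_append, pow_add, Finset.prod_range_succ]
    ring

/-- Lower bound for the total weight of a set of configurations containing all words with
prescribed block counts. -/
lemma IsMPA.sum_lower {a b c d q : ℝ} {F : List Bool → ℝ} (h : IsMPA a b c d q F)
    (hP : FanParams a b c d q) {κ : ℝ} (hκ : κ < 1) (hκ0 : 0 ≤ κ) :
    ∃ M : ℕ, ∃ C : ℝ, 0 < C ∧ ∀ (N K K' B h₀ n₀ n' : ℕ) (m k u z n : ℕ → ℕ)
      (S : (Fin N → Bool) → Prop) [DecidablePred S],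
      N = M + (K + (∑ s ∈ Finset.range B, m s + (K' + M))) → n 0 = n₀ + K → n' ≤ n B →
      n B ≤ n' + K' → (∀ r < B, h₀ + (m r - k r) ≤ n r) →
      (∀ r < B, n (r + 1) + z r = n r + u r) →
      (∀ τ : Fin N → Bool, (∀ r ≤ B,
        ((List.ofFn τ).take (M + K + ∑ s ∈ Finset.range r, m s)).count true =
          M + K + ∑ s ∈ Finset.range r, k s) → S τ) →
      C * κ ^ N * (1 - q) ^ K * (1 - q ^ h₀) ^ N * (a ^ n₀ * b ^ n') *
        (∏ r ∈ Finset.range B, (((m r).choose (k r) : ℝ) *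
          ((k r).choose (u r) * (m r - k r).choose (z r)))) ≤
        ∑ τ : Fin N → Bool, if S τ then F (List.ofFn τ) else 0 := by
  obtain ⟨M, C, hC, H⟩ := h.pathWeight_le hP hκ hκ0
  obtain ⟨ha, hb, -, -, -, -, -, hq0, hq1⟩ := id hP
  refine ⟨M, C, hC, ?_⟩
  intro N K K' B h₀ n₀ n' m k u z n S _ hN hn0 hnB1 hnB2 hn hn' hS
  have r0 : 0 ≤ 1 - q ^ h₀ := by linarith [pow_le_one₀ (n := h₀) hq0 hq1.le]
  have r1 : 1 - q ^ h₀ ≤ 1 := by linarith [pow_nonneg hq0 h₀]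
  set p := ∑ s ∈ Finset.range B, m s with hp
  obtain ⟨E, hE⟩ : ∃ E : List Bool → Prop, ∀ w, E w ↔ ∀ r ≤ B,
    (w.take (M + K + ∑ s ∈ Finset.range r, m s)).count true =
      M + K + ∑ s ∈ Finset.range r, k s := ⟨_, fun _ => Iff.rfl⟩
  have hF0 := h.nonneg hP
  have s1 : wordSum N (fun w => if E w then F w else 0) ≤
      ∑ τ : Fin N → Bool, if S τ then F (List.ofFn τ) else 0 := by
    rw [← sum_ofFn]
    refine Finset.sum_le_sum fun τ _ => ?_
    by_cases h1 : E (List.ofFn τ)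
    · rw [if_pos h1, if_pos (hS τ ((hE _).1 h1))]
    · rw [if_neg h1]; split_ifs; exacts [hF0 _, le_rfl]
  refine le_trans ?_ s1
  set pre : List Bool := List.replicate M true ++ List.replicate K true with hpre
  set suf : List Bool := List.replicate K' false ++ List.replicate M false with hsuf
  have hprel : pre.length = M + K := by simp [hpre]
  have hprec : pre.count true = M + K := by simp [hpre]
  have hsufl : suf.length = K' + M := by simp [hsuf]
  have hg0 : ∀ w : List Bool, 0 ≤ if E w then F w else 0 := fun w => by
    split_ifs; exacts [hF0 _, le_rfl]
  have s2 : wordSum p (fun w => if E (pre ++ (w ++ suf)) then F (pre ++ (w ++ suf)) else 0) ≤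
      wordSum N (fun w => if E w then F w else 0) := by
    rw [hN, ← add_assoc, wordSum_add, ← hprel]
    refine le_trans ?_ (le_wordSum (fun w => wordSum_nonneg fun _ => hg0 _) pre)
    rw [wordSum_add]
    refine wordSum_mono fun w _ => ?_
    rw [← hsufl]
    exact le_wordSum (g := fun v => if E (pre ++ (w ++ v)) then F (pre ++ (w ++ v)) else 0)
      (fun _ => hg0 _) suf
  refine le_trans ?_ s2
  have s3 : ∀ w : List Bool, w.length = p → (C * κ ^ N * (1 - q) ^ K * (1 - q ^ h₀) ^ N *
      (a ^ n₀ * b ^ n') * ∏ r ∈ Finset.range B, ((k r).choose (u r) * (m r - k r).choose (z r) : ℝ))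
      * (if BlockCounts m k B w then 1 else 0) ≤
      if E (pre ++ (w ++ suf)) then F (pre ++ (w ++ suf)) else 0 := by
    intro w hw
    by_cases hc : BlockCounts m k B w
    · have hEw : E (pre ++ (w ++ suf)) := by
        refine (hE _).2 fun r hr => ?_
        have hle : ∑ s ∈ Finset.range r, m s ≤ w.length := by
          rw [hw]; exact Finset.sum_le_sum_of_subset (Finset.range_mono hr)
        rw [← hprel, List.take_length_add_append, List.count_append,
          List.take_append_of_le_length hle, hc r hr, hprec, hprel]
      rw [if_pos hc, if_pos hEw, mul_one]
      have e1 := H (List.replicate K true ++ (w ++ List.replicate K' false)) n₀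
      have e2 := pathWeight_replicate_true hq0 hq1 hb K n₀ (w ++ List.replicate K' false)
      have e3 := pathWeight_blocks (h₀ := h₀) hq0 hq1 hb m k u z n B w
        (List.replicate K' false) hw hc hn hn'
      have e4 := pathWeight_replicate_false hq0 hq1 hb K' (n B) n' hnB1 hnB2
      rw [← hn0] at e2
      set Pr := ∏ r ∈ Finset.range B, ((k r).choose (u r) * (m r - k r).choose (z r) : ℝ) with hPr
      have hPr0 : 0 ≤ Pr := Finset.prod_nonneg fun _ _ => by positivity
      have hwN : w.length ≤ N := by omega
      have hvN : (List.replicate K true ++ (w ++ List.replicate K' false)).length ≤ N := by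
        simp; omega
      have e5 : (1 - q ^ h₀) ^ N * Pr * b ^ n' ≤
          pathWeight q b (n 0) (w ++ List.replicate K' false) := by
        refine le_trans ?_ e3
        have := pow_le_pow_of_le_one r0 r1 hwN
        gcongr
      have hq2 : 0 ≤ 1 - q := by linarith
      have e6 : κ ^ N ≤ κ ^ (List.replicate K true ++ (w ++ List.replicate K' false)).length :=
        pow_le_pow_of_le_one hκ0 hκ.le hvN
      have e7 : F (pre ++ (w ++ suf)) = F (List.replicate M true ++
          (List.replicate K true ++ (w ++ List.replicate K' false) ++ List.replicate M false)) := by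
        simp only [hpre, hsuf, List.append_assoc]
      rw [e7]
      refine le_trans ?_ e1
      calc _ = C * κ ^ N * (a ^ n₀ * ((1 - q) ^ K * ((1 - q ^ h₀) ^ N * Pr * b ^ n'))) := by ring
        _ ≤ C * κ ^ N * (a ^ n₀ * ((1 - q) ^ K *
            pathWeight q b (n 0) (w ++ List.replicate K' false))) := by gcongr
        _ ≤ C * κ ^ N * (a ^ n₀ * pathWeight q b n₀ (List.replicate K true ++
            (w ++ List.replicate K' false))) := by gcongr
        _ ≤ _ := by
          apply mul_le_mul_of_nonneg_right (mul_le_mul_of_nonneg_left e6 hC.le)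
          exact mul_nonneg (pow_nonneg ha _) (pathWeight_nonneg hq0 hq1 hb _ _)
    · rw [if_neg hc, mul_zero]; exact hg0 _
  refine le_trans (le_of_eq ?_) (wordSum_mono s3)
  rw [wordSum_mul_left, wordSum_blockCounts, Finset.prod_mul_distrib]
  ring

/-- The continuous fraction of a unit site covered by `[0, y]`. -/
noncomputable def ramp (y : ℝ) : ℝ := min 1 (max 0 y)

lemma ramp_mono : Monotone ramp := fun _ _ h => min_le_min_left _ (max_le_max_left _ h)

lemma ramp_of_nonpos {y : ℝ} (h : y ≤ 0) : ramp y = 0 := by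
  rw [ramp, max_eq_left h, min_eq_right zero_le_one]

lemma ramp_of_one_le {y : ℝ} (h : 1 ≤ y) : ramp y = 1 := by
  rw [ramp, max_eq_right (by linarith), min_eq_left h]

lemma sum_ramp (N : ℕ) (y : ℝ) (h0 : 0 ≤ y) (h1 : y ≤ N) :
    ∑ k : Fin N, ramp (y - (k : ℕ)) = y := by
  rw [Fin.sum_univ_eq_sum_range (fun k => ramp (y - (k : ℝ)))]
  suffices H : ∀ n : ℕ, ∑ k ∈ Finset.range n, ramp (y - (k : ℝ)) = min (n : ℝ) y by
    rw [H, min_eq_right h1]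
  intro n
  induction n with
  | zero => simp [h0]
  | succ n ih =>
    rw [Finset.sum_range_succ, ih]
    push_cast
    rcases le_total y n with h | h
    · rw [ramp_of_nonpos (by linarith), min_eq_right h, min_eq_right (by linarith), add_zero]
    · rw [min_eq_left h]
      rcases le_total (n + 1 : ℝ) y with h' | h'
      · rw [ramp_of_one_le (by linarith), min_eq_left h']
      · rw [min_eq_right h', ramp, max_eq_right (by linarith), min_eq_right (by linarith)]
        ring

lemma evalC0_heightC0 (N : ℕ) (τ : Fin N → Bool) {t : ℝ} (ht : t ∈ Set.Icc (0 : ℝ) 1) :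
    evalC0 (heightC0 N τ) t =
      (N : ℝ)⁻¹ * ∑ k : Fin N, (if τ k = true then (1 : ℝ) else 0) * ramp (N * t - (k : ℕ)) := by
  simp only [evalC0, extendF, Set.projIcc_of_mem zero_le_one ht]
  rfl

lemma count_take_ofFn (N : ℕ) (τ : Fin N → Bool) (p : ℕ) :
    (((List.ofFn τ).take p).count true : ℝ) =
      ∑ k : Fin N, (if τ k = true then (1 : ℝ) else 0) * ramp ((p : ℝ) - (k : ℕ)) := by
  induction N generalizing p with
  | zero => simp
  | succ N ih =>
    rcases p with _ | p
    · rw [List.take_zero, List.count_nil, Nat.cast_zero]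
      refine (Finset.sum_eq_zero fun k _ => ?_).symm
      rw [ramp_of_nonpos (by simp), mul_zero]
    · rw [List.ofFn_succ, List.take_succ_cons, List.count_cons, Fin.sum_univ_succ]
      push_cast
      rw [ih, ramp_of_one_le (by simp), add_comm]
      congr 1
      · by_cases h : τ 0 <;> simp [h]
      · refine Finset.sum_congr rfl fun k _ => ?_
        congr 2
        simp

lemma abs_height_sub_count_le (N : ℕ) (τ : Fin N → Bool) {t : ℝ} (ht : t ∈ Set.Icc (0 : ℝ) 1)
    {p : ℕ} (hp : p ≤ N) (hN : 0 < N) :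
    |N * evalC0 (heightC0 N τ) t - ((List.ofFn τ).take p).count true| ≤ |N * t - p| := by
  have hN' : (0 : ℝ) < N := by exact_mod_cast hN
  rw [evalC0_heightC0 N τ ht, mul_inv_cancel_left₀ hN'.ne', count_take_ofFn]
  have hNt0 : 0 ≤ N * t := mul_nonneg hN'.le ht.1
  have hNt1 : N * t ≤ N := mul_le_of_le_one_right hN'.le ht.2
  have e1 := sum_ramp N (N * t) hNt0 hNt1
  have e2 := sum_ramp N p p.cast_nonneg (by exact_mod_cast hp)
  rw [← Finset.sum_sub_distrib]
  have main : ∀ y y' : ℝ, y ≤ y' → 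
      0 ≤ ∑ k : Fin N, ((if τ k = true then (1 : ℝ) else 0) * ramp (y' - (k : ℕ)) -
        (if τ k = true then (1 : ℝ) else 0) * ramp (y - (k : ℕ))) ∧
      ∑ k : Fin N, ((if τ k = true then (1 : ℝ) else 0) * ramp (y' - (k : ℕ)) -
        (if τ k = true then (1 : ℝ) else 0) * ramp (y - (k : ℕ))) ≤
      ∑ k : Fin N, ramp (y' - (k : ℕ)) - ∑ k : Fin N, ramp (y - (k : ℕ)) := by
    intro y y' h
    have hr : ∀ k : Fin N, ramp (y - (k : ℕ)) ≤ ramp (y' - (k : ℕ)) := fun k =>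
      ramp_mono (by linarith)
    rw [← Finset.sum_sub_distrib]
    constructor
    · refine Finset.sum_nonneg fun k _ => ?_
      have := hr k
      split_ifs <;> linarith
    · refine Finset.sum_le_sum fun k _ => ?_
      have := hr k
      split_ifs <;> linarith
  rcases le_total (N * t) p with h | h
  · obtain ⟨m1, m2⟩ := main _ _ h
    rw [e1, e2] at m2
    rw [abs_sub_comm (N * t), abs_of_nonneg (sub_nonneg.2 h), abs_le]
    simp only [Finset.sum_sub_distrib] at m1 m2 ⊢
    constructor <;> linarith
  · obtain ⟨m1, m2⟩ := main _ _ h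
    rw [e1, e2] at m2
    rw [abs_of_nonneg (sub_nonneg.2 h), abs_le]
    constructor <;> linarith

lemma le_log_factorial (n : ℕ) : n * Real.log n - n ≤ Real.log n.factorial := by
  rcases Nat.eq_zero_or_pos n with rfl | hn
  · simp
  have hn' : (0 : ℝ) < n := by exact_mod_cast hn
  have h := Real.pow_div_factorial_le_exp (n : ℝ) hn'.le n
  have h2 := Real.log_le_log (by positivity) h
  rw [Real.log_exp, Real.log_div (by positivity) (by positivity), Real.log_pow] at h2
  linarith

lemma log_factorial_le (n : ℕ) :
    Real.log n.factorial ≤ n * Real.log n - n + Real.log n + 1 := by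
  induction n with
  | zero => simp
  | succ n ih =>
    rcases Nat.eq_zero_or_pos n with rfl | hn
    · simp
    have hn' : (0 : ℝ) < n := by exact_mod_cast hn
    rw [Nat.factorial_succ, Nat.cast_mul, Real.log_mul (by positivity) (by positivity)]
    have h := Real.log_le_sub_one_of_pos (show (0 : ℝ) < n / (n + 1) by positivity)
    rw [Real.log_div (by positivity) (by positivity)] at h
    have h2 : ((n : ℝ) + 1) * (Real.log n - Real.log (n + 1)) ≤ -1 := by
      refine (mul_le_mul_of_nonneg_left h (by positivity)).trans (le_of_eq ?_)
      field_simp; ring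
    push_cast
    linarith

/-- `v` is an exponential lower growth rate of `f`. -/
def ExpLB (f : ℕ → ℝ) (v : ℝ) : Prop :=
  ∀ ε > 0, ∀ᶠ N : ℕ in Filter.atTop, Real.exp (N * (v - ε)) ≤ f N

namespace ExpLB

open Filter Topology

lemma mul {f g : ℕ → ℝ} {v w : ℝ} (hf : ExpLB f v) (hg : ExpLB g w) :
    ExpLB (fun N => f N * g N) (v + w) := by
  intro ε hε
  filter_upwards [hf (ε / 2) (by linarith), hg (ε / 2) (by linarith)] with N h1 h2
  have := mul_le_mul h1 h2 (Real.exp_pos _).le ((Real.exp_pos _).le.trans h1)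
  rw [← Real.exp_add] at this
  refine le_trans (le_of_eq ?_) this
  congr 1; ring

lemma one : ExpLB (fun _ => 1) 0 := by
  intro ε hε
  filter_upwards with N
  rw [Real.exp_le_one_iff]
  have : (0 : ℝ) ≤ N := N.cast_nonneg
  nlinarith

lemma prod {f : ℕ → ℕ → ℝ} {v : ℕ → ℝ} {B : ℕ} (h : ∀ r < B, ExpLB (fun N => f N r) (v r)) :
    ExpLB (fun N => ∏ r ∈ Finset.range B, f N r) (∑ r ∈ Finset.range B, v r) := by
  induction B with
  | zero => simpa using one
  | succ B ih =>
    simp only [Finset.prod_range_succ, Finset.sum_range_succ]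
    exact (ih fun r hr => h r (by omega)).mul (h B (by omega))

/-- Criterion through logarithms. -/
lemma of_log {f : ℕ → ℝ} {v : ℝ} {g : ℕ → ℝ} (hf : ∀ᶠ N in atTop, Real.exp (g N) ≤ f N)
    (hg : Tendsto (fun N : ℕ => g N / N) atTop (𝓝 v)) : ExpLB f v := by
  intro ε hε
  filter_upwards [hf, (tendsto_order.1 hg).1 (v - ε) (by linarith), eventually_gt_atTop 0]
    with N h1 h2 h3
  refine le_trans (Real.exp_le_exp.2 ?_) h1
  have hN : (0 : ℝ) < N := by exact_mod_cast h3
  rw [lt_div_iff₀ hN] at h2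
  linarith

lemma const {C : ℝ} (hC : 0 < C) : ExpLB (fun _ => C) 0 :=
  of_log (g := fun _ => Real.log C) (by simp [Real.exp_log hC])
    (tendsto_const_nhds.div_atTop tendsto_natCast_atTop_atTop)

lemma pow {a y : ℝ} (ha : 0 < a) {n : ℕ → ℕ} (hn : Tendsto (fun N => (n N : ℝ) / N) atTop (𝓝 y)) :
    ExpLB (fun N => a ^ n N) (y * Real.log a) := by
  refine of_log (g := fun N => n N * Real.log a) ?_ ?_
  · filter_upwards with N
    rw [mul_comm, Real.exp_mul, Real.exp_log ha, Real.rpow_natCast]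
  · simpa [div_mul_eq_mul_div] using hn.mul_const (Real.log a)

lemma tendsto_log_div : Tendsto (fun N : ℕ => Real.log N / N) atTop (𝓝 0) := by
  have h := (Real.isLittleO_log_id_atTop).tendsto_div_nhds_zero
  exact h.comp tendsto_natCast_atTop_atTop

lemma choose {n k : ℕ → ℕ} {ν κ : ℝ} (hkn : ∀ᶠ N in atTop, k N ≤ n N)
    (hn : Tendsto (fun N => (n N : ℝ) / N) atTop (𝓝 ν))
    (hk : Tendsto (fun N => (k N : ℝ) / N) atTop (𝓝 κ)) :
    ExpLB (fun N => ((n N).choose (k N) : ℝ))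
      (ν * Real.log ν - κ * Real.log κ - (ν - κ) * Real.log (ν - κ)) := by
  set ψ : ℝ → ℝ := fun x => x * Real.log x with hψ
  have hc : Continuous ψ := Real.continuous_mul_log
  have hC : ∃ A : ℝ, 0 < A ∧ ∀ᶠ N : ℕ in atTop, (n N : ℝ) ≤ A * N := by
    refine ⟨|ν| + 1, by positivity, ?_⟩
    filter_upwards [(tendsto_order.1 hn).2 (|ν| + 1) (by linarith [le_abs_self ν]),
      eventually_gt_atTop 0] with N h1 h2
    rw [div_lt_iff₀ (by exact_mod_cast h2)] at h1
    exact h1.le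
  obtain ⟨A, hA, hAN⟩ := hC
  refine of_log (g := fun N => N * (ψ (n N / N) - ψ (k N / N) - ψ (n N / N - k N / N))
    - 2 * (Real.log (A + 1) + Real.log N + 1)) ?_ ?_
  · filter_upwards [hkn, hAN, eventually_gt_atTop 0] with N h1 h2 h3
    have hN : (0 : ℝ) < N := by exact_mod_cast h3
    have hN1 : (1 : ℝ) ≤ N := by exact_mod_cast h3
    have hpos : (0 : ℝ) < (n N).choose (k N) := by exact_mod_cast Nat.choose_pos h1
    rw [← Real.le_log_iff_exp_le hpos, Nat.cast_choose ℝ h1,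
      Real.log_div (by positivity) (by positivity), Real.log_mul (by positivity) (by positivity)]
    have f1 := le_log_factorial (n N)
    have f2 := log_factorial_le (k N)
    have f3 := log_factorial_le (n N - k N)
    have hlog : ∀ j : ℕ, j ≤ n N → Real.log j ≤ Real.log (A + 1) + Real.log N := by
      intro j hj
      rw [← Real.log_mul (by positivity) hN.ne']
      rcases Nat.eq_zero_or_pos j with rfl | hj0
      · rw [Nat.cast_zero, Real.log_zero]
        exact Real.log_nonneg (by nlinarith)
      · apply Real.log_le_log (by exact_mod_cast hj0)
        have : (j : ℝ) ≤ n N := by exact_mod_cast hj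
        nlinarith
    have g2 := hlog (k N) h1
    have g3 := hlog (n N - k N) (Nat.sub_le _ _)
    have hs : ∀ x : ℝ, 0 ≤ x → N * ψ (x / N) = x * Real.log x - x * Real.log N := by
      intro x hx
      rcases hx.eq_or_lt with rfl | hx
      · simp [hψ]
      · simp only [hψ]
        rw [Real.log_div hx.ne' hN.ne']; field_simp
    have hkn' : (k N : ℝ) ≤ n N := by exact_mod_cast h1
    rw [← sub_div, mul_sub, mul_sub, hs _ (Nat.cast_nonneg _), hs _ (Nat.cast_nonneg _),
      hs _ (sub_nonneg.2 hkn')]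
    rw [Nat.cast_sub h1] at f3 g3
    linarith
  · have h1 := ((hc.tendsto ν).comp hn).sub ((hc.tendsto κ).comp hk)
    have h2 := h1.sub ((hc.tendsto (ν - κ)).comp (hn.sub hk))
    have h3 : Tendsto (fun N : ℕ => 2 * ((Real.log (A + 1) + 1) / N + Real.log N / N)) atTop
        (𝓝 (2 * (0 + 0))) :=
      ((tendsto_const_nhds.div_atTop tendsto_natCast_atTop_atTop).add tendsto_log_div).const_mul 2
    have h4 := h2.sub h3
    simp only [add_zero, mul_zero, sub_zero] at h4
    refine h4.congr' ?_
    filter_upwards [eventually_gt_atTop 0] with N h3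
    have hN : (0 : ℝ) < N := by exact_mod_cast h3
    simp only [Function.comp_apply]
    field_simp
    ring

end ExpLB

section Floors

open Filter Topology

lemma tendsto_floor_div {c : ℝ} (hc : 0 ≤ c) :
    Tendsto (fun N : ℕ => (⌊c * N⌋₊ : ℝ) / N) atTop (𝓝 c) :=
  (tendsto_nat_floor_mul_div_atTop hc).comp tendsto_natCast_atTop_atTop

lemma eventually_le_of_tendsto_div {f g : ℕ → ℕ} {x y : ℝ}
    (hf : Tendsto (fun N => (f N : ℝ) / N) atTop (𝓝 x))
    (hg : Tendsto (fun N => (g N : ℝ) / N) atTop (𝓝 y)) (h : x < y) :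
    ∀ᶠ N in atTop, f N ≤ g N := by
  filter_upwards [hf.eventually_lt hg h, eventually_gt_atTop 0] with N h1 h2
  have hN : (0 : ℝ) < N := by exact_mod_cast h2
  rw [div_lt_div_iff_of_pos_right hN] at h1
  exact_mod_cast h1.le

lemma tendsto_add_div {f g : ℕ → ℕ} {x y : ℝ}
    (hf : Tendsto (fun N => (f N : ℝ) / N) atTop (𝓝 x))
    (hg : Tendsto (fun N => (g N : ℝ) / N) atTop (𝓝 y)) :
    Tendsto (fun N => ((f N + g N : ℕ) : ℝ) / N) atTop (𝓝 (x + y)) := by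
  simpa [add_div] using hf.add hg

lemma tendsto_sub_div {f g : ℕ → ℕ} {x y : ℝ} (h : ∀ᶠ N in atTop, g N ≤ f N)
    (hf : Tendsto (fun N => (f N : ℝ) / N) atTop (𝓝 x))
    (hg : Tendsto (fun N => (g N : ℝ) / N) atTop (𝓝 y)) :
    Tendsto (fun N => ((f N - g N : ℕ) : ℝ) / N) atTop (𝓝 (x - y)) := by
  refine (hf.sub hg).congr' ?_
  filter_upwards [h] with N hN
  rw [Nat.cast_sub hN, sub_div]

lemma tendsto_const_div' (C : ℕ) : Tendsto (fun N : ℕ => (C : ℝ) / N) atTop (𝓝 0) :=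
  tendsto_const_nhds.div_atTop tendsto_natCast_atTop_atTop

lemma tendsto_sum_div {f : ℕ → ℕ → ℕ} {x : ℕ → ℝ} {B : ℕ}
    (h : ∀ r < B, Tendsto (fun N => (f N r : ℝ) / N) atTop (𝓝 (x r))) :
    Tendsto (fun N => ((∑ r ∈ Finset.range B, f N r : ℕ) : ℝ) / N) atTop
      (𝓝 (∑ r ∈ Finset.range B, x r)) := by
  induction B with
  | zero => simp
  | succ B ih =>
    simp only [Finset.sum_range_succ]
    exact tendsto_add_div (ih fun r hr => h r (by omega)) (h B (by omega))

lemma ExpLB.pow_floor {a c : ℝ} (ha : 0 ≤ a) (hc : 0 ≤ c) (h : a = 0 → c = 0) :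
    ExpLB (fun N => a ^ ⌊c * N⌋₊) (c * Real.log a) := by
  rcases ha.eq_or_lt with rfl | ha
  · rw [h rfl]; simpa using ExpLB.one
  · exact ExpLB.pow ha (tendsto_floor_div hc)

lemma mul_log_split (c x : ℝ) :
    c * Real.log c - (c * x) * Real.log (c * x) - (c - c * x) * Real.log (c - c * x) =
      - (c * Hent x) := by
  by_cases hc : c = 0
  · subst hc; simp
  have h : ∀ z, c * z * Real.log (c * z) = c * z * Real.log c + c * (z * Real.log z) := by
    intro z
    by_cases hz : z = 0
    · subst hz; simp
    · rw [Real.log_mul hc hz]; ring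
  have h2 := h (1 - x)
  rw [show c * (1 - x) = c - c * x by ring] at h2
  rw [h, h2, Hent]; ring

variable {a b c d q : ℝ} {F : List Bool → ℝ}

lemma IsMPA.mesh_lower_fine (h : IsMPA a b c d q F) (hP : FanParams a b c d q) {B h₀ : ℕ}
    {Δ ρ G y : ℕ → ℝ} {η κ ε : ℝ} (hη0 : 0 < η) (hη1 : η < 1 / 4) (hΔ0 : ∀ r < B, 0 ≤ Δ r)
    (hΔη : ∀ r < B, Δ r < η) (hΔ1 : ∑ r ∈ Finset.range B, Δ r = 1)
    (hρ : ∀ r < B, ρ r ∈ Set.Icc (0 : ℝ) 1) (hG : ∀ r < B, G r ∈ Set.Icc (0 : ℝ) 1)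
    (hy0 : ∀ r ≤ B, 0 ≤ y r) (hy : ∀ r < B, y (r + 1) = y r + Δ r * (ρ r - G r))
    (hya : a = 0 → y 0 = 0) (hyb : b = 0 → y B = 0) (hκ0 : 0 < κ) (hκ1 : κ < 1)
    (hh₀ : h₀ ≠ 0) (hε : 5 * η < ε) :
    ExpLB (fun N => ∑ τ : Fin N → Bool, if ∀ r ≤ B, |evalC0 (heightC0 N τ)
        (∑ s ∈ Finset.range r, Δ s) - ∑ s ∈ Finset.range r, Δ s * ρ s| < ε
        then F (List.ofFn τ) else 0)
      (Real.log κ + η * Real.log (1 - q) + Real.log (1 - q ^ h₀) + (1 - 3 * η) *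
        (y 0 * Real.log a + y B * Real.log b -
          ∑ r ∈ Finset.range B, Δ r * (Hent (ρ r) + Hent (G r)))) := by
  obtain ⟨M, C, hC, H⟩ := h.sum_lower hP hκ1 hκ0.le
  obtain ⟨ha, hb, -, -, -, -, -, hq0, hq1⟩ := id hP
  set lam := 1 - 3 * η with hlam
  have hlam0 : 0 < lam := by linarith
  have hlam1 : lam ≤ 1 := by linarith
  set m : ℕ → ℕ → ℕ := fun N r => ⌊lam * Δ r * N⌋₊ with hm
  set k : ℕ → ℕ → ℕ := fun N r => ⌊lam * Δ r * ρ r * N⌋₊ with hk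
  set u : ℕ → ℕ → ℕ := fun N r => ⌊lam * Δ r * ρ r * (1 - G r) * N⌋₊ with hu
  set z : ℕ → ℕ → ℕ := fun N r => ⌊lam * Δ r * (1 - ρ r) * G r * N⌋₊ with hz
  set K : ℕ → ℕ := fun N => ⌊η * N⌋₊ with hK
  set n₀ : ℕ → ℕ := fun N => ⌊lam * y 0 * N⌋₊ with hn₀
  set n' : ℕ → ℕ := fun N => ⌊lam * y B * N⌋₊ with hn'
  set n : ℕ → ℕ → ℕ := fun N r => Nat.rec (n₀ N + K N) (fun r p => p + u N r - z N r) r with hn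
  have hnz : ∀ N, n N 0 = n₀ N + K N := fun N => rfl
  have hns : ∀ N r, n N (r + 1) = n N r + u N r - z N r := fun N r => rfl
  set K' : ℕ → ℕ := fun N => N - (M + (K N + (∑ r ∈ Finset.range B, m N r + M))) with hK'
  have hcm : ∀ r < B, 0 ≤ lam * Δ r := fun r hr => mul_nonneg hlam0.le (hΔ0 r hr)
  have hck : ∀ r < B, 0 ≤ lam * Δ r * ρ r := fun r hr => mul_nonneg (hcm r hr) (hρ r hr).1
  have hcu : ∀ r < B, 0 ≤ lam * Δ r * ρ r * (1 - G r) := fun r hr =>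
    mul_nonneg (hck r hr) (sub_nonneg.2 (hG r hr).2)
  have hcl : ∀ r < B, 0 ≤ lam * Δ r * (1 - ρ r) := fun r hr =>
    mul_nonneg (hcm r hr) (sub_nonneg.2 (hρ r hr).2)
  have hcz : ∀ r < B, 0 ≤ lam * Δ r * (1 - ρ r) * G r := fun r hr =>
    mul_nonneg (hcl r hr) (hG r hr).1
  have tm : ∀ r < B, Tendsto (fun N => (m N r : ℝ) / N) atTop (𝓝 (lam * Δ r)) :=
    fun r hr => tendsto_floor_div (hcm r hr)
  have tk : ∀ r < B, Tendsto (fun N => (k N r : ℝ) / N) atTop (𝓝 (lam * Δ r * ρ r)) :=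
    fun r hr => tendsto_floor_div (hck r hr)
  have tu : ∀ r < B, Tendsto (fun N => (u N r : ℝ) / N) atTop
      (𝓝 (lam * Δ r * ρ r * (1 - G r))) := fun r hr => tendsto_floor_div (hcu r hr)
  have tz : ∀ r < B, Tendsto (fun N => (z N r : ℝ) / N) atTop
      (𝓝 (lam * Δ r * (1 - ρ r) * G r)) := fun r hr => tendsto_floor_div (hcz r hr)
  have tK : Tendsto (fun N => (K N : ℝ) / N) atTop (𝓝 η) := tendsto_floor_div hη0.le
  have tn₀ : Tendsto (fun N => (n₀ N : ℝ) / N) atTop (𝓝 (lam * y 0)) :=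
    tendsto_floor_div (mul_nonneg hlam0.le (hy0 0 (by omega)))
  have tn' : Tendsto (fun N => (n' N : ℝ) / N) atTop (𝓝 (lam * y B)) :=
    tendsto_floor_div (mul_nonneg hlam0.le (hy0 B le_rfl))
  have hkm : ∀ N, ∀ r < B, k N r ≤ m N r := fun N r hr => Nat.floor_mono
    (mul_le_mul_of_nonneg_right (mul_le_of_le_one_right (hcm r hr) (hρ r hr).2) N.cast_nonneg)
  have huk : ∀ N, ∀ r < B, u N r ≤ k N r := fun N r hr => Nat.floor_mono
    (mul_le_mul_of_nonneg_right (mul_le_of_le_one_right (hck r hr) (by linarith [(hG r hr).1]))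
      N.cast_nonneg)
  have hzl : ∀ N, ∀ r < B, z N r ≤ m N r - k N r := fun N r hr => by
    have h1 : z N r ≤ ⌊lam * Δ r * (1 - ρ r) * N⌋₊ := Nat.floor_mono
      (mul_le_mul_of_nonneg_right (mul_le_of_le_one_right (hcl r hr) (hG r hr).2) N.cast_nonneg)
    have h2 : k N r + ⌊lam * Δ r * (1 - ρ r) * N⌋₊ ≤ m N r := by
      apply Nat.le_floor
      push_cast
      have e1 := Nat.floor_le (mul_nonneg (hck r hr) N.cast_nonneg)
      have e2 := Nat.floor_le (mul_nonneg (hcl r hr) N.cast_nonneg)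
      simp only [hk]
      linarith
    omega
  have tl : ∀ r < B, Tendsto (fun N => ((m N r - k N r : ℕ) : ℝ) / N) atTop
      (𝓝 (lam * Δ r - lam * Δ r * ρ r)) := fun r hr =>
    tendsto_sub_div (Eventually.of_forall fun N => hkm N r hr) (tm r hr) (tk r hr)
  have hcl_lt : ∀ r < B, lam * Δ r * (1 - ρ r) < η + lam * y r := fun r hr => by
    have e1 : lam * Δ r * (1 - ρ r) ≤ lam * Δ r :=
      mul_le_of_le_one_right (hcm r hr) (by linarith [(hρ r hr).1])
    have e2 : lam * Δ r ≤ Δ r := mul_le_of_le_one_left (hΔ0 r hr) hlam1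
    have e3 := mul_nonneg hlam0.le (hy0 r hr.le)
    linarith [hΔη r hr]
  have tn : ∀ r ≤ B, Tendsto (fun N => (n N r : ℝ) / N) atTop (𝓝 (η + lam * y r)) := by
    intro r
    induction r with
    | zero => intro _; simpa [hnz, add_comm] using tendsto_add_div tn₀ tK
    | succ r ih =>
      intro hr
      have i1 := ih (by omega)
      have hz_le : ∀ᶠ N in atTop, z N r ≤ n N r + u N r := by
        have : ∀ᶠ N in atTop, z N r ≤ n N r := eventually_le_of_tendsto_div (tz r hr) i1
          (lt_of_le_of_lt (mul_le_of_le_one_right (hcl r hr) (hG r hr).2) (hcl_lt r hr))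
        filter_upwards [this] with N hN; omega
      have := tendsto_sub_div hz_le (tendsto_add_div i1 (tu r hr)) (tz r hr)
      simp only [hns]
      convert this using 2
      rw [hy r hr]; ring
  have tsm : ∀ j ≤ B, Tendsto (fun N => ((∑ r ∈ Finset.range j, m N r : ℕ) : ℝ) / N) atTop
      (𝓝 (∑ r ∈ Finset.range j, lam * Δ r)) := fun j hj =>
    tendsto_sum_div fun r hr => tm r (by omega)
  have tsk : ∀ j ≤ B, Tendsto (fun N => ((∑ r ∈ Finset.range j, k N r : ℕ) : ℝ) / N) atTop
      (𝓝 (∑ r ∈ Finset.range j, lam * Δ r * ρ r)) := fun j hj =>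
    tendsto_sum_div fun r hr => tk r (by omega)
  have hsB : ∑ r ∈ Finset.range B, lam * Δ r = lam := by
    rw [← Finset.mul_sum, hΔ1, mul_one]
  have ttot : Tendsto (fun N => ((M + (K N + (∑ r ∈ Finset.range B, m N r + M)) : ℕ) : ℝ) / N)
      atTop (𝓝 (0 + (η + (lam + 0)))) := by
    have := tsm B le_rfl
    rw [hsB] at this
    exact tendsto_add_div (tendsto_const_div' M) (tendsto_add_div tK
      (tendsto_add_div this (tendsto_const_div' M)))
  have tid : Tendsto (fun N : ℕ => (N : ℝ) / N) atTop (𝓝 1) := by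
    refine tendsto_const_nhds.congr' ?_
    filter_upwards [eventually_gt_atTop 0] with N hN
    have : (N : ℝ) ≠ 0 := by positivity
    rw [div_self this]
  have htot : ∀ᶠ N in atTop, M + (K N + (∑ r ∈ Finset.range B, m N r + M)) ≤ N :=
    eventually_le_of_tendsto_div ttot tid (by linarith)
  have tK' : Tendsto (fun N => (K' N : ℝ) / N) atTop (𝓝 (2 * η)) := by
    have := tendsto_sub_div (f := fun N => N) htot tid ttot
    convert this using 2
    linarith
  have ev1 : ∀ᶠ N in atTop, ∀ r < B, h₀ + (m N r - k N r) ≤ n N r := by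
    have : ∀ r ∈ Finset.range B, ∀ᶠ N in atTop, h₀ + (m N r - k N r) ≤ n N r := by
      intro r hr
      have hr := Finset.mem_range.1 hr
      refine eventually_le_of_tendsto_div (tendsto_add_div (tendsto_const_div' h₀) (tl r hr))
        (tn r hr.le) ?_
      have := hcl_lt r hr
      linarith
    filter_upwards [(Finset.eventually_all _).2 this] with N hN r hr
    exact hN r (Finset.mem_range.2 hr)
  have ev2 : ∀ᶠ N in atTop, n' N ≤ n N B :=
    eventually_le_of_tendsto_div tn' (tn B le_rfl) (by linarith)
  have ev3 : ∀ᶠ N in atTop, n N B ≤ n' N + K' N :=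
    eventually_le_of_tendsto_div (tn B le_rfl) (tendsto_add_div tn' tK') (by linarith)
  have ev4 : ∀ᶠ N : ℕ in atTop, ∀ r ≤ B,
      |(∑ s ∈ Finset.range r, Δ s) - ((M + K N + ∑ s ∈ Finset.range r, m N s : ℕ) : ℝ) / N| +
      |((M + K N + ∑ s ∈ Finset.range r, k N s : ℕ) : ℝ) / N - ∑ s ∈ Finset.range r, Δ s * ρ s|
        < ε := by
    have : ∀ r ∈ Finset.range (B + 1), ∀ᶠ N : ℕ in atTop,
      |(∑ s ∈ Finset.range r, Δ s) - ((M + K N + ∑ s ∈ Finset.range r, m N s : ℕ) : ℝ) / N| +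
      |((M + K N + ∑ s ∈ Finset.range r, k N s : ℕ) : ℝ) / N - ∑ s ∈ Finset.range r, Δ s * ρ s|
        < ε := by
      intro r hr
      have hr : r ≤ B := by have := Finset.mem_range.1 hr; omega
      have e1 := tendsto_add_div (tendsto_add_div (tendsto_const_div' M) tK) (tsm r hr)
      have e2 := tendsto_add_div (tendsto_add_div (tendsto_const_div' M) tK) (tsk r hr)
      have e3 := ((e1.const_sub (∑ s ∈ Finset.range r, Δ s)).abs).add
        ((e2.sub_const (∑ s ∈ Finset.range r, Δ s * ρ s)).abs)
      refine (tendsto_order.1 e3).2 ε ?_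
      have hsub : Finset.range r ⊆ Finset.range B := Finset.range_mono hr
      have t0 : 0 ≤ ∑ s ∈ Finset.range r, Δ s := Finset.sum_nonneg fun s hs =>
        hΔ0 s (Finset.mem_range.1 (hsub hs))
      have t1 : ∑ s ∈ Finset.range r, Δ s ≤ 1 := by
        rw [← hΔ1]
        exact Finset.sum_le_sum_of_subset_of_nonneg hsub fun s hs _ =>
          hΔ0 s (Finset.mem_range.1 hs)
      have x0 : 0 ≤ ∑ s ∈ Finset.range r, Δ s * ρ s := Finset.sum_nonneg fun s hs =>
        mul_nonneg (hΔ0 s (Finset.mem_range.1 (hsub hs))) (hρ s (Finset.mem_range.1 (hsub hs))).1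
      have x1 : ∑ s ∈ Finset.range r, Δ s * ρ s ≤ ∑ s ∈ Finset.range r, Δ s :=
        Finset.sum_le_sum fun s hs => mul_le_of_le_one_right
          (hΔ0 s (Finset.mem_range.1 (hsub hs))) (hρ s (Finset.mem_range.1 (hsub hs))).2
      have s1 : ∑ s ∈ Finset.range r, lam * Δ s = lam * ∑ s ∈ Finset.range r, Δ s := by
        rw [Finset.mul_sum]
      have s2 : ∑ s ∈ Finset.range r, lam * Δ s * ρ s =
          lam * ∑ s ∈ Finset.range r, Δ s * ρ s := by
        rw [Finset.mul_sum]; exact Finset.sum_congr rfl fun _ _ => by ring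
      rw [s1, s2]
      set t := ∑ s ∈ Finset.range r, Δ s
      set x := ∑ s ∈ Finset.range r, Δ s * ρ s
      have a1 : |t - (0 + η + lam * t)| ≤ 2 * η := by rw [abs_le]; constructor <;> nlinarith
      have a2 : |0 + η + lam * x - x| ≤ 2 * η := by rw [abs_le]; constructor <;> nlinarith
      linarith
    filter_upwards [(Finset.eventually_all _).2 this] with N hN r hr
    exact hN r (Finset.mem_range.2 (by omega))
  have hlow : ∀ᶠ N : ℕ in atTop, C * κ ^ N * (1 - q) ^ K N * (1 - q ^ h₀) ^ N *
      (a ^ n₀ N * b ^ n' N) * (∏ r ∈ Finset.range B, (((m N r).choose (k N r) : ℝ) *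
          ((k N r).choose (u N r) * (m N r - k N r).choose (z N r)))) ≤
      ∑ τ : Fin N → Bool, if ∀ r ≤ B, |evalC0 (heightC0 N τ)
        (∑ s ∈ Finset.range r, Δ s) - ∑ s ∈ Finset.range r, Δ s * ρ s| < ε
        then F (List.ofFn τ) else 0 := by
    filter_upwards [htot, ev1, ev2, ev3, ev4, eventually_gt_atTop 0] with N h1 h2 h3 h4 h5 h6
    refine H N (K N) (K' N) B h₀ (n₀ N) (n' N) (m N) (k N) (u N) (z N) (n N) _ ?_ (hnz N) h3 h4 h2
      ?_ ?_
    · simp only [hK']; omega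
    · intro r hr
      have := h2 r hr
      have := hzl N r hr
      rw [hns]; omega
    · intro τ hτ r hr
      have hN : (0 : ℝ) < N := by exact_mod_cast h6
      have hsub : Finset.range r ⊆ Finset.range B := Finset.range_mono hr
      have t0 : 0 ≤ ∑ s ∈ Finset.range r, Δ s := Finset.sum_nonneg fun s hs =>
        hΔ0 s (Finset.mem_range.1 (hsub hs))
      have t1 : ∑ s ∈ Finset.range r, Δ s ≤ 1 := by
        rw [← hΔ1]
        exact Finset.sum_le_sum_of_subset_of_nonneg hsub fun s hs _ =>
          hΔ0 s (Finset.mem_range.1 hs)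
      have hp : M + K N + ∑ s ∈ Finset.range r, m N s ≤ N := by
        have : ∑ s ∈ Finset.range r, m N s ≤ ∑ s ∈ Finset.range B, m N s :=
          Finset.sum_le_sum_of_subset hsub
        omega
      have e1 := abs_height_sub_count_le N τ ⟨t0, t1⟩ hp h6
      rw [hτ r hr] at e1
      have e2 := h5 r hr
      set P := ((M + K N + ∑ s ∈ Finset.range r, m N s : ℕ) : ℝ)
      set Q := ((M + K N + ∑ s ∈ Finset.range r, k N s : ℕ) : ℝ)
      set t := ∑ s ∈ Finset.range r, Δ s
      set x := ∑ s ∈ Finset.range r, Δ s * ρ s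
      set hgt := evalC0 (heightC0 N τ) t
      have e3 : |hgt - Q / N| ≤ |t - P / N| := by
        rw [show hgt - Q / N = (N * hgt - Q) / N by field_simp,
          show t - P / N = (N * t - P) / N by field_simp, abs_div, abs_div]
        gcongr
      calc |hgt - x| = |(hgt - Q / N) + (Q / N - x)| := by ring_nf
        _ ≤ |hgt - Q / N| + |Q / N - x| := abs_add_le _ _
        _ < ε := by linarith
  have hr0 : 0 < 1 - q ^ h₀ := by
    have := pow_lt_one₀ hq0 hq1 hh₀
    linarith
  have hq2 : 0 < 1 - q := by linarith
  have g1 := ((((ExpLB.const hC).mul (ExpLB.pow hκ0 tid)).mul (ExpLB.pow hq2 tK)).mul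
    (ExpLB.pow hr0 tid)).mul ((ExpLB.pow_floor ha (mul_nonneg hlam0.le (hy0 0 (by omega)))
      (fun h => by rw [hya h, mul_zero])).mul (ExpLB.pow_floor hb
        (mul_nonneg hlam0.le (hy0 B le_rfl)) (fun h => by rw [hyb h, mul_zero])))
  have g2 := ExpLB.prod (B := B) fun r hr =>
    (ExpLB.choose (Eventually.of_forall fun N => hkm N r hr) (tm r hr) (tk r hr)).mul
      ((ExpLB.choose (Eventually.of_forall fun N => huk N r hr) (tk r hr) (tu r hr)).mul
      (ExpLB.choose (Eventually.of_forall fun N => hzl N r hr) (tl r hr) (tz r hr)))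
  intro δ hδ
  filter_upwards [(g1.mul g2) δ hδ, hlow] with N h1 h2
  refine le_trans (le_of_eq ?_) (h1.trans h2)
  congr 3
  have : ∀ r ∈ Finset.range B, (lam * Δ r * Real.log (lam * Δ r) -
      lam * Δ r * ρ r * Real.log (lam * Δ r * ρ r) -
        (lam * Δ r - lam * Δ r * ρ r) * Real.log (lam * Δ r - lam * Δ r * ρ r) +
      (lam * Δ r * ρ r * Real.log (lam * Δ r * ρ r) -
        lam * Δ r * ρ r * (1 - G r) * Real.log (lam * Δ r * ρ r * (1 - G r)) -
        (lam * Δ r * ρ r - lam * Δ r * ρ r * (1 - G r)) *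
          Real.log (lam * Δ r * ρ r - lam * Δ r * ρ r * (1 - G r)) +
      ((lam * Δ r - lam * Δ r * ρ r) * Real.log (lam * Δ r - lam * Δ r * ρ r) -
        lam * Δ r * (1 - ρ r) * G r * Real.log (lam * Δ r * (1 - ρ r) * G r) -
        (lam * Δ r - lam * Δ r * ρ r - lam * Δ r * (1 - ρ r) * G r) *
          Real.log (lam * Δ r - lam * Δ r * ρ r - lam * Δ r * (1 - ρ r) * G r)))) =
      -(lam * (Δ r * (Hent (ρ r) + Hent (G r)))) := by
    intro r _
    have e1 := mul_log_split (lam * Δ r) (ρ r)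
    have e2 := mul_log_split (lam * Δ r * ρ r) (1 - G r)
    have e3 := mul_log_split (lam * Δ r * (1 - ρ r)) (G r)
    have e4 : Hent (1 - G r) = Hent (G r) := by simp only [Hent, sub_sub_cancel]; ring
    rw [show lam * Δ r * (1 - ρ r) = lam * Δ r - lam * Δ r * ρ r by ring] at e3 ⊢
    rw [e4] at e2
    rw [e1, e2, e3]; ring
  rw [Finset.sum_congr rfl this, Finset.sum_neg_distrib, ← Finset.mul_sum]
  ring

end Floors

lemma sum_range_div {R : ℕ} (hR : 0 < R) (f : ℕ → ℝ) (j i : ℕ) (hi : i ≤ R) :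
    ∑ s ∈ Finset.range (j * R + i), f (s / R) / R =
      ∑ r ∈ Finset.range j, f r + i / R * f j := by
  have hR' : (0 : ℝ) < R := by exact_mod_cast hR
  have aux : ∀ j i, i ≤ R → ∑ s ∈ Finset.range (j * R + i), f (s / R) / R =
      ∑ s ∈ Finset.range (j * R), f (s / R) / R + i / R * f j := by
    intro j i
    induction i with
    | zero => simp
    | succ i ih =>
      intro hi
      rw [← add_assoc, Finset.sum_range_succ, ih (by omega)]
      have : (j * R + i) / R = j := by
        rw [mul_comm, Nat.mul_add_div hR, Nat.div_eq_of_lt (by omega), add_zero]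
      rw [this]; push_cast; ring
  rw [aux j i hi]
  congr 1
  clear hi
  induction j with
  | zero => simp
  | succ j ih =>
    rw [add_mul, one_mul, aux j R le_rfl, ih, Finset.sum_range_succ, div_self hR'.ne', one_mul]

lemma IsMPA.mesh_lower {a b c d q : ℝ} {F : List Bool → ℝ} (h : IsMPA a b c d q F)
    (hP : FanParams a b c d q) {B : ℕ} {Δ ρ G y : ℕ → ℝ} {ε : ℝ} (hε : 0 < ε)
    (hΔ0 : ∀ r < B, 0 ≤ Δ r) (hΔ1 : ∑ r ∈ Finset.range B, Δ r = 1)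
    (hρ : ∀ r < B, ρ r ∈ Set.Icc (0 : ℝ) 1) (hG : ∀ r < B, G r ∈ Set.Icc (0 : ℝ) 1)
    (hy0 : ∀ r ≤ B, 0 ≤ y r) (hy : ∀ r < B, y (r + 1) = y r + Δ r * (ρ r - G r))
    (hya : a = 0 → y 0 = 0) (hyb : b = 0 → y B = 0) :
    ExpLB (fun N => ∑ τ : Fin N → Bool, if ∀ r ≤ B, |evalC0 (heightC0 N τ)
        (∑ s ∈ Finset.range r, Δ s) - ∑ s ∈ Finset.range r, Δ s * ρ s| < ε
        then F (List.ofFn τ) else 0)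
      (y 0 * Real.log a + y B * Real.log b -
          ∑ r ∈ Finset.range B, Δ r * (Hent (ρ r) + Hent (G r))) := by
  set V := y 0 * Real.log a + y B * Real.log b -
          ∑ r ∈ Finset.range B, Δ r * (Hent (ρ r) + Hent (G r)) with hV
  have hq0 := hP.hq0
  have hq1 := hP.hq1
  intro δ hδ
  obtain ⟨η, hη0, hη1, hη2, hη3⟩ : ∃ η : ℝ, 0 < η ∧ η < 1 / 4 ∧ 5 * η < ε ∧
      η * (|Real.log (1 - q)| + 3 * |V|) < δ / 4 := by
    have hcont : Filter.Tendsto (fun η : ℝ => η * (|Real.log (1 - q)| + 3 * |V|))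
        (nhdsWithin 0 (Set.Ioi 0)) (nhds 0) := by
      have : Continuous (fun η : ℝ => η * (|Real.log (1 - q)| + 3 * |V|)) := by fun_prop
      simpa using (this.tendsto 0).mono_left nhdsWithin_le_nhds
    have h1 := (tendsto_order.1 hcont).2 (δ / 4) (by linarith)
    have h2 : ∀ᶠ η : ℝ in nhdsWithin 0 (Set.Ioi 0), η < min (1 / 4) (ε / 5) :=
      nhdsWithin_le_nhds (Iio_mem_nhds (lt_min (by norm_num) (by linarith)))
    obtain ⟨η, e1, e2, e3⟩ := (h1.and (h2.and self_mem_nhdsWithin)).exists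
    rw [lt_min_iff] at e2
    exact ⟨η, e3, e2.1, by linarith [e2.2], e1⟩
  obtain ⟨h₀, hh₀, hh₁⟩ : ∃ h₀ : ℕ, h₀ ≠ 0 ∧ -(δ / 4) < Real.log (1 - q ^ h₀) := by
    have h1 : Filter.Tendsto (fun j : ℕ => Real.log (1 - q ^ j)) Filter.atTop (nhds 0) := by
      have h2 := (tendsto_pow_atTop_nhds_zero_of_lt_one hq0 hq1).const_sub 1
      rw [sub_zero] at h2
      simpa using h2.log (by norm_num)
    obtain ⟨j, e1, e2⟩ := (((tendsto_order.1 h1).1 (-(δ / 4)) (by linarith)).and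
      (Filter.eventually_ne_atTop 0)).exists
    exact ⟨j, e2, e1⟩
  obtain ⟨R, hR⟩ := exists_nat_gt (1 / η)
  have hRpos' : (0 : ℝ) < R := lt_trans (by positivity) hR
  have hRpos : 0 < R := by exact_mod_cast hRpos'
  have hidx : ∀ s, s < B * R → s / R < B := fun s hs => Nat.div_lt_of_lt_mul (by rwa [mul_comm])
  have hsplit : ∀ s, s = s / R * R + s % R := fun s => by rw [mul_comm]; exact (Nat.div_add_mod s R).symm
  set y' : ℕ → ℝ := fun s => y 0 + ∑ i ∈ Finset.range s, Δ (i / R) * (ρ (i / R) - G (i / R)) / R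
    with hy'
  have hyj : ∀ j ≤ B, y j = y 0 + ∑ r ∈ Finset.range j, Δ r * (ρ r - G r) := by
    intro j
    induction j with
    | zero => simp
    | succ j ih =>
      intro hj
      rw [hy j hj, ih (by omega), Finset.sum_range_succ]; ring
  have hy'j : ∀ j ≤ B, y' (j * R) = y j := by
    intro j hj
    have := sum_range_div hRpos (fun r => Δ r * (ρ r - G r)) j 0 (by omega)
    simp only [add_zero, Nat.cast_zero, zero_div, zero_mul] at this
    simp only [hy', this, hyj j hj]
  have key := h.mesh_lower_fine hP (B := B * R) (h₀ := h₀) (Δ := fun s => Δ (s / R) / R)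
    (ρ := fun s => ρ (s / R)) (G := fun s => G (s / R)) (y := y') (η := η)
    (κ := Real.exp (-(δ / 4))) (ε := ε) hη0 hη1 ?_ ?_ ?_ ?_ ?_ ?_ ?_ ?_ ?_ (Real.exp_pos _) ?_ hh₀ hη2
  · have hsum : ∑ s ∈ Finset.range (B * R), Δ (s / R) / R * (Hent (ρ (s / R)) + Hent (G (s / R)))
        = ∑ r ∈ Finset.range B, Δ r * (Hent (ρ r) + Hent (G r)) := by
      have := sum_range_div hRpos (fun r => Δ r * (Hent (ρ r) + Hent (G r))) B 0 (by omega)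
      simp only [add_zero, Nat.cast_zero, zero_div, zero_mul] at this
      rw [← this]
      exact Finset.sum_congr rfl fun _ _ => by ring
    have hy'0 : y' 0 = y 0 := by simp [hy']
    rw [hsum, hy'0, hy'j B le_rfl, ← hV, Real.log_exp] at key
    filter_upwards [key (δ / 4) (by linarith)] with N hN
    refine le_trans (Real.exp_le_exp.2 (mul_le_mul_of_nonneg_left ?_ N.cast_nonneg)) (hN.trans ?_)
    · have e1 := mul_le_mul_of_nonneg_left (neg_abs_le (Real.log (1 - q))) hη0.le
      have e2 := mul_le_mul_of_nonneg_left (le_abs_self V) hη0.le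
      linarith
    · refine Finset.sum_le_sum fun τ _ => ?_
      by_cases hτ : ∀ r ≤ B * R, |evalC0 (heightC0 N τ) (∑ s ∈ Finset.range r, Δ (s / R) / R) -
          ∑ s ∈ Finset.range r, Δ (s / R) / R * ρ (s / R)| < ε
      · rw [if_pos hτ, if_pos]
        intro r hr
        have := hτ (r * R) (Nat.mul_le_mul_right R hr)
        have e1 := sum_range_div hRpos Δ r 0 (by omega)
        have e2 := sum_range_div hRpos (fun r => Δ r * ρ r) r 0 (by omega)
        simp only [add_zero, Nat.cast_zero, zero_div, zero_mul] at e1 e2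
        have e3 : ∑ s ∈ Finset.range (r * R), Δ (s / R) / R * ρ (s / R) =
            ∑ s ∈ Finset.range (r * R), Δ (s / R) * ρ (s / R) / R :=
          Finset.sum_congr rfl fun _ _ => by ring
        rwa [e3, e1, e2] at this
      · rw [if_neg hτ]; split_ifs; exacts [h.nonneg hP _, le_rfl]
  · exact fun s hs => div_nonneg (hΔ0 _ (hidx s hs)) hRpos'.le
  · intro s hs
    have : Δ (s / R) ≤ 1 := by
      rw [← hΔ1]
      exact Finset.single_le_sum (f := Δ) (fun r hr => hΔ0 r (Finset.mem_range.1 hr))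
        (Finset.mem_range.2 (hidx s hs))
    rw [div_lt_iff₀ hη0] at hR
    rw [div_lt_iff₀ hRpos']
    linarith
  · have := sum_range_div hRpos Δ B 0 (by omega)
    simp only [add_zero, Nat.cast_zero, zero_div, zero_mul] at this
    rw [this, hΔ1]
  · exact fun s hs => hρ _ (hidx s hs)
  · exact fun s hs => hG _ (hidx s hs)
  · intro s hs
    rcases hs.eq_or_lt with rfl | hs
    · rw [hy'j B le_rfl]; exact hy0 B le_rfl
    · have hj := hidx s hs
      set j := s / R with hjdef
      have hi : s % R < R := Nat.mod_lt _ hRpos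
      have := sum_range_div hRpos (fun r => Δ r * (ρ r - G r)) j (s % R) hi.le
      rw [hjdef, ← hsplit s, ← hjdef] at this
      have hi' : ((s % R : ℕ) : ℝ) / R ≤ 1 := by
        rw [div_le_one hRpos']; exact_mod_cast hi.le
      have hi0 : 0 ≤ ((s % R : ℕ) : ℝ) / R := by positivity
      have e1 := hyj j hj.le
      have e2 := hy j hj
      have e3 := mul_nonneg (sub_nonneg.2 hi') (hy0 j hj.le)
      have e4 := mul_nonneg hi0 (hy0 (j + 1) hj)
      simp only [hy', this]
      rw [e2] at e4
      linarith
  · intro s hs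
    simp only [hy', Finset.sum_range_succ]
    ring
  · intro h0; simp only [hy', Finset.range_zero, Finset.sum_empty, add_zero]; exact hya h0
  · intro h0; rw [hy'j B le_rfl]; exact hyb h0
  · rw [Real.exp_lt_one_iff]; linarith

section Stationary

variable {N : ℕ} {α β γ δ q : ℝ}

lemma asepJump_self (τ : Fin N → Bool) : asepJump N α β γ δ q τ τ = 0 := by
  have upd1 : ∀ (i : Fin N) (x : Bool), τ i ≠ x → ¬ τ = Function.update τ i x := by
    intro i x h e
    apply h
    rw [e, Function.update_self]
  have upd2 : ∀ (i j : Fin N) (x y : Bool), τ j ≠ y →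
      ¬ τ = Function.update (Function.update τ i x) j y := by
    intro i j x y h e
    apply h
    rw [e, Function.update_self]
  unfold asepJump
  have h1 : ∀ i j : Fin N, ¬ ((j : ℕ) = (i : ℕ) + 1 ∧ τ i = true ∧ τ j = false ∧
        τ = Function.update (Function.update τ i false) j true) := by
    rintro i j ⟨-, -, h, e⟩
    exact upd2 i j _ _ (by simp [h]) e
  have h2 : ∀ i j : Fin N, ¬ ((j : ℕ) = (i : ℕ) + 1 ∧ τ i = false ∧ τ j = true ∧
        τ = Function.update (Function.update τ i true) j false) := by
    rintro i j ⟨-, -, h, e⟩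
    exact upd2 i j _ _ (by simp [h]) e
  have h3 : ∀ (i : Fin N) (m : ℕ) (x y : Bool), x ≠ y → ¬ ((i : ℕ) = m ∧ τ i = x ∧
      τ = Function.update τ i y) := by
    rintro i m x y hxy ⟨-, h, e⟩
    exact upd1 i y (by rwa [h]) e
  simp only [h1, h2, if_false, Finset.sum_const_zero,
    h3 _ _ false true (by simp), h3 _ _ true false (by simp)]
  ring

lemma sum_mul_asepGen (μ : (Fin N → Bool) → ℝ) (σ : Fin N → Bool) :
    ∑ τ, μ τ * asepGen N α β γ δ q τ σ =
      ∑ τ, μ τ * asepJump N α β γ δ q τ σ - μ σ * ∑ τ, asepJump N α β γ δ q σ τ := by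
  have h : ∑ τ, asepJump N α β γ δ q σ τ =
      ∑ τ ∈ Finset.univ.filter (fun τ => τ ≠ σ), asepJump N α β γ δ q σ τ := by
    rw [Finset.sum_filter]
    refine Finset.sum_congr rfl fun τ _ => ?_
    split_ifs with h
    · rfl
    · rw [not_not] at h; rw [h, asepJump_self]
  rw [← Finset.add_sum_erase _ _ (Finset.mem_univ σ),
    ← Finset.add_sum_erase _ (fun τ => μ τ * asepJump N α β γ δ q τ σ) (Finset.mem_univ σ),
    asepJump_self, h]
  have h2 : ∑ τ ∈ Finset.univ.erase σ, μ τ * asepGen N α β γ δ q τ σ =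
      ∑ τ ∈ Finset.univ.erase σ, μ τ * asepJump N α β γ δ q τ σ := by
    refine Finset.sum_congr rfl fun τ hτ => ?_
    rw [asepGen, if_neg (Finset.ne_of_mem_erase hτ).symm]
  rw [h2]
  simp only [asepGen, if_true]
  ring

lemma asepJump_nonneg (hα : 0 < α) (hβ : 0 < β) (hγ : 0 ≤ γ) (hδ : 0 ≤ δ) (hq0 : 0 ≤ q)
    (τ σ : Fin N → Bool) : 0 ≤ asepJump N α β γ δ q τ σ := by
  unfold asepJump
  positivity

lemma sum_ite_one_pos {ι : Type*} [Fintype ι] (P : ι → Prop) [DecidablePred P] (h : ∃ i, P i) :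
    0 < ∑ i, if P i then (1 : ℝ) else 0 := by
  obtain ⟨i, hi⟩ := h
  refine lt_of_lt_of_le one_pos ((le_of_eq (if_pos hi).symm).trans (Finset.single_le_sum
    (f := fun i => if P i then (1 : ℝ) else 0) (fun j _ => ?_) (Finset.mem_univ i)))
  split_ifs <;> norm_num

/-- The three kinds of transition that always have positive rate. -/
lemma asepJump_pos (hα : 0 < α) (hβ : 0 < β) (hγ : 0 ≤ γ) (hδ : 0 ≤ δ) (hq0 : 0 ≤ q)
    {τ σ : Fin N → Bool}
    (h : (∃ i j : Fin N, (j : ℕ) = (i : ℕ) + 1 ∧ τ i = true ∧ τ j = false ∧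
        σ = Function.update (Function.update τ i false) j true) ∨
      (∃ i : Fin N, (i : ℕ) = 0 ∧ τ i = false ∧ σ = Function.update τ i true) ∨
      (∃ i : Fin N, (i : ℕ) = N - 1 ∧ τ i = true ∧ σ = Function.update τ i false)) :
    0 < asepJump N α β γ δ q τ σ := by
  unfold asepJump
  rcases h with ⟨i, h⟩ | h | h
  · have h1 : 0 < ∑ i : Fin N, ∑ j : Fin N, if (j : ℕ) = (i : ℕ) + 1 ∧ τ i = true ∧ τ j = false ∧
        σ = Function.update (Function.update τ i false) j true then (1 : ℝ) else 0 :=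
      lt_of_lt_of_le (sum_ite_one_pos _ h) (Finset.single_le_sum (f := fun i : Fin N => ∑ j : Fin N,
        if (j : ℕ) = (i : ℕ) + 1 ∧ τ i = true ∧ τ j = false ∧
          σ = Function.update (Function.update τ i false) j true then (1 : ℝ) else 0)
        (fun j _ => by positivity) (Finset.mem_univ i))
    positivity
  · have h3 := sum_ite_one_pos _ h
    positivity
  · have h6 := sum_ite_one_pos _ h
    positivity

lemma sum_update_real (g : Fin N → Bool → ℝ) (σ : Fin N → Bool) (j : Fin N) (x : Bool) :
    ∑ i, g i (Function.update σ j x i) = ∑ i, g i (σ i) + (g j x - g j (σ j)) := by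
  rw [← Finset.add_sum_erase _ _ (Finset.mem_univ j),
    ← Finset.add_sum_erase _ (fun i => g i (σ i)) (Finset.mem_univ j),
    Function.update_self]
  have : ∑ i ∈ Finset.univ.erase j, g i (Function.update σ j x i) =
      ∑ i ∈ Finset.univ.erase j, g i (σ i) :=
    Finset.sum_congr rfl fun i hi => by rw [Function.update_of_ne (Finset.ne_of_mem_erase hi)]
  rw [this]; ring

/-- A nonempty set of configurations stable under the inverse of the always allowed moves contains
the empty configuration. -/
lemma empty_mem_of_pred (S : Set (Fin N → Bool)) (hS : S.Nonempty)
    (h1 : ∀ σ ∈ S, ∀ i j : Fin N, (j : ℕ) = (i : ℕ) + 1 → σ i = false → σ j = true →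
      Function.update (Function.update σ i true) j false ∈ S)
    (h2 : ∀ σ ∈ S, ∀ i : Fin N, (i : ℕ) = 0 → σ i = true → Function.update σ i false ∈ S) :
    (fun _ => false) ∈ S := by
  obtain ⟨σ, hσ, hmin⟩ := Set.exists_min_image S
    (fun σ => ∑ i : Fin N, if σ i then ((i : ℕ) : ℝ) + 1 else 0) (Set.toFinite S) hS
  by_contra hne
  have hex : ∃ m : ℕ, ∃ h : m < N, σ ⟨m, h⟩ = true := by
    by_contra! hcon
    apply hne
    convert hσ with i
    simpa using (hcon i i.2).symm
  obtain ⟨m, hm, hmt, hlt⟩ : ∃ m : ℕ, ∃ h : m < N, σ ⟨m, h⟩ = true ∧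
      ∀ m' < m, ∀ h : m' < N, σ ⟨m', h⟩ = false := by
    obtain ⟨hm, hmt⟩ := Nat.find_spec hex
    refine ⟨Nat.find hex, hm, hmt, fun m' h' h => ?_⟩
    have := Nat.find_min hex h'
    push Not at this
    simpa using this h
  rcases Nat.eq_zero_or_pos m with h0 | hpos
  · have := hmin _ (h2 σ hσ ⟨m, hm⟩ h0 hmt)
    rw [sum_update_real (fun i x => if x then ((i : ℕ) : ℝ) + 1 else 0)] at this
    simp [hmt] at this
    have : (0:ℝ) ≤ (m:ℝ) := Nat.cast_nonneg _
    linarith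
  · have hf := hlt (m - 1) (by omega) (by omega)
    have hne : (⟨m, hm⟩ : Fin N) ≠ ⟨m - 1, by omega⟩ := by simp [Fin.ext_iff]; omega
    have := hmin _ (h1 σ hσ ⟨m - 1, by omega⟩ ⟨m, hm⟩ (by simp; omega) hf hmt)
    rw [sum_update_real (fun i x => if x then ((i : ℕ) : ℝ) + 1 else 0),
      sum_update_real (fun i x => if x then ((i : ℕ) : ℝ) + 1 else 0),
      Function.update_of_ne hne] at this
    simp [hmt, hf] at this
    have h3 : ((m - 1 : ℕ) : ℝ) = m - 1 := by rw [Nat.cast_sub hpos]; simp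
    linarith

/-- A nonempty set of configurations stable under the always allowed moves contains
the empty configuration. -/
lemma empty_mem_of_succ (S : Set (Fin N → Bool)) (hS : S.Nonempty)
    (h1 : ∀ σ ∈ S, ∀ i j : Fin N, (j : ℕ) = (i : ℕ) + 1 → σ i = true → σ j = false →
      Function.update (Function.update σ i false) j true ∈ S)
    (h2 : ∀ σ ∈ S, ∀ i : Fin N, (i : ℕ) = N - 1 → σ i = true → Function.update σ i false ∈ S) :
    (fun _ => false) ∈ S := by
  have key := empty_mem_of_pred {σ : Fin N → Bool | (fun i => σ i.rev) ∈ S} ?_ ?_ ?_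
  · exact key
  · obtain ⟨σ, hσ⟩ := hS
    exact ⟨fun i => σ i.rev, by simpa using hσ⟩
  · intro σ hσ i j hij hi hj
    have := h1 _ hσ j.rev i.rev (by simp [Fin.val_rev]; omega) (by simpa using hj) (by simpa using hi)
    have hne : i ≠ j := by rintro rfl; omega
    simp only [Set.mem_ofPred_eq]
    convert this using 1
    ext m
    simp only [Function.update_apply, Fin.rev_eq_iff]
    by_cases e : m = i.rev
    · subst e; simp [hne]
    · simp [e]
  · intro σ hσ i hi ht
    have := h2 _ hσ i.rev (by simp [Fin.val_rev]; omega) (by simpa using ht)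
    simp only [Set.mem_ofPred_eq]
    convert this using 1
    ext m
    simp only [Function.update_apply, Fin.rev_eq_iff]

lemma stationary_eq (hα : 0 < α) (hβ : 0 < β) (hγ : 0 ≤ γ) (hδ : 0 ≤ δ) (hq0 : 0 ≤ q)
    {μ G : (Fin N → Bool) → ℝ} (hG : ∀ τ, 0 < G τ)
    (hμs : IsStationaryASEP N α β γ δ q μ) (hGs : IsStationaryASEP N α β γ δ q G) :
    ∃ t : ℝ, ∀ τ, μ τ = t * G τ := by
  obtain ⟨σ₀, -, hmin⟩ := Finset.exists_min_image Finset.univ (fun τ => μ τ / G τ)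
    ⟨fun _ => false, Finset.mem_univ _⟩
  set t := μ σ₀ / G σ₀ with ht
  refine ⟨t, ?_⟩
  have hν0 : ∀ τ, 0 ≤ μ τ - t * G τ := by
    intro τ
    have := hmin τ (Finset.mem_univ _)
    rw [le_div_iff₀ (hG τ)] at this
    linarith
  have hσ₀ : μ σ₀ - t * G σ₀ = 0 := by
    rw [ht, div_mul_cancel₀ _ (hG σ₀).ne', sub_self]
  have hνs : ∀ σ, ∑ τ, (μ τ - t * G τ) * asepJump N α β γ δ q τ σ =
      (μ σ - t * G σ) * ∑ τ, asepJump N α β γ δ q σ τ := by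
    intro σ
    have h1 := hμs σ
    have h2 := hGs σ
    rw [sum_mul_asepGen] at h1 h2
    simp only [sub_mul, Finset.sum_sub_distrib, mul_assoc, ← Finset.mul_sum]
    linear_combination h1 - t * h2
  have hzero : ∀ σ τ, μ σ - t * G σ = 0 → 0 < asepJump N α β γ δ q τ σ → μ τ - t * G τ = 0 := by
    intro σ τ h0 hJ
    have h1 := hνs σ
    rw [h0, zero_mul, Finset.sum_eq_zero_iff_of_nonneg fun τ _ =>
      mul_nonneg (hν0 τ) (asepJump_nonneg hα hβ hγ hδ hq0 _ _)] at h1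
    exact (mul_eq_zero.1 (h1 τ (Finset.mem_univ _))).resolve_right hJ.ne'
  have hE : μ (fun _ => false) - t * G (fun _ => false) = 0 := by
    refine empty_mem_of_pred {σ | μ σ - t * G σ = 0} ⟨σ₀, hσ₀⟩ ?_ ?_
    · intro σ hσ i j hij hi hj
      have hne : i ≠ j := by rintro rfl; omega
      refine hzero σ _ hσ (asepJump_pos hα hβ hγ hδ hq0 (Or.inl ⟨i, j, hij, ?_, ?_, ?_⟩))
      · simp [hne]
      · simp
      · ext m
        simp only [Function.update_apply]
        split_ifs <;> simp_all
    · intro σ hσ i hi ht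
      refine hzero σ _ hσ (asepJump_pos hα hβ hγ hδ hq0 (Or.inr (Or.inl ⟨i, hi, ?_, ?_⟩)))
      · simp
      · ext m
        simp only [Function.update_apply]
        split_ifs <;> simp_all
  by_contra! hcon
  obtain ⟨σ₁, h₁⟩ := hcon
  refine empty_mem_of_succ {σ | ¬ μ σ - t * G σ = 0} ⟨σ₁, fun h => h₁ (by linarith)⟩ ?_ ?_ hE
  · intro σ hσ i j hij hi hj h0
    exact hσ (hzero _ _ h0 (asepJump_pos hα hβ hγ hδ hq0 (Or.inl ⟨i, j, hij, hi, hj, rfl⟩)))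
  · intro σ hσ i hi ht h0
    exact hσ (hzero _ _ h0 (asepJump_pos hα hβ hγ hδ hq0 (Or.inr (Or.inr ⟨i, hi, ht, rfl⟩))))

end Stationary

section Stationary

variable {N : ℕ}

lemma sum_neighbours {n : ℕ} (X : Fin (n + 1) → Fin (n + 1) → ℝ) :
    ∑ i : Fin (n + 1), ∑ j : Fin (n + 1), (if (j : ℕ) = (i : ℕ) + 1 then X i j else 0) =
      ∑ m : Fin n, X m.castSucc m.succ := by
  rw [Fin.sum_univ_castSucc]
  have h0 : ∑ j : Fin (n + 1), (if (j : ℕ) = (Fin.last n : ℕ) + 1 then X (Fin.last n) j else 0) = 0 :=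
    Finset.sum_eq_zero fun j _ => if_neg (by simp; omega)
  rw [h0, add_zero]
  refine Finset.sum_congr rfl fun m _ => ?_
  rw [Finset.sum_eq_single m.succ]
  · simp
  · intro j _ hj
    exact if_neg fun h => hj (Fin.ext (by simpa using h))
  · simp

lemma sum_ite_pair {n : ℕ} (A : Fin (n + 1) → Fin (n + 1) → Prop) [∀ i j, Decidable (A i j)]
    [∀ i j : Fin (n + 1), Decidable ((j : ℕ) = (i : ℕ) + 1 ∧ A i j)] :
    ∑ i : Fin (n + 1), ∑ j : Fin (n + 1), (if (j : ℕ) = (i : ℕ) + 1 ∧ A i j then (1 : ℝ) else 0) =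
      ∑ m : Fin n, if A m.castSucc m.succ then (1 : ℝ) else 0 := by
  rw [← sum_neighbours fun i j => if A i j then (1 : ℝ) else 0]
  refine Finset.sum_congr rfl fun i _ => Finset.sum_congr rfl fun j _ => ?_
  by_cases h : (j : ℕ) = (i : ℕ) + 1 <;> by_cases h' : A i j <;> simp [h, h']

lemma sum_ite_zero {n : ℕ} (A : Fin (n + 1) → Prop) [DecidablePred A]
    [∀ i : Fin (n + 1), Decidable ((i : ℕ) = 0 ∧ A i)] :
    ∑ i : Fin (n + 1), (if (i : ℕ) = 0 ∧ A i then (1 : ℝ) else 0) = if A 0 then (1 : ℝ) else 0 := by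
  rw [Finset.sum_eq_single 0]
  · by_cases h : A 0 <;> simp [h]
  · intro j _ hj
    exact if_neg fun h => hj (Fin.ext (by simpa using h.1))
  · simp

lemma sum_ite_last {n : ℕ} (A : Fin (n + 1) → Prop) [DecidablePred A]
    [∀ i : Fin (n + 1), Decidable ((i : ℕ) = n + 1 - 1 ∧ A i)] :
    ∑ i : Fin (n + 1), (if (i : ℕ) = n + 1 - 1 ∧ A i then (1 : ℝ) else 0) =
      if A (Fin.last n) then (1 : ℝ) else 0 := by
  rw [Finset.sum_eq_single (Fin.last n)]
  · by_cases h : A (Fin.last n) <;> simp [h]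
  · intro j _ hj
    exact if_neg fun h => hj (Fin.ext (by simpa using h.1))
  · simp

lemma asepJump_succ (n : ℕ) (α β γ δ q : ℝ) (τ σ : Fin (n + 1) → Bool) :
    asepJump (n + 1) α β γ δ q τ σ =
      (∑ m : Fin n, if τ m.castSucc = true ∧ τ m.succ = false ∧
        σ = Function.update (Function.update τ m.castSucc false) m.succ true then (1 : ℝ) else 0) +
      q * (∑ m : Fin n, if τ m.castSucc = false ∧ τ m.succ = true ∧
        σ = Function.update (Function.update τ m.castSucc true) m.succ false then (1 : ℝ) else 0) +
      α * (if τ 0 = false ∧ σ = Function.update τ 0 true then (1 : ℝ) else 0) +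
      γ * (if τ 0 = true ∧ σ = Function.update τ 0 false then (1 : ℝ) else 0) +
      δ * (if τ (Fin.last n) = false ∧ σ = Function.update τ (Fin.last n) true
        then (1 : ℝ) else 0) +
      β * (if τ (Fin.last n) = true ∧ σ = Function.update τ (Fin.last n) false
        then (1 : ℝ) else 0) := by
  unfold asepJump
  rw [sum_ite_pair fun i j => τ i = true ∧ τ j = false ∧
      σ = Function.update (Function.update τ i false) j true,
    sum_ite_pair fun i j => τ i = false ∧ τ j = true ∧
      σ = Function.update (Function.update τ i true) j false,
    sum_ite_zero fun i => τ i = false ∧ σ = Function.update τ i true,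
    sum_ite_zero fun i => τ i = true ∧ σ = Function.update τ i false,
    sum_ite_last fun i => τ i = false ∧ σ = Function.update τ i true,
    sum_ite_last fun i => τ i = true ∧ σ = Function.update τ i false]

lemma sum_in_pair (μ : (Fin N → Bool) → ℝ) (σ : Fin N → Bool) {i j : Fin N} (hij : i ≠ j)
    (x y x' y' : Bool) :
    ∑ τ : Fin N → Bool, μ τ * (if τ i = x ∧ τ j = y ∧
        σ = Function.update (Function.update τ i x') j y' then (1 : ℝ) else 0) =
      if σ i = x' ∧ σ j = y' then μ (Function.update (Function.update σ i x) j y) else 0 := by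
  have key : ∀ τ : Fin N → Bool, (τ i = x ∧ τ j = y ∧
        σ = Function.update (Function.update τ i x') j y') ↔
      ((σ i = x' ∧ σ j = y') ∧ τ = Function.update (Function.update σ i x) j y) := by
    intro τ
    constructor
    · rintro ⟨h1, h2, rfl⟩
      refine ⟨⟨by simp [hij], by simp⟩, ?_⟩
      ext m; simp only [Function.update_apply]; split_ifs <;> simp_all
    · rintro ⟨⟨h1, h2⟩, rfl⟩
      refine ⟨by simp [hij], by simp, ?_⟩
      ext m; simp only [Function.update_apply]; split_ifs <;> simp_all
  simp only [key, ite_and, mul_ite, mul_one, mul_zero]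
  split_ifs <;> simp

lemma sum_in_single (μ : (Fin N → Bool) → ℝ) (σ : Fin N → Bool) (i : Fin N) (x x' : Bool) :
    ∑ τ : Fin N → Bool, μ τ * (if τ i = x ∧ σ = Function.update τ i x' then (1 : ℝ) else 0) =
      if σ i = x' then μ (Function.update σ i x) else 0 := by
  have key : ∀ τ : Fin N → Bool, (τ i = x ∧ σ = Function.update τ i x') ↔
      (σ i = x' ∧ τ = Function.update σ i x) := by
    intro τ
    constructor
    · rintro ⟨h1, rfl⟩
      refine ⟨by simp, ?_⟩
      ext m; simp only [Function.update_apply]; split_ifs <;> simp_all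
    · rintro ⟨h1, rfl⟩
      refine ⟨by simp, ?_⟩
      ext m; simp only [Function.update_apply]; split_ifs <;> simp_all
  simp only [key, ite_and, mul_ite, mul_one, mul_zero]
  split_ifs <;> simp

lemma sum_out_pair (σ : Fin N → Bool) (i j : Fin N) (x y : Bool) (e : Fin N → Bool) :
    ∑ τ : Fin N → Bool, (if σ i = x ∧ σ j = y ∧ τ = e then (1 : ℝ) else 0) =
      if σ i = x ∧ σ j = y then 1 else 0 := by
  simp only [ite_and]
  split_ifs <;> simp

lemma sum_out_single (σ : Fin N → Bool) (i : Fin N) (x : Bool) (e : Fin N → Bool) :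
    ∑ τ : Fin N → Bool, (if σ i = x ∧ τ = e then (1 : ℝ) else 0) = if σ i = x then 1 else 0 := by
  simp only [ite_and]
  split_ifs <;> simp

/-- The net flow into a configuration, split into nearest-neighbour and boundary contributions. -/
lemma net_flow (n : ℕ) (α β γ δ q : ℝ) (μ : (Fin (n + 1) → Bool) → ℝ) (σ : Fin (n + 1) → Bool) :
    ∑ τ, μ τ * asepGen (n + 1) α β γ δ q τ σ =
      (∑ m : Fin n,
        ((if σ m.castSucc = false ∧ σ m.succ = true then
            μ (Function.update (Function.update σ m.castSucc true) m.succ false) - q * μ σ else 0) +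
          (if σ m.castSucc = true ∧ σ m.succ = false then
            q * μ (Function.update (Function.update σ m.castSucc false) m.succ true) - μ σ
            else 0))) +
      (if σ 0 = true then α * μ (Function.update σ 0 false) - γ * μ σ
        else γ * μ (Function.update σ 0 true) - α * μ σ) +
      (if σ (Fin.last n) = true then δ * μ (Function.update σ (Fin.last n) false) - β * μ σ
        else β * μ (Function.update σ (Fin.last n) true) - δ * μ σ) := by
  have hne : ∀ m : Fin n, m.castSucc ≠ m.succ := fun m => (Fin.castSucc_lt_succ).ne
  have e : ∀ m : Fin n,
      ((if σ m.castSucc = false ∧ σ m.succ = true then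
            μ (Function.update (Function.update σ m.castSucc true) m.succ false) - q * μ σ else 0) +
          (if σ m.castSucc = true ∧ σ m.succ = false then
            q * μ (Function.update (Function.update σ m.castSucc false) m.succ true) - μ σ
            else 0)) =
      (if σ m.castSucc = false ∧ σ m.succ = true then
        μ (Function.update (Function.update σ m.castSucc true) m.succ false) else 0) +
      q * (if σ m.castSucc = true ∧ σ m.succ = false then
        μ (Function.update (Function.update σ m.castSucc false) m.succ true) else 0) -
      μ σ * (if σ m.castSucc = true ∧ σ m.succ = false then 1 else 0) -
      q * μ σ * (if σ m.castSucc = false ∧ σ m.succ = true then 1 else 0) := by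
    intro m
    split_ifs <;> ring
  rw [sum_mul_asepGen, Finset.sum_congr rfl fun m _ => e m]
  simp only [asepJump_succ, mul_add, Finset.sum_add_distrib]
  have c1 : ∀ (c : ℝ) (f : (Fin (n + 1) → Bool) → ℝ),
      ∑ τ, μ τ * (c * f τ) = c * ∑ τ, μ τ * f τ := by
    intro c f
    rw [Finset.mul_sum]; exact Finset.sum_congr rfl fun τ _ => by ring
  have c2 : ∀ f : (Fin (n + 1) → Bool) → Fin n → ℝ,
      ∑ τ, μ τ * ∑ m, f τ m = ∑ m, ∑ τ, μ τ * f τ m := by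
    intro f
    rw [Finset.sum_comm]; exact Finset.sum_congr rfl fun τ _ => Finset.mul_sum _ _ _
  simp only [c1, c2, sum_in_single, ← Finset.mul_sum, sum_out_single]
  rw [Finset.sum_comm (s := Finset.univ (α := Fin (n + 1) → Bool)),
    Finset.sum_comm (s := Finset.univ (α := Fin (n + 1) → Bool))]
  simp only [sum_in_pair μ σ (hne _), sum_out_pair]
  simp only [Finset.sum_sub_distrib, Finset.sum_add_distrib, ← Finset.mul_sum]
  by_cases h0 : σ 0 = true <;> by_cases h1 : σ (Fin.last n) = true <;> simp [h0, h1] <;> ring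

end Stationary

section Stationary

lemma ofFn_update_eq_set {n : ℕ} (τ : Fin n → Bool) (i : Fin n) (x : Bool) :
    List.ofFn (Function.update τ i x) = (List.ofFn τ).set i x := by
  apply List.ext_getElem
  · simp
  · intro m h1 h2
    simp [List.getElem_set, Function.update_apply, Fin.ext_iff, eq_comm]

lemma exists_split_pair {n : ℕ} (τ : Fin (n + 1) → Bool) (m : Fin n) :
    ∃ u v : List Bool, (∀ x y, List.ofFn (Function.update (Function.update τ m.castSucc x) m.succ y)
      = u ++ x :: y :: v) ∧ List.ofFn τ = u ++ τ m.castSucc :: τ m.succ :: v ∧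
      u.length = m := by
  have hlen : (m : ℕ) + 1 < (List.ofFn τ).length := by simp
  have hl : List.ofFn τ = (List.ofFn τ).take m ++ τ m.castSucc :: τ m.succ ::
      (List.ofFn τ).drop (m + 2) := by
    conv_lhs => rw [← List.take_append_drop m (List.ofFn τ)]
    rw [List.drop_eq_getElem_cons (by omega), List.drop_eq_getElem_cons hlen,
      List.getElem_ofFn, List.getElem_ofFn]
    rfl
  have hu : ((List.ofFn τ).take m).length = m := by simp; omega
  refine ⟨_, _, ?_, hl, hu⟩
  intro x y
  rw [ofFn_update_eq_set, ofFn_update_eq_set]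
  conv_lhs => rw [hl]
  rw [List.set_append_right _ _ (by simp), List.set_append_right _ _ (by simp), hu]
  simp

/-- The matrix-product weights are stationary for the open ASEP. -/
lemma IsMPA.isStationary {a b c d q : ℝ} {F : List Bool → ℝ} (h : IsMPA a b c d q F) {n : ℕ}
    {α β γ δ : ℝ} (hα : α * ((1 + a) * (1 + c)) = 1 - q) (hγ : γ = -(a * c) * α)
    (hβ : β * ((1 + b) * (1 + d)) = 1 - q) (hδ : δ = -(b * d) * β) :
    IsStationaryASEP (n + 1) α β γ δ q (fun τ => F (List.ofFn τ)) := by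
  intro σ
  rw [net_flow]
  set g : Fin (n + 1) → ℝ := fun i =>
    (if σ i = true then 1 else -1) * ((1 - q) * F ((List.ofFn σ).eraseIdx i)) with hg
  have hbulk : ∀ m : Fin n,
      ((if σ m.castSucc = false ∧ σ m.succ = true then
            F (List.ofFn (Function.update (Function.update σ m.castSucc true) m.succ false)) -
              q * F (List.ofFn σ) else 0) +
          (if σ m.castSucc = true ∧ σ m.succ = false then
            q * F (List.ofFn (Function.update (Function.update σ m.castSucc false) m.succ true)) -
              F (List.ofFn σ) else 0)) = g m.succ - g m.castSucc := by
    intro m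
    obtain ⟨u, v, h1, h2, h3⟩ := exists_split_pair σ m
    have e1 : ((List.ofFn σ).eraseIdx (m.castSucc : Fin (n + 1))) = u ++ σ m.succ :: v := by
      rw [h2, List.eraseIdx_append_of_length_le (by simp [h3])]
      simp [h3]
    have e2 : ((List.ofFn σ).eraseIdx (m.succ : Fin (n + 1))) = u ++ σ m.castSucc :: v := by
      rw [h2, List.eraseIdx_append_of_length_le (by simp [h3])]
      simp [h3]
    simp only [hg, e1, e2, h1]
    rw [h2]
    have hb := h.bulk u v
    rcases σ m.castSucc <;> rcases σ m.succ <;> simp [hb] <;> ring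
  rw [Finset.sum_congr rfl fun m _ => hbulk m]
  have htel : ∑ m : Fin n, (g m.succ - g m.castSucc) = g (Fin.last n) - g 0 := by
    rw [Finset.sum_sub_distrib]
    have := Fin.sum_univ_succ g
    rw [Fin.sum_univ_castSucc g] at this
    linarith
  have hleft : (if σ 0 = true then α * F (List.ofFn (Function.update σ 0 false)) - γ * F (List.ofFn σ)
      else γ * F (List.ofFn (Function.update σ 0 true)) - α * F (List.ofFn σ)) = g 0 := by
    have e0 : ∀ x, List.ofFn (Function.update σ 0 x) = x :: List.ofFn (fun i : Fin n => σ i.succ) := by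
      intro x; rw [ofFn_update_eq_set, List.ofFn_succ]; simp
    have hl := h.left (List.ofFn (fun i : Fin n => σ i.succ))
    simp only [e0, hg]
    rw [List.ofFn_succ, hγ]
    simp only [Fin.val_zero, List.eraseIdx_cons_zero]
    rcases σ 0 <;> simp [hl] <;> rw [← hα] <;> ring
  have hright : (if σ (Fin.last n) = true then
        δ * F (List.ofFn (Function.update σ (Fin.last n) false)) - β * F (List.ofFn σ)
      else β * F (List.ofFn (Function.update σ (Fin.last n) true)) - δ * F (List.ofFn σ)) =
      -g (Fin.last n) := by
    have e : List.ofFn σ = List.ofFn (fun i : Fin n => σ i.castSucc) ++ [σ (Fin.last n)] := by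
      rw [List.ofFn_succ', List.concat_eq_append]
    have e0 : ∀ x, List.ofFn (Function.update σ (Fin.last n) x) =
        List.ofFn (fun i : Fin n => σ i.castSucc) ++ [x] := by
      intro x
      rw [ofFn_update_eq_set, e, List.set_append_right _ _ (by simp)]
      simp
    have hr := h.right (List.ofFn (fun i : Fin n => σ i.castSucc))
    simp only [e0, hg]
    rw [e, hδ, List.eraseIdx_append_of_length_le (by simp)]
    rcases σ (Fin.last n) <;> simp [hr] <;> rw [← hβ] <;> ring
  rw [htel, hleft, hright]
  ring

lemma phi_spec {q x y : ℝ} (hx : 0 < x) (hy : 0 ≤ y) (hq1 : q < 1) :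
    0 ≤ phiPlus q x y ∧ -1 < phiMinus q x y ∧ phiMinus q x y ≤ 0 ∧
      x * ((1 + phiPlus q x y) * (1 + phiMinus q x y)) = 1 - q ∧
      y = -(phiPlus q x y * phiMinus q x y) * x := by
  have hD : 0 ≤ (1 - q - x + y) ^ 2 + 4 * x * y := by positivity
  obtain ⟨s, hs⟩ : ∃ s, s = Real.sqrt ((1 - q - x + y) ^ 2 + 4 * x * y) := ⟨_, rfl⟩
  have hs0 : 0 ≤ s := hs ▸ Real.sqrt_nonneg _
  have hs2 : s ^ 2 = (1 - q - x + y) ^ 2 + 4 * x * y := by rw [hs, Real.sq_sqrt hD]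
  have habs : |1 - q - x + y| ≤ s := by
    rw [hs]; apply Real.abs_le_sqrt; nlinarith [mul_nonneg hx.le hy]
  have hle := abs_le.1 habs
  have hlt : s < 1 - q + x + y := by
    apply lt_of_pow_lt_pow_left₀ 2 (by linarith)
    rw [hs2]
    nlinarith [mul_pos hx (sub_pos.2 hq1)]
  have ep : phiPlus q x y = (1 - q - x + y + s) / (2 * x) := by rw [phiPlus, ← hs]; ring
  have em : phiMinus q x y = (1 - q - x + y - s) / (2 * x) := by rw [phiMinus, ← hs]; ring
  have h2x : 0 < 2 * x := by linarith
  rw [ep, em]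
  refine ⟨div_nonneg (by linarith) h2x.le, ?_, div_nonpos_of_nonpos_of_nonneg (by linarith) h2x.le,
    ?_, ?_⟩
  · rw [lt_div_iff₀ h2x]; linarith
  · field_simp
    linear_combination -hs2
  · field_simp
    linear_combination -hs2

end Stationary

/-- The slope `s` truncated to the interval `[a/(1+a), 1/(1+b)]` of admissible densities. -/
noncomputable def truncSlope (a b s : ℝ) : ℝ := min (max s (a / (1 + a))) (1 / (1 + b))

/-- The contribution to the rate function of a convex envelope of slope `s`. -/
noncomputable def envRate (a b s : ℝ) : ℝ :=
  s * Real.log (truncSlope a b s) + (1 - s) * Real.log (1 - truncSlope a b s)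

section TruncSlope

variable {a b s : ℝ}

lemma lower_lt_upper (ha : 0 ≤ a) (hb : 0 ≤ b) (hab : a * b < 1) : a / (1 + a) < 1 / (1 + b) := by
  rw [div_lt_div_iff₀ (by linarith) (by linarith)]
  nlinarith

lemma truncSlope_mem (ha : 0 ≤ a) (hb : 0 ≤ b) (hab : a * b < 1) (s : ℝ) :
    truncSlope a b s ∈ Set.Icc (a / (1 + a)) (1 / (1 + b)) :=
  ⟨le_min (le_max_right _ _) (lower_lt_upper ha hb hab).le, min_le_right _ _⟩

lemma lower_nonneg (ha : 0 ≤ a) : 0 ≤ a / (1 + a) := by positivity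

lemma upper_le_one (hb : 0 ≤ b) : 1 / (1 + b) ≤ 1 := by
  rw [div_le_one (by linarith)]; linarith

lemma truncSlope_mem_unit (ha : 0 ≤ a) (hb : 0 ≤ b) (hab : a * b < 1) (s : ℝ) :
    truncSlope a b s ∈ Set.Icc (0 : ℝ) 1 :=
  Set.Icc_subset_Icc (lower_nonneg ha) (upper_le_one hb) (truncSlope_mem ha hb hab s)

lemma truncSlope_sub (ha : 0 ≤ a) (hb : 0 ≤ b) (hab : a * b < 1) (s : ℝ) :
    truncSlope a b s - s = max (a / (1 + a) - s) 0 - max (s - 1 / (1 + b)) 0 := by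
  have h := lower_lt_upper ha hb hab
  unfold truncSlope
  rcases le_total s (a / (1 + a)) with h1 | h1
  · rw [max_eq_right h1, min_eq_left h.le, max_eq_left (by linarith), max_eq_right (by linarith)]
    ring
  · rw [max_eq_left h1, max_eq_right (by linarith : a / (1 + a) - s ≤ 0)]
    rcases le_total s (1 / (1 + b)) with h2 | h2
    · rw [min_eq_left h2, max_eq_right (by linarith)]; ring
    · rw [min_eq_right h2, max_eq_left (by linarith)]; ring

lemma envRate_eq (ha : 0 ≤ a) (hb : 0 ≤ b) (hab : a * b < 1) (hs : s ∈ Set.Icc (0 : ℝ) 1) :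
    envRate a b s = Hent (truncSlope a b s) - max (a / (1 + a) - s) 0 * Real.log a -
      max (s - 1 / (1 + b)) 0 * Real.log b := by
  have h := lower_lt_upper ha hb hab
  unfold envRate Hent truncSlope
  rcases le_or_gt (a / (1 + a)) s with h1 | h1
  · rw [max_eq_left h1, max_eq_right (by linarith : a / (1 + a) - s ≤ 0)]
    rcases le_or_gt s (1 / (1 + b)) with h2 | h2
    · rw [min_eq_left h2, max_eq_right (by linarith)]; ring
    · rw [min_eq_right h2.le, max_eq_left (by linarith)]
      have hb' : 0 < b := by
        rcases hb.eq_or_lt with rfl | hb'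
        · simp at h2; linarith [hs.2]
        · exact hb'
      have e : 1 - 1 / (1 + b) = b / (1 + b) := by field_simp; ring
      rw [e, Real.log_div one_ne_zero (by linarith), Real.log_div hb'.ne' (by linarith),
        Real.log_one]
      field_simp
      ring
  · rw [max_eq_right h1.le, min_eq_left h.le, max_eq_left (by linarith),
      max_eq_right (by linarith)]
    have ha' : 0 < a := by
      rcases ha.eq_or_lt with rfl | ha'
      · simp at h1; linarith [hs.1]
      · exact ha'
    have e : 1 - a / (1 + a) = 1 / (1 + a) := by field_simp; ring
    rw [e, Real.log_div one_ne_zero (by linarith), Real.log_div ha'.ne' (by linarith),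
      Real.log_one]
    field_simp
    ring

end TruncSlope

/-- Lower bound for the total weight of the configurations whose height profile is close, at the
mesh points, to a piecewise linear profile with slopes `ρ`, in terms of any minorant with
slopes `s` having the same end points. -/
lemma IsMPA.profile_lower {a b c d q : ℝ} {F : List Bool → ℝ} (h : IsMPA a b c d q F)
    (hP : FanParams a b c d q) {B : ℕ} {Δ ρ s : ℕ → ℝ} {ε : ℝ} (hε : 0 < ε)
    (hΔ0 : ∀ r < B, 0 ≤ Δ r) (hΔ1 : ∑ r ∈ Finset.range B, Δ r = 1)
    (hρ : ∀ r < B, ρ r ∈ Set.Icc (0 : ℝ) 1) (hs : ∀ r < B, s r ∈ Set.Icc (0 : ℝ) 1)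
    (hle : ∀ r ≤ B, ∑ i ∈ Finset.range r, Δ i * s i ≤ ∑ i ∈ Finset.range r, Δ i * ρ i)
    (heq : ∑ i ∈ Finset.range B, Δ i * s i = ∑ i ∈ Finset.range B, Δ i * ρ i) :
    ExpLB (fun N => ∑ τ : Fin N → Bool, if ∀ r ≤ B, |evalC0 (heightC0 N τ)
        (∑ i ∈ Finset.range r, Δ i) - ∑ i ∈ Finset.range r, Δ i * ρ i| < ε
        then F (List.ofFn τ) else 0)
      (-∑ r ∈ Finset.range B, Δ r * (Hent (ρ r) + envRate a b (s r))) := by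
  obtain ⟨ha, hb, hab⟩ := And.intro hP.ha (And.intro hP.hb hP.hab)
  set y : ℕ → ℝ := fun r => ∑ i ∈ Finset.range r, Δ i * ρ i - ∑ i ∈ Finset.range r, Δ i * s i +
    ∑ i ∈ Finset.range B, Δ i * max (a / (1 + a) - s i) 0 +
    ∑ i ∈ Finset.range r, Δ i * (s i - truncSlope a b (s i)) with hy
  have hyB : y B = ∑ i ∈ Finset.range B, Δ i * max (s i - 1 / (1 + b)) 0 := by
    simp only [hy, heq, sub_self, zero_add, ← Finset.sum_add_distrib]
    refine Finset.sum_congr rfl fun i _ => ?_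
    have := truncSlope_sub ha hb hab (s i)
    linear_combination (-Δ i) * this
  have hy00 : y 0 = ∑ i ∈ Finset.range B, Δ i * max (a / (1 + a) - s i) 0 := by simp [hy]
  have key := h.mesh_lower hP (B := B) (Δ := Δ) (ρ := ρ) (G := fun r => truncSlope a b (s r))
    (y := y) hε hΔ0 hΔ1 hρ (fun r _ => truncSlope_mem_unit ha hb hab _) ?_ ?_ ?_ ?_
  · convert key using 1
    rw [hyB, hy00, Finset.sum_mul, Finset.sum_mul, ← Finset.sum_add_distrib,
      ← Finset.sum_sub_distrib, ← Finset.sum_neg_distrib]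
    refine Finset.sum_congr rfl fun r hr => ?_
    rw [envRate_eq ha hb hab (hs r (Finset.mem_range.1 hr))]
    ring
  · intro r hr
    have h1 : ∑ i ∈ Finset.range r, Δ i * max (a / (1 + a) - s i) 0 ≤
        ∑ i ∈ Finset.range B, Δ i * max (a / (1 + a) - s i) 0 :=
      Finset.sum_le_sum_of_subset_of_nonneg (Finset.range_mono hr) fun i hi _ =>
        mul_nonneg (hΔ0 i (Finset.mem_range.1 hi)) (le_max_right _ _)
    have h2 : 0 ≤ ∑ i ∈ Finset.range r, (Δ i * max (a / (1 + a) - s i) 0 +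
        Δ i * (s i - truncSlope a b (s i))) := by
      refine Finset.sum_nonneg fun i hi => ?_
      have := truncSlope_sub ha hb hab (s i)
      have h3 := mul_nonneg (hΔ0 i (lt_of_lt_of_le (Finset.mem_range.1 hi) hr))
        (le_max_right (s i - 1 / (1 + b)) 0)
      linear_combination h3 + Δ i * this
    rw [Finset.sum_add_distrib] at h2
    have := hle r hr
    simp only [hy]
    linarith
  · intro r hr
    simp only [hy, Finset.sum_range_succ]
    ring
  · intro h0
    rw [hy00]
    refine Finset.sum_eq_zero fun i hi => ?_
    have := (hs i (Finset.mem_range.1 hi)).1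
    rw [h0, max_eq_right (by simpa using this), mul_zero]
  · intro h0
    rw [hyB]
    refine Finset.sum_eq_zero fun i hi => ?_
    have := (hs i (Finset.mem_range.1 hi)).2
    rw [h0, max_eq_right (by simpa using this), mul_zero]

section

open MeasureTheory

section EnvRate

variable {a b : ℝ}

lemma truncSlope_mono (a b : ℝ) : Monotone (truncSlope a b) := fun _ _ h =>
  min_le_min_right _ (max_le_max_right _ h)

/-- The truncated slope, moved slightly towards the middle of the fan so as to avoid the
degenerate densities `0` and `1`. -/
noncomputable def softSlope (a b η s : ℝ) : ℝ :=
  (1 - η) * truncSlope a b s + η * ((a / (1 + a) + 1 / (1 + b)) / 2)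

lemma softSlope_mono {η : ℝ} (hη : η ≤ 1) : Monotone (softSlope a b η) := fun _ _ h => by
  unfold softSlope
  have := mul_le_mul_of_nonneg_left (truncSlope_mono a b h) (sub_nonneg.2 hη)
  linarith

lemma softSlope_mem (ha : 0 ≤ a) (hb : 0 ≤ b) (hab : a * b < 1) {η : ℝ} (h0 : 0 ≤ η) (h1 : η ≤ 1)
    (s : ℝ) : softSlope a b η s ∈ Set.Icc (a / (1 + a)) (1 / (1 + b)) := by
  have h := lower_lt_upper ha hb hab
  obtain ⟨h2, h3⟩ := truncSlope_mem ha hb hab s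
  unfold softSlope
  constructor <;> nlinarith

lemma softSlope_pos (ha : 0 ≤ a) (hb : 0 ≤ b) (hab : a * b < 1) {η : ℝ} (h0 : 0 < η) (h1 : η ≤ 1)
    (s : ℝ) : 0 < softSlope a b η s := by
  have h := lower_lt_upper ha hb hab
  have h2 := truncSlope_mem_unit ha hb hab s
  have h3 := lower_nonneg ha
  have := mul_nonneg (sub_nonneg.2 h1) h2.1
  have : 0 < η * ((a / (1 + a) + 1 / (1 + b)) / 2) := mul_pos h0 (by linarith)
  unfold softSlope
  linarith

lemma softSlope_lt_one (ha : 0 ≤ a) (hb : 0 ≤ b) (hab : a * b < 1) {η : ℝ} (h0 : 0 < η)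
    (h1 : η ≤ 1) (s : ℝ) : softSlope a b η s < 1 := by
  have h := lower_lt_upper ha hb hab
  have h2 := truncSlope_mem_unit ha hb hab s
  have h3 := upper_le_one hb
  have := mul_nonneg (sub_nonneg.2 h1) (sub_nonneg.2 h2.2)
  have : 0 < η * (1 - (a / (1 + a) + 1 / (1 + b)) / 2) := mul_pos h0 (by linarith)
  unfold softSlope
  linarith

lemma mul_log_le_of_le {x y c s : ℝ} (hs : 0 ≤ s) (hc0 : 0 < c) (hx : 0 ≤ x) (h : c * x ≤ y)
    (hz : x = 0 → s = 0) :
    s * Real.log x + s * Real.log c ≤ s * Real.log y := by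
  rcases hx.eq_or_lt with h0 | h0
  · rw [hz h0.symm]; simp
  · rw [← mul_add, ← Real.log_mul h0.ne' hc0.ne', mul_comm x c]
    exact mul_le_mul_of_nonneg_left (Real.log_le_log (by positivity) h) hs

lemma envRate_add_log_le (ha : 0 ≤ a) (hb : 0 ≤ b) (hab : a * b < 1) {η : ℝ} (h0 : 0 < η)
    (h1 : η < 1) {s : ℝ} (hs : s ∈ Set.Icc (0 : ℝ) 1) :
    envRate a b s + Real.log (1 - η) ≤
      s * Real.log (softSlope a b η s) + (1 - s) * Real.log (1 - softSlope a b η s) := by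
  have h := lower_lt_upper ha hb hab
  have h2 := truncSlope_mem_unit ha hb hab s
  have hl := lower_nonneg ha
  have hu := upper_le_one hb
  have e1 := mul_log_le_of_le (x := truncSlope a b s) (y := softSlope a b η s) (c := 1 - η) hs.1
    (by linarith) h2.1
    (by unfold softSlope; nlinarith) (by
      intro hz
      unfold truncSlope at hz
      rcases min_eq_iff.1 hz with ⟨hz, -⟩ | ⟨hz, -⟩
      · have := le_max_left s (a / (1 + a)); linarith [hs.1]
      · linarith)
  have e2 := mul_log_le_of_le (x := 1 - truncSlope a b s) (y := 1 - softSlope a b η s) (c := 1 - η)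
    (sub_nonneg.2 hs.2)
    (by linarith)
    (sub_nonneg.2 h2.2)
    (by unfold softSlope; nlinarith) (by
      intro hz
      have hz : truncSlope a b s = 1 := by linarith
      have h3 : truncSlope a b s ≤ max s (a / (1 + a)) := min_le_left _ _
      rw [hz] at h3
      rcases le_max_iff.1 h3 with h4 | h4
      · linarith [hs.2]
      · linarith)
  unfold envRate
  linarith

/-- Gibbs' variational inequality for `envRate`. -/
lemma le_envRate (ha : 0 ≤ a) (hb : 0 ≤ b) (hab : a * b < 1) {p g : ℝ}
    (hp : p ∈ Set.Icc (0 : ℝ) 1) (hg0 : 0 < g) (hg1 : g < 1)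
    (hg : g ∈ Set.Icc (a / (1 + a)) (1 / (1 + b))) :
    p * Real.log g + (1 - p) * Real.log (1 - g) ≤ envRate a b p := by
  have h := lower_lt_upper ha hb hab
  have hl := lower_nonneg ha
  have hu := upper_le_one hb
  obtain ⟨ht0, ht1⟩ := truncSlope_mem_unit ha hb hab p
  have htp : p < truncSlope a b p → truncSlope a b p ≤ g := by
    intro h1
    unfold truncSlope at h1 ⊢
    rcases le_total p (a / (1 + a)) with h2 | h2
    · rw [max_eq_right h2]; exact (min_le_left _ _).trans hg.1
    · rw [max_eq_left h2] at h1; exact absurd (min_le_left p _) (not_le.2 h1)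
  have htp' : truncSlope a b p < p → g ≤ truncSlope a b p := by
    intro h1
    unfold truncSlope at h1 ⊢
    rcases le_total (max p (a / (1 + a))) (1 / (1 + b)) with h2 | h2
    · rw [min_eq_left h2] at h1; exact absurd (le_max_left p _) (not_le.2 h1)
    · rw [min_eq_right h2]; exact hg.2
  have hz : truncSlope a b p = 0 → p = 0 := by
    intro hz
    by_contra hne
    have := lt_of_le_of_ne hp.1 (Ne.symm hne)
    have := htp' (by rw [hz]; exact this)
    linarith
  have hz1 : truncSlope a b p = 1 → p = 1 := by
    intro hz
    by_contra hne
    have := lt_of_le_of_ne hp.2 hne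
    have := htp (by rw [hz]; exact this)
    linarith
  unfold envRate
  set t := truncSlope a b p
  rcases ht0.eq_or_lt with h0 | h0
  · rw [hz h0.symm, ← h0]
    have := Real.log_nonpos (by linarith : 0 ≤ 1 - g) (by linarith)
    simpa using this
  rcases ht1.eq_or_lt with h1 | h1
  · rw [hz1 h1, h1]
    have := Real.log_nonpos hg0.le hg1.le
    simpa using this
  have k1 : t * (Real.log g - Real.log t) ≤ g - t := by
    rw [← Real.log_div hg0.ne' h0.ne']
    have := mul_le_mul_of_nonneg_left (Real.log_le_sub_one_of_pos (div_pos hg0 h0)) h0.le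
    rwa [mul_sub, mul_div_cancel₀ _ h0.ne', mul_one] at this
  have k2 : (1 - t) * (Real.log (1 - g) - Real.log (1 - t)) ≤ (1 - g) - (1 - t) := by
    have h1' : 0 < 1 - t := by linarith
    have hg1' : 0 < 1 - g := by linarith
    rw [← Real.log_div hg1'.ne' h1'.ne']
    have := mul_le_mul_of_nonneg_left (Real.log_le_sub_one_of_pos (div_pos hg1' h1')) h1'.le
    rwa [mul_sub, mul_div_cancel₀ _ h1'.ne', mul_one] at this
  have k3 : (p - t) * ((Real.log g - Real.log t) - (Real.log (1 - g) - Real.log (1 - t))) ≤ 0 := by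
    rcases lt_trichotomy p t with hpt | hpt | hpt
    · have hgt := htp hpt
      have l1 := Real.log_le_log h0 hgt
      have l2 := Real.log_le_log (by linarith : 0 < 1 - g) (by linarith : 1 - g ≤ 1 - t)
      exact mul_nonpos_of_nonpos_of_nonneg (by linarith) (by linarith)
    · rw [hpt]; simp
    · have hgt := htp' hpt
      have l1 := Real.log_le_log hg0 hgt
      have l2 := Real.log_le_log (by linarith : 0 < 1 - t) (by linarith : 1 - t ≤ 1 - g)
      exact mul_nonpos_of_nonneg_of_nonpos (by linarith) (by linarith)
  nlinarith

lemma envRate_nonpos (ha : 0 ≤ a) (hb : 0 ≤ b) (hab : a * b < 1) {s : ℝ}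
    (hs : s ∈ Set.Icc (0 : ℝ) 1) : envRate a b s ≤ 0 := by
  obtain ⟨h0, h1⟩ := truncSlope_mem_unit ha hb hab s
  exact add_nonpos (mul_nonpos_of_nonneg_of_nonpos hs.1 (Real.log_nonpos h0 h1))
    (mul_nonpos_of_nonneg_of_nonpos (sub_nonneg.2 hs.2)
      (Real.log_nonpos (sub_nonneg.2 h1) (by linarith)))

lemma measurable_envRate (a b : ℝ) : Measurable (envRate a b) := by
  unfold envRate truncSlope
  fun_prop

lemma Hent_eq_envRate {s : ℝ} (hs : s ∈ Set.Icc (0 : ℝ) 1) : Hent s = envRate 0 0 s := by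
  simp [Hent, envRate, truncSlope, max_eq_left hs.1, min_eq_left hs.2]

lemma exists_envRate_bound (ha : 0 ≤ a) (hb : 0 ≤ b) (hab : a * b < 1) :
    ∃ K : ℝ, ∀ s ∈ Set.Icc (0 : ℝ) 1, |envRate a b s| ≤ K := by
  obtain ⟨m, hm⟩ : ∃ m, m = softSlope a b 1 0 := ⟨_, rfl⟩
  have hm0 : 0 < m := hm ▸ softSlope_pos ha hb hab one_pos le_rfl 0
  have hm1 : m < 1 := hm ▸ softSlope_lt_one ha hb hab one_pos le_rfl 0
  refine ⟨-(Real.log m + Real.log (1 - m)), fun s hs => ?_⟩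
  have h1 := envRate_nonpos ha hb hab hs
  have h2 := le_envRate ha hb hab hs hm0 hm1 (hm ▸ softSlope_mem ha hb hab zero_le_one le_rfl 0)
  have l1 := Real.log_nonpos hm0.le hm1.le
  have l2 := Real.log_nonpos (by linarith : 0 ≤ 1 - m) (by linarith)
  rw [abs_of_nonpos h1]
  nlinarith [hs.1, hs.2, mul_nonneg hs.1 (neg_nonneg.2 l2),
    mul_nonneg (sub_nonneg.2 hs.2) (neg_nonneg.2 l1)]

lemma integrable_envRate_comp (ha : 0 ≤ a) (hb : 0 ≤ b) (hab : a * b < 1) {u : ℝ → ℝ}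
    (hu : Measurable u) {x y : ℝ} (hxy : x ≤ y) (hu1 : ∀ t ∈ Set.Ioo x y, u t ∈ Set.Icc (0 : ℝ) 1) :
    IntervalIntegrable (fun t => envRate a b (u t)) volume x y := by
  obtain ⟨K, hK⟩ := exists_envRate_bound ha hb hab
  rw [intervalIntegrable_iff_integrableOn_Ioo_of_le hxy]
  refine Measure.integrableOn_of_bounded (M := K) (by simp)
    ((measurable_envRate a b).comp hu).aestronglyMeasurable ?_
  refine (ae_restrict_iff' measurableSet_Ioo).2 (Filter.Eventually.of_forall fun t ht => ?_)
  exact hK _ (hu1 t ht)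

lemma integrable_unit {u : ℝ → ℝ}
    (hu : Measurable u) {x y : ℝ} (hxy : x ≤ y) (hu1 : ∀ t ∈ Set.Ioo x y, u t ∈ Set.Icc (0 : ℝ) 1) :
    IntervalIntegrable u volume x y := by
  rw [intervalIntegrable_iff_integrableOn_Ioo_of_le hxy]
  refine Measure.integrableOn_of_bounded (M := 1) (by simp) hu.aestronglyMeasurable ?_
  refine (ae_restrict_iff' measurableSet_Ioo).2 (Filter.Eventually.of_forall fun t ht => ?_)
  have := hu1 t ht
  rw [Real.norm_eq_abs, abs_of_nonneg this.1]
  exact this.2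

/-- Jensen's inequality for `envRate`. -/
lemma mul_envRate_le_integral (ha : 0 ≤ a) (hb : 0 ≤ b) (hab : a * b < 1) {u : ℝ → ℝ}
    (hu : Measurable u) {x y : ℝ} (hxy : x ≤ y) (hu1 : ∀ t ∈ Set.Ioo x y, u t ∈ Set.Icc (0 : ℝ) 1)
    {m : ℝ} (hm : m ∈ Set.Icc (0 : ℝ) 1) (hint : ∫ t in x..y, u t = (y - x) * m) :
    (y - x) * envRate a b m ≤ ∫ t in x..y, envRate a b (u t) := by
  have key : ∀ η : ℝ, 0 < η → η < 1 →
      (y - x) * (envRate a b m + Real.log (1 - η)) ≤ ∫ t in x..y, envRate a b (u t) := by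
    intro η h0 h1
    have e := envRate_add_log_le ha hb hab h0 h1 hm
    set g := softSlope a b η m
    have hi := integrable_unit hu hxy hu1
    calc (y - x) * (envRate a b m + Real.log (1 - η))
        ≤ (y - x) * (m * Real.log g + (1 - m) * Real.log (1 - g)) :=
          mul_le_mul_of_nonneg_left e (sub_nonneg.2 hxy)
      _ = ∫ t in x..y, (u t * (Real.log g - Real.log (1 - g)) + Real.log (1 - g)) := by
          rw [intervalIntegral.integral_add (hi.mul_const _) (by simp),
            intervalIntegral.integral_mul_const, hint, intervalIntegral.integral_const,
            smul_eq_mul]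
          ring
      _ ≤ ∫ t in x..y, envRate a b (u t) := by
          refine intervalIntegral.integral_mono_on_of_le_Ioo hxy
            ((hi.mul_const _).add (by simp))
            (integrable_envRate_comp ha hb hab hu hxy hu1) fun t ht => ?_
          have := le_envRate ha hb hab (hu1 t ht) (softSlope_pos ha hb hab h0 h1.le m)
            (softSlope_lt_one ha hb hab h0 h1.le m) (softSlope_mem ha hb hab h0.le h1.le m)
          simp only [g]
          linarith
  have hlim : Filter.Tendsto (fun η : ℝ => (y - x) * (envRate a b m + Real.log (1 - η)))
      (nhdsWithin 0 (Set.Ioi 0)) (nhds ((y - x) * (envRate a b m + Real.log (1 - 0)))) := by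
    refine Filter.Tendsto.mono_left ?_ nhdsWithin_le_nhds
    refine ContinuousAt.tendsto (f := fun η : ℝ => (y - x) * (envRate a b m + Real.log (1 - η))) ?_
    have : ContinuousAt (fun η : ℝ => Real.log (1 - η)) 0 :=
      ContinuousAt.log (by fun_prop) (by norm_num)
    fun_prop
  simp only [sub_zero, Real.log_one, add_zero] at hlim
  refine le_of_tendsto hlim ?_
  filter_upwards [Ioo_mem_nhdsGT (zero_lt_one' ℝ)] with η hη
  exact key η hη.1 hη.2

end EnvRate

/-- Nondecreasing `1`-Lipschitz functions on `[0,1]` vanishing at `0`. -/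
structure IsProfile (F : ℝ → ℝ) : Prop where
  zero : F 0 = 0
  mono : MonotoneOn F (Set.Icc 0 1)
  lip : LipschitzOnWith 1 F (Set.Icc 0 1)

namespace IsProfile

variable {F : ℝ → ℝ}

lemma sub_le (h : IsProfile F) {s t : ℝ} (hs : 0 ≤ s) (hst : s ≤ t) (ht : t ≤ 1) :
    F t - F s ≤ t - s := by
  have h1 := h.lip.dist_le_mul t ⟨hs.trans hst, ht⟩ s ⟨hs, hst.trans ht⟩
  rw [Real.dist_eq, Real.dist_eq, abs_of_nonneg (sub_nonneg.2 hst)] at h1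
  have := le_abs_self (F t - F s)
  simpa using this.trans h1

lemma le_of_le (h : IsProfile F) {s t : ℝ} (hs : 0 ≤ s) (hst : s ≤ t) (ht : t ≤ 1) : F s ≤ F t :=
  h.mono ⟨hs, hst.trans ht⟩ ⟨hs.trans hst, ht⟩ hst

lemma of_bounds (h0 : F 0 = 0) (h1 : ∀ s t, 0 ≤ s → s ≤ t → t ≤ 1 → F s ≤ F t)
    (h2 : ∀ s t, 0 ≤ s → s ≤ t → t ≤ 1 → F t - F s ≤ t - s) : IsProfile F := by
  refine ⟨h0, fun s hs t ht hst => h1 s t hs.1 hst ht.2, ?_⟩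
  refine LipschitzOnWith.of_dist_le_mul fun s hs t ht => ?_
  rw [Real.dist_eq, Real.dist_eq, NNReal.coe_one, one_mul]
  rcases le_total s t with h | h
  · rw [abs_sub_comm (F s), abs_sub_comm s, abs_of_nonneg (sub_nonneg.2 (h1 s t hs.1 h ht.2)),
      abs_of_nonneg (sub_nonneg.2 h)]
    exact h2 s t hs.1 h ht.2
  · rw [abs_of_nonneg (sub_nonneg.2 (h1 t s ht.1 h hs.2)), abs_of_nonneg (sub_nonneg.2 h)]
    exact h2 t s ht.1 h hs.2

lemma deriv_mem (h : IsProfile F) {x : ℝ} (hx : x ∈ Set.Ioo (0 : ℝ) 1) :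
    deriv F x ∈ Set.Icc (0 : ℝ) 1 := by
  have hn : Set.Icc (0 : ℝ) 1 ∈ nhds x := Icc_mem_nhds hx.1 hx.2
  constructor
  · rw [← derivWithin_of_mem_nhds hn]
    exact h.mono.derivWithin_nonneg
  · have := norm_deriv_le_of_lipschitzOn hn h.lip
    rw [NNReal.coe_one] at this
    exact (le_abs_self _).trans this

lemma integral_deriv (h : IsProfile F) {s t : ℝ} (hs : 0 ≤ s) (hst : s ≤ t) (ht : t ≤ 1) :
    ∫ x in s..t, deriv F x = F t - F s := by
  refine (LipschitzOnWith.absolutelyContinuousOnInterval (K := 1)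
    (h.lip.mono ?_)).integral_deriv_eq_sub
  rw [Set.uIcc_of_le hst]
  exact Set.Icc_subset_Icc hs ht

lemma slope_mem (h : IsProfile F) {s t m : ℝ} (hs : 0 ≤ s) (hst : s < t) (ht : t ≤ 1)
    (hm : (t - s) * m = F t - F s) : m ∈ Set.Icc (0 : ℝ) 1 := by
  have h1 := h.sub_le hs hst.le ht
  have h2 := h.le_of_le hs hst.le ht
  have h3 := sub_pos.2 hst
  constructor
  · by_contra! hneg
    have := mul_neg_of_pos_of_neg h3 hneg
    linarith
  · by_contra! hneg
    have := mul_lt_mul_of_pos_left hneg h3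
    linarith

lemma integrable_envRate (h : IsProfile F) {a b : ℝ} (ha : 0 ≤ a) (hb : 0 ≤ b) (hab : a * b < 1)
    {s t : ℝ} (hs : 0 ≤ s) (hst : s ≤ t) (ht : t ≤ 1) :
    IntervalIntegrable (fun x => envRate a b (deriv F x)) volume s t :=
  integrable_envRate_comp ha hb hab (measurable_deriv F) hst fun _ hx =>
    h.deriv_mem ⟨hs.trans_lt hx.1, hx.2.trans_le ht⟩

end IsProfile

lemma mesh_mono {B : ℕ} {Δ : ℕ → ℝ} (hΔ0 : ∀ r < B, 0 < Δ r) {i j : ℕ} (hij : i ≤ j) (hj : j ≤ B) :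
    ∑ r ∈ Finset.range i, Δ r ≤ ∑ r ∈ Finset.range j, Δ r :=
  Finset.sum_le_sum_of_subset_of_nonneg (Finset.range_mono hij) fun r hr _ =>
    (hΔ0 r (lt_of_lt_of_le (Finset.mem_range.1 hr) hj)).le

lemma mesh_mem {B : ℕ} {Δ : ℕ → ℝ} (hΔ0 : ∀ r < B, 0 < Δ r)
    (hΔ1 : ∑ r ∈ Finset.range B, Δ r = 1) {r : ℕ} (hr : r ≤ B) :
    ∑ i ∈ Finset.range r, Δ i ∈ Set.Icc (0 : ℝ) 1 := by
  have h1 := mesh_mono hΔ0 (Nat.zero_le r) hr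
  have h2 := mesh_mono hΔ0 hr le_rfl
  rw [Finset.sum_range_zero] at h1
  rw [hΔ1] at h2
  exact ⟨h1, h2⟩

/-- Jensen's inequality along a mesh. -/
lemma IsProfile.sum_envRate_le {F : ℝ → ℝ} (h : IsProfile F) {a b : ℝ} (ha : 0 ≤ a) (hb : 0 ≤ b)
    (hab : a * b < 1) {B : ℕ} {Δ m : ℕ → ℝ} (hΔ0 : ∀ r < B, 0 < Δ r)
    (hΔ1 : ∑ r ∈ Finset.range B, Δ r = 1)
    (hm : ∀ r < B, Δ r * m r =
      F (∑ i ∈ Finset.range (r + 1), Δ i) - F (∑ i ∈ Finset.range r, Δ i)) :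
    ∑ r ∈ Finset.range B, Δ r * envRate a b (m r) ≤ ∫ x in (0 : ℝ)..1, envRate a b (deriv F x) := by
  set T : ℕ → ℝ := fun r => ∑ i ∈ Finset.range r, Δ i with hT
  have hTs : ∀ r, T (r + 1) - T r = Δ r := fun r => by simp [hT, Finset.sum_range_succ]
  have hT0 : T 0 = 0 := by simp [hT]
  have hmem : ∀ r ≤ B, T r ∈ Set.Icc (0 : ℝ) 1 := fun r hr => mesh_mem hΔ0 hΔ1 hr
  have hlt : ∀ r < B, T r < T (r + 1) := fun r hr => by linarith [hTs r, hΔ0 r hr]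
  have hsum := intervalIntegral.sum_integral_adjacent_intervals (a := T) (n := B) (μ := volume)
    (f := fun x => envRate a b (deriv F x)) fun r hr =>
      h.integrable_envRate ha hb hab (hmem r hr.le).1 (hlt r hr).le (hmem (r + 1) hr).2
  rw [hT0, show T B = 1 from hΔ1] at hsum
  rw [← hsum]
  refine Finset.sum_le_sum fun r hr => ?_
  rw [Finset.mem_range] at hr
  have h1 := (hmem r hr.le).1
  have h2 := (hmem (r + 1) hr).2
  have hmr : (T (r + 1) - T r) * m r = F (T (r + 1)) - F (T r) := by rw [hTs]; exact hm r hr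
  rw [← hTs r]
  refine mul_envRate_le_integral ha hb hab (measurable_deriv F) (hlt r hr).le (fun x hx =>
    h.deriv_mem ⟨h1.trans_lt hx.1, hx.2.trans_le h2⟩) (h.slope_mem h1 (hlt r hr) h2 hmr) ?_
  rw [h.integral_deriv h1 (hlt r hr).le h2, hmr]

namespace IsProfile

variable {F : ℝ → ℝ}

lemma le_convEnv {g : ℝ → ℝ} (hg : ConvexOn ℝ (Set.Icc (0 : ℝ) 1) g)
    (hgF : ∀ t ∈ Set.Icc (0 : ℝ) 1, g t ≤ F t) {x : ℝ} (hx : x ∈ Set.Icc (0 : ℝ) 1) :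
    g x ≤ convEnv F x := by
  refine le_csSup ⟨F x, ?_⟩ ⟨g, hg, hgF, rfl⟩
  rintro _ ⟨g', -, h', rfl⟩
  exact h' x hx

lemma nonneg (h : IsProfile F) {t : ℝ} (ht : t ∈ Set.Icc (0 : ℝ) 1) : 0 ≤ F t := by
  rw [← h.zero]; exact h.le_of_le le_rfl ht.1 ht.2

lemma convEnv_le_of (h : IsProfile F) {x y : ℝ}
    (hy : ∀ g : ℝ → ℝ, ConvexOn ℝ (Set.Icc (0 : ℝ) 1) g →
      (∀ t ∈ Set.Icc (0 : ℝ) 1, g t ≤ F t) → g x ≤ y) : convEnv F x ≤ y := by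
  refine csSup_le ⟨0, fun _ => 0, convexOn_const 0 (convex_Icc 0 1), fun t ht => h.nonneg ht, rfl⟩ ?_
  rintro _ ⟨g, hg, hgF, rfl⟩
  exact hy g hg hgF

lemma convEnv_le (h : IsProfile F) {x : ℝ} (hx : x ∈ Set.Icc (0 : ℝ) 1) : convEnv F x ≤ F x :=
  h.convEnv_le_of fun _ _ hgF => hgF x hx

lemma convexOn_convEnv (h : IsProfile F) : ConvexOn ℝ (Set.Icc (0 : ℝ) 1) (convEnv F) := by
  refine ⟨convex_Icc 0 1, fun x hx y hy s t hs ht hst => ?_⟩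
  refine h.convEnv_le_of fun g hg hgF => (hg.2 hx hy hs ht hst).trans ?_
  simp only [smul_eq_mul]
  exact add_le_add (mul_le_mul_of_nonneg_left (le_convEnv hg hgF hx) hs)
    (mul_le_mul_of_nonneg_left (le_convEnv hg hgF hy) ht)

lemma convEnv_one (h : IsProfile F) : convEnv F 1 = F 1 := by
  refine le_antisymm (h.convEnv_le (by simp)) ?_
  have := le_convEnv (F := F) (g := fun t => t + (F 1 - 1)) (x := 1)
    ((convexOn_id (convex_Icc 0 1)).add_const _) (fun t ht => by
      have := h.sub_le ht.1 ht.2 le_rfl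
      linarith) (by simp)
  linarith

lemma convEnv_nonneg (h : IsProfile F) {x : ℝ} (hx : x ∈ Set.Icc (0 : ℝ) 1) : 0 ≤ convEnv F x :=
  le_convEnv (F := F) (g := fun _ => 0) (convexOn_const 0 (convex_Icc 0 1))
    (fun _ ht => h.nonneg ht) hx

lemma convEnv_zero (h : IsProfile F) : convEnv F 0 = 0 :=
  le_antisymm ((h.convEnv_le (by simp)).trans h.zero.le) (h.convEnv_nonneg (by simp))

lemma convEnv_isProfile (h : IsProfile F) : IsProfile (convEnv F) := by
  have hc := h.convexOn_convEnv
  refine of_bounds h.convEnv_zero ?_ ?_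
  · intro s t hs hst ht
    rcases (hs.trans hst).eq_or_lt with h0 | h0
    · rw [le_antisymm (hst.trans h0.symm.le) hs, ← h0]
    have h1 := hc.2 (show (0 : ℝ) ∈ Set.Icc (0 : ℝ) 1 by simp)
      (show t ∈ Set.Icc (0 : ℝ) 1 from ⟨h0.le, ht⟩)
      (show 0 ≤ 1 - s / t by rw [sub_nonneg, div_le_one h0]; exact hst)
      (show 0 ≤ s / t by positivity) (by ring)
    simp only [smul_eq_mul, mul_zero, zero_add, h.convEnv_zero, div_mul_cancel₀ _ h0.ne'] at h1
    have h2 : s / t * convEnv F t ≤ 1 * convEnv F t :=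
      mul_le_mul_of_nonneg_right ((div_le_one h0).2 hst) (h.convEnv_nonneg ⟨h0.le, ht⟩)
    linarith
  · intro s t hs hst ht
    rcases (hst.trans ht).eq_or_lt with h0 | h0
    · rw [le_antisymm hst (ht.trans h0.symm.le)]; simp
    have h0' : 0 < 1 - s := by linarith
    have hl : 0 ≤ (t - s) / (1 - s) := div_nonneg (by linarith) h0'.le
    have h1 := hc.2 (show s ∈ Set.Icc (0 : ℝ) 1 from ⟨hs, h0.le⟩)
      (show (1 : ℝ) ∈ Set.Icc (0 : ℝ) 1 by simp)
      (show 0 ≤ 1 - (t - s) / (1 - s) by rw [sub_nonneg, div_le_one h0']; linarith) hl (by ring)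
    have e : (1 - (t - s) / (1 - s)) • s + ((t - s) / (1 - s)) • (1 : ℝ) = t := by
      simp only [smul_eq_mul]; field_simp; ring
    rw [e] at h1
    simp only [smul_eq_mul] at h1
    have h2 : convEnv F 1 - convEnv F s ≤ 1 - s := by
      rw [h.convEnv_one]
      have := le_convEnv (F := F) (g := fun t => t + (F 1 - 1)) (x := s)
        ((convexOn_id (convex_Icc 0 1)).add_const _) (fun t ht => by
          have := h.sub_le ht.1 ht.2 le_rfl
          linarith) ⟨hs, h0.le⟩
      linarith
    have h3 := mul_le_mul_of_nonneg_left h2 hl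
    rw [div_mul_cancel₀ _ h0'.ne'] at h3
    linarith

end IsProfile

lemma extendF_zero (f : C0Sp) : extendF f.val 0 = 0 := by
  have := f.property
  simpa [extendF, Set.projIcc] using this

/-- The rate function on profiles. -/
lemma rateI_eq {a b : ℝ} (f : C0Sp) (h : IsProfile (extendF f.val)) :
    rateI a b f = (((∫ x in (0 : ℝ)..1, envRate 0 0 (deriv (extendF f.val) x)) +
      (∫ x in (0 : ℝ)..1, envRate a b (deriv (convEnv (extendF f.val)) x)) -
      Real.log (Jfun a b) : ℝ) : EReal) := by
  rw [rateI, if_pos ⟨h.mono, h.lip⟩]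
  have hH : ∫ x in (0 : ℝ)..1, Hent (deriv (extendF f.val) x) =
      ∫ x in (0 : ℝ)..1, envRate 0 0 (deriv (extendF f.val) x) := by
    rw [intervalIntegral.integral_of_le zero_le_one, intervalIntegral.integral_of_le zero_le_one,
      integral_Ioc_eq_integral_Ioo, integral_Ioc_eq_integral_Ioo]
    exact setIntegral_congr_fun measurableSet_Ioo fun x hx => Hent_eq_envRate (h.deriv_mem hx)
  rw [hH]
  rfl

lemma isProfile_of_rateI_ne_top {a b : ℝ} (f : C0Sp) (h : rateI a b f ≠ ⊤) :
    IsProfile (extendF f.val) := by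
  unfold rateI at h
  split_ifs at h with h1
  · exact ⟨extendF_zero f, h1.1, h1.2⟩
  · exact absurd rfl h

/-- The polygonal line with slopes `v` over the mesh with steps `Δ`. -/
noncomputable def polyline (B : ℕ) (Δ v : ℕ → ℝ) (t : ℝ) : ℝ :=
  ∑ r ∈ Finset.range B, v r * min (Δ r) (max 0 (t - ∑ i ∈ Finset.range r, Δ i))

section Polyline

variable {B : ℕ} {Δ : ℕ → ℝ}

lemma exists_mesh_block (hΔ1 : ∑ r ∈ Finset.range B, Δ r = 1) {t : ℝ}
    (ht : t ∈ Set.Icc (0 : ℝ) 1) :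
    ∃ j < B, t ∈ Set.Icc (∑ i ∈ Finset.range j, Δ i) (∑ i ∈ Finset.range (j + 1), Δ i) := by
  have key : ∀ n, t ≤ ∑ i ∈ Finset.range n, Δ i → n = 0 ∨
      ∃ j < n, t ∈ Set.Icc (∑ i ∈ Finset.range j, Δ i) (∑ i ∈ Finset.range (j + 1), Δ i) := by
    intro n
    induction n with
    | zero => exact fun _ => Or.inl rfl
    | succ n ih =>
      intro h
      right
      rcases le_total t (∑ i ∈ Finset.range n, Δ i) with h1 | h1
      · rcases ih h1 with rfl | ⟨j, hj, h2⟩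
        · exact ⟨0, by simp, by simpa using ht.1, h⟩
        · exact ⟨j, by omega, h2⟩
      · exact ⟨n, by omega, h1, h⟩
  rcases key B (by rw [hΔ1]; exact ht.2) with rfl | h
  · simp at hΔ1
  · exact h

lemma polyline_block (hΔ0 : ∀ r < B, 0 < Δ r) (v : ℕ → ℝ) {j : ℕ} (hj : j < B) {t : ℝ}
    (ht : t ∈ Set.Icc (∑ i ∈ Finset.range j, Δ i) (∑ i ∈ Finset.range (j + 1), Δ i)) :
    polyline B Δ v t =
      ∑ i ∈ Finset.range j, Δ i * v i + v j * (t - ∑ i ∈ Finset.range j, Δ i) := by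
  obtain ⟨m, rfl⟩ : ∃ m, B = j + 1 + m := ⟨B - (j + 1), by omega⟩
  rw [polyline, Finset.sum_range_add, Finset.sum_range_succ]
  have h1 : ∀ r ∈ Finset.range m, v (j + 1 + r) *
      min (Δ (j + 1 + r)) (max 0 (t - ∑ i ∈ Finset.range (j + 1 + r), Δ i)) = 0 := by
    intro r hr
    rw [Finset.mem_range] at hr
    have := mesh_mono hΔ0 (Nat.le_add_right (j + 1) r) (by omega)
    rw [max_eq_left (by linarith [ht.2]), min_eq_right (hΔ0 _ (by omega)).le, mul_zero]
  rw [Finset.sum_eq_zero h1, add_zero]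
  congr 1
  · refine Finset.sum_congr rfl fun r hr => ?_
    rw [Finset.mem_range] at hr
    have := mesh_mono hΔ0 (show r + 1 ≤ j from hr) (by omega)
    rw [Finset.sum_range_succ] at this
    have := hΔ0 r (by omega)
    rw [max_eq_right (by linarith [ht.1]), min_eq_left (by linarith [ht.1]), mul_comm]
  · have := ht.2
    rw [Finset.sum_range_succ] at this
    rw [max_eq_right (by linarith [ht.1]), min_eq_right (by linarith)]

lemma polyline_knot (hΔ0 : ∀ r < B, 0 < Δ r) (v : ℕ → ℝ) {j : ℕ} (hj : j ≤ B) :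
    polyline B Δ v (∑ i ∈ Finset.range j, Δ i) = ∑ i ∈ Finset.range j, Δ i * v i := by
  rcases hj.lt_or_eq with h | rfl
  · rw [polyline_block hΔ0 v h ⟨le_rfl, mesh_mono hΔ0 (Nat.le_succ j) h⟩]
    ring
  · rw [polyline]
    refine Finset.sum_congr rfl fun r hr => ?_
    rw [Finset.mem_range] at hr
    have := mesh_mono hΔ0 (show r + 1 ≤ j from hr) le_rfl
    rw [Finset.sum_range_succ] at this
    have := hΔ0 r hr
    rw [max_eq_right (by linarith), min_eq_left (by linarith), mul_comm]

lemma affine_le_of_endpoints {p w A m A' m' t : ℝ} (hw : 0 < w) (ht : t ∈ Set.Icc p (p + w))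
    (h0 : A ≤ A') (h1 : A + m * w ≤ A' + m' * w) : A + m * (t - p) ≤ A' + m' * (t - p) := by
  have h2 := mul_le_mul_of_nonneg_left h1 (sub_nonneg.2 ht.1)
  have h3 := mul_le_mul_of_nonneg_left h0 (sub_nonneg.2 ht.2)
  have h4 : w * (A + m * (t - p)) ≤ w * (A' + m' * (t - p)) := by linarith
  exact le_of_mul_le_mul_left h4 hw

lemma affine_le_polyline (hΔ0 : ∀ r < B, 0 < Δ r) (hΔ1 : ∑ r ∈ Finset.range B, Δ r = 1)
    {v : ℕ → ℝ} {A m : ℝ}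
    (h : ∀ j ≤ B, A + m * ∑ i ∈ Finset.range j, Δ i ≤ ∑ i ∈ Finset.range j, Δ i * v i)
    {t : ℝ} (ht : t ∈ Set.Icc (0 : ℝ) 1) : A + m * t ≤ polyline B Δ v t := by
  obtain ⟨j, hj, htj⟩ := exists_mesh_block hΔ1 ht
  rw [polyline_block hΔ0 v hj htj]
  have h0 := h j hj.le
  have h1 := h (j + 1) hj
  rw [Finset.sum_range_succ] at htj
  rw [Finset.sum_range_succ, Finset.sum_range_succ] at h1
  have := affine_le_of_endpoints (m := m) (m' := v j) (hΔ0 j hj) htj h0 (by linarith)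
  linarith

lemma polyline_le_polyline (hΔ0 : ∀ r < B, 0 < Δ r) (hΔ1 : ∑ r ∈ Finset.range B, Δ r = 1)
    {v w : ℕ → ℝ}
    (h : ∀ j ≤ B, ∑ i ∈ Finset.range j, Δ i * v i ≤ ∑ i ∈ Finset.range j, Δ i * w i)
    {t : ℝ} (ht : t ∈ Set.Icc (0 : ℝ) 1) : polyline B Δ v t ≤ polyline B Δ w t := by
  obtain ⟨j, hj, htj⟩ := exists_mesh_block hΔ1 ht
  rw [polyline_block hΔ0 v hj htj, polyline_block hΔ0 w hj htj]
  have h0 := h j hj.le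
  have h1 := h (j + 1) hj
  rw [Finset.sum_range_succ] at htj
  rw [Finset.sum_range_succ, Finset.sum_range_succ] at h1
  exact affine_le_of_endpoints (hΔ0 j hj) htj h0 (by linarith)

lemma tangent_le_knot (hΔ0 : ∀ r < B, 0 < Δ r) {v : ℕ → ℝ}
    (hv : ∀ i j, i ≤ j → j < B → v i ≤ v j) {j : ℕ} (hj : j < B) {i : ℕ} (hi : i ≤ B) :
    ∑ r ∈ Finset.range j, Δ r * v r +
      v j * (∑ r ∈ Finset.range i, Δ r - ∑ r ∈ Finset.range j, Δ r) ≤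
        ∑ r ∈ Finset.range i, Δ r * v r := by
  rcases le_total i j with h | h
  · obtain ⟨m, rfl⟩ := Nat.exists_eq_add_of_le h
    rw [Finset.sum_range_add, Finset.sum_range_add]
    have : ∑ x ∈ Finset.range m, Δ (i + x) * v (i + x) ≤
        ∑ x ∈ Finset.range m, Δ (i + x) * v (i + m) :=
      Finset.sum_le_sum fun x hx => by
        rw [Finset.mem_range] at hx
        exact mul_le_mul_of_nonneg_left (hv _ _ (by omega) hj) (hΔ0 _ (by omega)).le
    rw [← Finset.sum_mul] at this
    linarith
  · obtain ⟨m, rfl⟩ := Nat.exists_eq_add_of_le h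
    rw [Finset.sum_range_add, Finset.sum_range_add]
    have : ∑ x ∈ Finset.range m, Δ (j + x) * v j ≤
        ∑ x ∈ Finset.range m, Δ (j + x) * v (j + x) :=
      Finset.sum_le_sum fun x hx => by
        rw [Finset.mem_range] at hx
        exact mul_le_mul_of_nonneg_left (hv _ _ (by omega) (by omega)) (hΔ0 _ (by omega)).le
    rw [← Finset.sum_mul] at this
    linarith

lemma convexOn_polyline (hΔ0 : ∀ r < B, 0 < Δ r) (hΔ1 : ∑ r ∈ Finset.range B, Δ r = 1)
    {v : ℕ → ℝ} (hv : ∀ i j, i ≤ j → j < B → v i ≤ v j) :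
    ConvexOn ℝ (Set.Icc (0 : ℝ) 1) (polyline B Δ v) := by
  refine ⟨convex_Icc 0 1, fun x hx y hy s t hs ht hst => ?_⟩
  have hz := convex_Icc (0 : ℝ) 1 hx hy hs ht hst
  obtain ⟨j, hj, hzj⟩ := exists_mesh_block hΔ1 hz
  rw [polyline_block hΔ0 v hj hzj]
  set A := ∑ i ∈ Finset.range j, Δ i * v i - v j * ∑ i ∈ Finset.range j, Δ i with hA
  have key : ∀ u ∈ Set.Icc (0 : ℝ) 1, A + v j * u ≤ polyline B Δ v u := fun u hu =>
    affine_le_polyline hΔ0 hΔ1 (fun i hi => by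
      have := tangent_le_knot hΔ0 hv hj hi
      linarith) hu
  have h1 := mul_le_mul_of_nonneg_left (key x hx) hs
  have h2 := mul_le_mul_of_nonneg_left (key y hy) ht
  simp only [smul_eq_mul] at *
  have h3 : A * s + A * t = A := by rw [← mul_add, hst, mul_one]
  linarith

lemma continuous_polyline (v : ℕ → ℝ) : Continuous (polyline B Δ v) := by
  unfold polyline
  fun_prop

lemma polyline_mono {v : ℕ → ℝ} (hv : ∀ r < B, 0 ≤ v r) :
    Monotone (polyline B Δ v) := fun s t hst =>
  Finset.sum_le_sum fun r hr => mul_le_mul_of_nonneg_left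
    (min_le_min le_rfl (max_le_max le_rfl (by linarith))) (hv r (Finset.mem_range.1 hr))

lemma polyline_isProfile (hΔ0 : ∀ r < B, 0 < Δ r) (hΔ1 : ∑ r ∈ Finset.range B, Δ r = 1)
    {v : ℕ → ℝ} (hv : ∀ r < B, v r ∈ Set.Icc (0 : ℝ) 1) {F : ℝ → ℝ}
    (hF : ∀ t ∈ Set.Icc (0 : ℝ) 1, F t = polyline B Δ v t) : IsProfile F := by
  refine IsProfile.of_bounds ?_ ?_ ?_
  · rw [hF 0 (by simp)]
    have := polyline_knot hΔ0 v (Nat.zero_le B)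
    simpa using this
  · intro s t hs hst ht
    rw [hF s ⟨hs, hst.trans ht⟩, hF t ⟨hs.trans hst, ht⟩]
    exact polyline_mono (fun r hr => (hv r hr).1) hst
  · intro s t hs hst ht
    rw [hF s ⟨hs, hst.trans ht⟩, hF t ⟨hs.trans hst, ht⟩]
    have h1 := polyline_mono (Δ := Δ) (v := fun r => 1 - v r) (fun r hr => by
      have := (hv r hr).2
      linarith) hst
    have h2 : ∀ u ∈ Set.Icc (0 : ℝ) 1, polyline B Δ (fun r => 1 - v r) u =
        u - polyline B Δ v u := by
      intro u hu
      obtain ⟨j, hj, huj⟩ := exists_mesh_block hΔ1 hu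
      rw [polyline_block hΔ0 _ hj huj, polyline_block hΔ0 _ hj huj]
      simp only [mul_sub, mul_one, Finset.sum_sub_distrib]
      ring
    rw [h2 s ⟨hs, hst.trans ht⟩, h2 t ⟨hs.trans hst, ht⟩] at h1
    linarith

lemma integral_comp_deriv_polyline (hΔ0 : ∀ r < B, 0 < Δ r)
    (hΔ1 : ∑ r ∈ Finset.range B, Δ r = 1) {v : ℕ → ℝ} {F : ℝ → ℝ}
    (hF : ∀ t ∈ Set.Icc (0 : ℝ) 1, F t = polyline B Δ v t) (ψ : ℝ → ℝ) :
    ∫ x in (0 : ℝ)..1, ψ (deriv F x) = ∑ r ∈ Finset.range B, Δ r * ψ (v r) := by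
  set T : ℕ → ℝ := fun r => ∑ i ∈ Finset.range r, Δ i with hT
  have hTs : ∀ r, T (r + 1) - T r = Δ r := fun r => by simp [hT, Finset.sum_range_succ]
  have hmem : ∀ r ≤ B, T r ∈ Set.Icc (0 : ℝ) 1 := fun r hr => mesh_mem hΔ0 hΔ1 hr
  have hlt : ∀ r < B, T r < T (r + 1) := fun r hr => by linarith [hTs r, hΔ0 r hr]
  have hd : ∀ r < B, ∀ x ∈ Set.Ioo (T r) (T (r + 1)), ψ (deriv F x) = ψ (v r) := by
    intro r hr x hx
    have he : F =ᶠ[nhds x] fun t => ∑ i ∈ Finset.range r, Δ i * v i + v r * (t - T r) := by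
      filter_upwards [Ioo_mem_nhds hx.1 hx.2] with t ht
      rw [hF t ⟨(hmem r hr.le).1.trans ht.1.le, ht.2.le.trans (hmem (r + 1) hr).2⟩,
        polyline_block hΔ0 v hr ⟨ht.1.le, ht.2.le⟩]
    rw [he.deriv_eq]
    simp
  have hi : ∀ r < B, IntervalIntegrable (fun x => ψ (deriv F x)) volume (T r) (T (r + 1)) := by
    intro r hr
    rw [intervalIntegrable_iff_integrableOn_Ioo_of_le (hlt r hr).le]
    exact (integrableOn_const (by simp)).congr_fun (fun x hx => (hd r hr x hx).symm)
      measurableSet_Ioo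
  have hsum := intervalIntegral.sum_integral_adjacent_intervals hi
  rw [show T 0 = 0 by simp [hT], show T B = 1 from hΔ1] at hsum
  rw [← hsum]
  refine Finset.sum_congr rfl fun r hr => ?_
  rw [Finset.mem_range] at hr
  rw [intervalIntegral.integral_of_le (hlt r hr).le, integral_Ioc_eq_integral_Ioo,
    setIntegral_congr_fun measurableSet_Ioo (hd r hr), ← integral_Ioc_eq_integral_Ioo,
    ← intervalIntegral.integral_of_le (hlt r hr).le, intervalIntegral.integral_const, hTs,
    smul_eq_mul]

end Polyline

lemma le_of_le_succ_below {B : ℕ} {v : ℕ → ℝ} (h : ∀ i, i + 1 < B → v i ≤ v (i + 1)) :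
    ∀ i j, i ≤ j → j < B → v i ≤ v j := by
  intro i j hij
  induction j, hij using Nat.le_induction with
  | base => exact fun _ => le_rfl
  | succ j _ ih => exact fun hj => (ih (by omega)).trans (h j hj)

section Envelope

variable {B : ℕ} {Δ : ℕ → ℝ}

/-- Raising one knot of a polygonal line. -/
lemma sum_bump (hΔ0 : ∀ r < B, 0 < Δ r) (s : ℕ → ℝ) (x : ℝ) {j : ℕ} (hj : j + 1 < B) {m : ℕ}
    (hm : m ≤ B) :
    ∑ i ∈ Finset.range m, Δ i * (if i = j then s j + x / Δ j else
      if i = j + 1 then s (j + 1) - x / Δ (j + 1) else s i) =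
      ∑ i ∈ Finset.range m, Δ i * s i + if m = j + 1 then x else 0 := by
  have h1 := (hΔ0 j (by omega)).ne'
  have h2 := (hΔ0 (j + 1) hj).ne'
  induction m with
  | zero => simp
  | succ m ih =>
    rw [Finset.sum_range_succ, Finset.sum_range_succ, ih (by omega)]
    rcases eq_or_ne m j with rfl | h3
    · simp only [if_true]
      rw [if_neg (by omega)]
      field_simp
      ring
    · rcases eq_or_ne m (j + 1) with rfl | h4
      · rw [if_pos rfl, if_neg h3, if_pos rfl, if_neg (by omega)]
        field_simp
        ring
      · rw [if_neg h4, if_neg h3, if_neg h4, if_neg (by omega)]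
        ring

/-- The convex envelope of a polygonal line is a polygonal line over the same mesh, whose slope
is constant where it does not touch. -/
lemma exists_envelope_slopes (hΔ0 : ∀ r < B, 0 < Δ r) (hΔ1 : ∑ r ∈ Finset.range B, Δ r = 1)
    {ρ : ℕ → ℝ} (hρ : ∀ r < B, ρ r ∈ Set.Icc (0 : ℝ) 1) {F : ℝ → ℝ}
    (hF : ∀ t ∈ Set.Icc (0 : ℝ) 1, F t = polyline B Δ ρ t) :
    ∃ s : ℕ → ℝ, (∀ r < B, s r ∈ Set.Icc (0 : ℝ) 1) ∧ (∀ i j, i ≤ j → j < B → s i ≤ s j) ∧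
      (∀ t ∈ Set.Icc (0 : ℝ) 1, convEnv F t = polyline B Δ s t) ∧
      ∀ L : ℝ → ℝ, ∑ r ∈ Finset.range B, Δ r * (ρ r - s r) * L (s r) = 0 := by
  have hp := polyline_isProfile hΔ0 hΔ1 hρ hF
  have hpe := hp.convEnv_isProfile
  have hce := hp.convexOn_convEnv
  set e := convEnv F with he
  set T : ℕ → ℝ := fun r => ∑ i ∈ Finset.range r, Δ i with hT
  have hTs : ∀ r, T (r + 1) - T r = Δ r := fun r => by simp [hT, Finset.sum_range_succ]
  have hmem : ∀ r ≤ B, T r ∈ Set.Icc (0 : ℝ) 1 := fun r hr => mesh_mem hΔ0 hΔ1 hr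
  have hlt : ∀ r < B, T r < T (r + 1) := fun r hr => by linarith [hTs r, hΔ0 r hr]
  have hFT : ∀ j ≤ B, F (T j) = ∑ i ∈ Finset.range j, Δ i * ρ i := fun j hj => by
    rw [hF _ (hmem j hj), polyline_knot hΔ0 ρ hj]
  set s : ℕ → ℝ := fun r => (e (T (r + 1)) - e (T r)) / (T (r + 1) - T r) with hs
  have hΔs : ∀ r < B, Δ r * s r = e (T (r + 1)) - e (T r) := fun r hr => by
    simp only [hs, hTs]
    rw [mul_div_cancel₀ _ (hΔ0 r hr).ne']
  have hE : ∀ j ≤ B, ∑ i ∈ Finset.range j, Δ i * s i = e (T j) := by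
    intro j hj
    rw [Finset.sum_congr rfl fun i hi => hΔs i (lt_of_lt_of_le (Finset.mem_range.1 hi) hj),
      Finset.sum_range_sub (fun i => e (T i))]
    simp only [hT, Finset.sum_range_zero]
    rw [hpe.zero, sub_zero]
  have hmono : ∀ i j, i ≤ j → j < B → s i ≤ s j := le_of_le_succ_below fun i hi =>
    hce.slope_mono_adjacent (hmem i (by omega)) (hmem (i + 1 + 1) hi) (hlt i (by omega))
      (hlt (i + 1) hi)
  have hle : ∀ j ≤ B, ∑ i ∈ Finset.range j, Δ i * s i ≤ ∑ i ∈ Finset.range j, Δ i * ρ i := by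
    intro j hj
    rw [hE j hj, ← hFT j hj]
    exact hp.convEnv_le (hmem j hj)
  have hle_env : ∀ w : ℕ → ℝ, (∀ i j, i ≤ j → j < B → w i ≤ w j) →
      (∀ j ≤ B, ∑ i ∈ Finset.range j, Δ i * w i ≤ ∑ i ∈ Finset.range j, Δ i * ρ i) →
      ∀ t ∈ Set.Icc (0 : ℝ) 1, polyline B Δ w t ≤ e t := fun w hw hwρ t ht =>
    IsProfile.le_convEnv (convexOn_polyline hΔ0 hΔ1 hw) (fun u hu => by
      rw [hF u hu]; exact polyline_le_polyline hΔ0 hΔ1 hwρ hu) ht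
  refine ⟨s, fun r hr => hpe.slope_mem (hmem r hr.le).1 (hlt r hr) (hmem (r + 1) hr).2
    (by rw [hTs, hΔs r hr]), hmono, fun t ht => le_antisymm ?_ (hle_env s hmono hle t ht), ?_⟩
  · obtain ⟨j, hj, htj⟩ := exists_mesh_block hΔ1 ht
    rw [polyline_block hΔ0 s hj htj, hE j hj.le]
    change t ∈ Set.Icc (T j) (T (j + 1)) at htj
    change e t ≤ e (T j) + s j * (t - T j)
    have hw := sub_pos.2 (hlt j hj)
    have h1 := hce.2 (hmem j hj.le) (hmem (j + 1) hj)
      (show 0 ≤ (T (j + 1) - t) / (T (j + 1) - T j) from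
        div_nonneg (sub_nonneg.2 htj.2) hw.le)
      (show 0 ≤ (t - T j) / (T (j + 1) - T j) from div_nonneg (sub_nonneg.2 htj.1) hw.le)
      (by field_simp; ring)
    simp only [smul_eq_mul] at h1
    have h2 : (T (j + 1) - t) / (T (j + 1) - T j) * T j +
        (t - T j) / (T (j + 1) - T j) * T (j + 1) = t := by field_simp; ring
    rw [h2] at h1
    refine h1.trans (le_of_eq ?_)
    simp only [hs]
    field_simp
    ring
  · have hslack : ∀ j, j + 1 < B →
        ∑ i ∈ Finset.range (j + 1), Δ i * s i < ∑ i ∈ Finset.range (j + 1), Δ i * ρ i →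
        s j = s (j + 1) := by
      intro j hj hD
      by_contra hne
      have hsl : s j < s (j + 1) := lt_of_le_of_ne (hmono j (j + 1) (by omega) hj) hne
      have hp1 := hΔ0 j (by omega)
      have hp2 := hΔ0 (j + 1) hj
      have hc : 0 < 1 / Δ j + 1 / Δ (j + 1) := by positivity
      set x := min (∑ i ∈ Finset.range (j + 1), Δ i * ρ i - ∑ i ∈ Finset.range (j + 1), Δ i * s i)
        ((s (j + 1) - s j) / (1 / Δ j + 1 / Δ (j + 1))) with hx
      have hx0 : 0 < x := lt_min (sub_pos.2 hD) (div_pos (sub_pos.2 hsl) hc)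
      have hx1 : x / Δ j + x / Δ (j + 1) ≤ s (j + 1) - s j := by
        have := (le_div_iff₀ hc).1 (min_le_right _ _ : x ≤ _)
        calc _ = x * (1 / Δ j + 1 / Δ (j + 1)) := by ring
          _ ≤ _ := this
      have hq1 : 0 < x / Δ j := by positivity
      have hq2 : 0 < x / Δ (j + 1) := by positivity
      have h1 := hle_env (fun i => if i = j then s j + x / Δ j else
        if i = j + 1 then s (j + 1) - x / Δ (j + 1) else s i) (le_of_le_succ_below fun i hi => by
          have hii := hmono i (i + 1) (by omega) hi
          rcases eq_or_ne i j with rfl | h3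
          · simp only [if_true]
            rw [if_neg (by omega)]
            linarith
          · rcases eq_or_ne (i + 1) j with h4 | h4
            · subst h4
              simp only [if_true]
              rw [if_neg (by omega), if_neg (by omega)]
              linarith
            · simp only [if_neg h3, if_neg h4]
              rw [if_neg (show ¬ i + 1 = j + 1 by omega)]
              split_ifs with h5
              · subst h5
                linarith
              · exact hii)
        (fun m hm => by
          rw [sum_bump hΔ0 s x hj hm]
          split_ifs with h3
          · subst h3
            have := (min_le_left _ _ : x ≤ _)
            linarith
          · rw [add_zero]; exact hle m hm)
        (T (j + 1)) (hmem (j + 1) hj.le)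
      rw [polyline_knot hΔ0 _ hj.le, sum_bump hΔ0 s x hj hj.le, if_pos rfl, hE (j + 1) hj.le] at h1
      linarith
    intro L
    have key : ∀ j < B, ∑ r ∈ Finset.range (j + 1), Δ r * (ρ r - s r) * L (s r) =
        (∑ i ∈ Finset.range (j + 1), Δ i * ρ i - ∑ i ∈ Finset.range (j + 1), Δ i * s i) *
          L (s j) := by
      intro j
      induction j with
      | zero => intro _; rw [Finset.sum_range_one, Finset.sum_range_one, Finset.sum_range_one]; ring
      | succ j ih =>
        intro hj
        rw [Finset.sum_range_succ, ih (by omega), Finset.sum_range_succ _ (j + 1),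
          Finset.sum_range_succ _ (j + 1)]
        rcases (hle (j + 1) hj.le).lt_or_eq with h1 | h1
        · rw [hslack j hj h1]; ring
        · rw [h1]; ring
    obtain ⟨n, rfl⟩ : ∃ n, B = n + 1 := ⟨B - 1, by
      rcases B with _ | n
      · simp at hΔ1
      · omega⟩
    rw [key n (by omega), hE _ le_rfl, ← hFT _ le_rfl]
    rw [show T (n + 1) = 1 from hΔ1, he, hp.convEnv_one, sub_self, zero_mul]

/-- The polygonal profile with prescribed slopes, and its rate. -/
lemma exists_polygonal_profile {a b : ℝ} (hΔ0 : ∀ r < B, 0 < Δ r)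
    (hΔ1 : ∑ r ∈ Finset.range B, Δ r = 1) {ρ : ℕ → ℝ} (hρ : ∀ r < B, ρ r ∈ Set.Icc (0 : ℝ) 1) :
    ∃ (f : C0Sp) (s : ℕ → ℝ), (∀ j ≤ B, evalC0 f (∑ i ∈ Finset.range j, Δ i) =
        ∑ i ∈ Finset.range j, Δ i * ρ i) ∧
      (∀ r < B, s r ∈ Set.Icc (0 : ℝ) 1) ∧ (∀ i j, i ≤ j → j < B → s i ≤ s j) ∧
      (∀ L : ℝ → ℝ, ∑ r ∈ Finset.range B, Δ r * (ρ r - s r) * L (s r) = 0) ∧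
      rateI a b f = ((∑ r ∈ Finset.range B, Δ r * (envRate 0 0 (ρ r) + envRate a b (s r)) -
        Real.log (Jfun a b) : ℝ) : EReal) := by
  have h0 : polyline B Δ ρ 0 = 0 := by
    have := polyline_knot hΔ0 ρ (Nat.zero_le B)
    simpa using this
  let f : C0Sp := ⟨⟨fun t => polyline B Δ ρ t,
    (continuous_polyline ρ).comp continuous_subtype_val⟩, h0⟩
  have hF : ∀ t ∈ Set.Icc (0 : ℝ) 1, extendF f.val t = polyline B Δ ρ t := by
    intro t ht
    simp [f, extendF, Set.projIcc_of_mem _ ht]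
  obtain ⟨s, hs, hsm, hse, hL⟩ := exists_envelope_slopes hΔ0 hΔ1 hρ hF
  refine ⟨f, s, fun j hj => ?_, hs, hsm, hL, ?_⟩
  · rw [evalC0, hF _ (mesh_mem hΔ0 hΔ1 hj), polyline_knot hΔ0 ρ hj]
  · rw [rateI_eq f (polyline_isProfile hΔ0 hΔ1 hρ hF),
      integral_comp_deriv_polyline hΔ0 hΔ1 hF, integral_comp_deriv_polyline hΔ0 hΔ1 hse]
    simp only [mul_add, Finset.sum_add_distrib]

end Envelope

/-- The fraction of the `k`-th site contained in the `r`-th block of the mesh. -/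
noncomputable def blockShare (N : ℕ) (Δ : ℕ → ℝ) (k r : ℕ) : ℝ :=
  ramp (N * (∑ i ∈ Finset.range (r + 1), Δ i) - k) - ramp (N * (∑ i ∈ Finset.range r, Δ i) - k)

/-- Site parameters obtained by averaging block parameters over a site. -/
noncomputable def siteParam (N B : ℕ) (Δ G : ℕ → ℝ) (k : ℕ) : ℝ :=
  ∑ r ∈ Finset.range B, blockShare N Δ k r * G r

/-- Likelihood of a configuration under independent sites with densities `g`. -/
noncomputable def likelihood (N : ℕ) (g : ℕ → ℝ) (τ : Fin N → Bool) : ℝ :=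
  ∏ k : Fin N, if τ k = true then g k else 1 - g k

lemma sum_likelihood (N : ℕ) (g : ℕ → ℝ) : ∑ τ : Fin N → Bool, likelihood N g τ = 1 := by
  have := Finset.prod_univ_sum (fun _ : Fin N => (Finset.univ : Finset Bool))
    (fun k x => if x = true then g k else 1 - g k)
  rw [Fintype.piFinset_univ] at this
  unfold likelihood
  rw [← this]
  simp

lemma prodWeight_ofFn (N : ℕ) (g : ℕ → ℝ) (τ : Fin N → Bool) :
    prodWeight (List.ofFn fun k => (τ k, g k)) = (likelihood N g τ)⁻¹ := by
  rw [prodWeight, List.map_ofFn, List.prod_ofFn, likelihood, ← Finset.prod_inv_distrib]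
  refine Finset.prod_congr rfl fun k _ => ?_
  simp only [Function.comp, siteWeight]
  split_ifs <;> simp

section Share

variable {N B : ℕ} {Δ : ℕ → ℝ}

lemma blockShare_nonneg (hΔ0 : ∀ r < B, 0 < Δ r) (k : ℕ) {r : ℕ} (hr : r < B) :
    0 ≤ blockShare N Δ k r :=
  sub_nonneg.2 (ramp_mono (sub_le_sub_right
    (mul_le_mul_of_nonneg_left (mesh_mono hΔ0 (Nat.le_succ r) hr) N.cast_nonneg) _))

lemma sum_blockShare (hΔ1 : ∑ r ∈ Finset.range B, Δ r = 1) {k : ℕ} (hk : k < N) :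
    ∑ r ∈ Finset.range B, blockShare N Δ k r = 1 := by
  unfold blockShare
  rw [Finset.sum_range_sub (fun r => ramp (N * (∑ i ∈ Finset.range r, Δ i) - k)), hΔ1,
    Finset.sum_range_zero]
  have : (k : ℝ) + 1 ≤ N := by exact_mod_cast hk
  have hk0 : (0 : ℝ) ≤ k := k.cast_nonneg
  rw [ramp_of_one_le (by linarith), ramp_of_nonpos (by linarith), sub_zero]

lemma sum_blockShare_sites (hΔ0 : ∀ r < B, 0 < Δ r) (hΔ1 : ∑ r ∈ Finset.range B, Δ r = 1)
    {r : ℕ} (hr : r < B) : ∑ k : Fin N, blockShare N Δ k r = N * Δ r := by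
  have h1 := mesh_mem hΔ0 hΔ1 (show r + 1 ≤ B from hr)
  have h2 := mesh_mem hΔ0 hΔ1 hr.le
  have hN : (0 : ℝ) ≤ N := N.cast_nonneg
  unfold blockShare
  rw [Finset.sum_sub_distrib, sum_ramp N _ (mul_nonneg hN h1.1) (mul_le_of_le_one_right hN h1.2),
    sum_ramp N _ (mul_nonneg hN h2.1) (mul_le_of_le_one_right hN h2.2), Finset.sum_range_succ]
  ring

lemma sum_blockShare_particles (hΔ0 : ∀ r < B, 0 < Δ r) (hΔ1 : ∑ r ∈ Finset.range B, Δ r = 1)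
    (hN : 1 ≤ N) (τ : Fin N → Bool) {r : ℕ} (hr : r < B) :
    ∑ k : Fin N, (if τ k = true then (1 : ℝ) else 0) * blockShare N Δ k r =
      N * (evalC0 (heightC0 N τ) (∑ i ∈ Finset.range (r + 1), Δ i) -
        evalC0 (heightC0 N τ) (∑ i ∈ Finset.range r, Δ i)) := by
  have hN' : (N : ℝ) ≠ 0 := by positivity
  rw [evalC0_heightC0 N τ (mesh_mem hΔ0 hΔ1 (show r + 1 ≤ B from hr)),
    evalC0_heightC0 N τ (mesh_mem hΔ0 hΔ1 hr.le), ← mul_sub, mul_inv_cancel_left₀ hN',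
    ← Finset.sum_sub_distrib]
  simp only [blockShare, mul_sub]

/-- Slopes of a height profile along a mesh. -/
lemma exists_height_slopes (hΔ0 : ∀ r < B, 0 < Δ r) (hΔ1 : ∑ r ∈ Finset.range B, Δ r = 1)
    (hN : 1 ≤ N) (τ : Fin N → Bool) :
    ∃ ρ : ℕ → ℝ, (∀ r < B, ρ r ∈ Set.Icc (0 : ℝ) 1) ∧
      ∀ j ≤ B, evalC0 (heightC0 N τ) (∑ i ∈ Finset.range j, Δ i) =
        ∑ i ∈ Finset.range j, Δ i * ρ i := by
  have hN' : (0 : ℝ) < N := by positivity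
  set h : ℕ → ℝ := fun j => evalC0 (heightC0 N τ) (∑ i ∈ Finset.range j, Δ i) with hh
  refine ⟨fun r => (h (r + 1) - h r) / Δ r, fun r hr => ?_, fun j hj => ?_⟩
  · have h1 := sum_blockShare_particles hΔ0 hΔ1 hN τ hr
    have h2 := sum_blockShare_sites (N := N) hΔ0 hΔ1 hr
    have hp := fun k : Fin N => blockShare_nonneg (N := N) hΔ0 k hr
    have hlo : 0 ≤ (N : ℝ) * (h (r + 1) - h r) := h1 ▸ Finset.sum_nonneg fun k _ =>
      mul_nonneg (by split_ifs <;> simp) (hp k)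
    have hhi : (N : ℝ) * (h (r + 1) - h r) ≤ N * Δ r := by
      rw [← h2]
      refine h1.symm.le.trans (Finset.sum_le_sum fun k _ => ?_)
      exact mul_le_of_le_one_left (hp k) (by split_ifs <;> simp)
    exact ⟨div_nonneg (nonneg_of_mul_nonneg_right hlo hN') (hΔ0 r hr).le,
      (div_le_one (hΔ0 r hr)).2 (le_of_mul_le_mul_left hhi hN')⟩
  · have h0 : h 0 = 0 := by simp only [hh, Finset.sum_range_zero, evalC0, extendF_zero]
    rw [Finset.sum_congr rfl fun i hi => mul_div_cancel₀ (h (i + 1) - h i)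
      (hΔ0 i (lt_of_lt_of_le (Finset.mem_range.1 hi) hj)).ne', Finset.sum_range_sub, h0, sub_zero]

/-- Concavity of the logarithm: the site parameters do at least as well as block parameters. -/
lemma exp_le_likelihood (hΔ0 : ∀ r < B, 0 < Δ r) (hΔ1 : ∑ r ∈ Finset.range B, Δ r = 1)
    (hN : 1 ≤ N) {τ : Fin N → Bool} {ρ G : ℕ → ℝ}
    (hτ : ∀ j ≤ B, evalC0 (heightC0 N τ) (∑ i ∈ Finset.range j, Δ i) =
        ∑ i ∈ Finset.range j, Δ i * ρ i) (hG : ∀ r < B, 0 < G r ∧ G r < 1) :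
    Real.exp (N * ∑ r ∈ Finset.range B,
      Δ r * (ρ r * Real.log (G r) + (1 - ρ r) * Real.log (1 - G r))) ≤
        likelihood N (siteParam N B Δ G) τ := by
  have hlog : ∀ (k : Fin N) (H : ℕ → ℝ), (∀ r < B, 0 < H r) →
      ∑ r ∈ Finset.range B, blockShare N Δ k r * Real.log (H r) ≤
        Real.log (∑ r ∈ Finset.range B, blockShare N Δ k r * H r) ∧
      0 < ∑ r ∈ Finset.range B, blockShare N Δ k r * H r := by
    intro k H hH
    have hw : ∀ r ∈ Finset.range B, 0 ≤ blockShare N Δ k r := fun r hr =>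
      blockShare_nonneg hΔ0 k (Finset.mem_range.1 hr)
    have hm : ∀ r ∈ Finset.range B, H r ∈ Set.Ioi (0 : ℝ) := fun r hr =>
      hH r (Finset.mem_range.1 hr)
    have h1 := sum_blockShare hΔ1 k.isLt
    exact ⟨strictConcaveOn_log_Ioi.concaveOn.le_map_sum hw h1 hm,
      (convex_Ioi (0 : ℝ)).sum_mem hw h1 hm⟩
  have hone : ∀ k : Fin N, 1 - siteParam N B Δ G k =
      ∑ r ∈ Finset.range B, blockShare N Δ k r * (1 - G r) := fun k => by
    simp only [mul_sub, mul_one, Finset.sum_sub_distrib, sum_blockShare hΔ1 k.isLt, siteParam]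
  have hsite : ∀ k : Fin N, ∑ r ∈ Finset.range B, blockShare N Δ k r *
      ((if τ k = true then (1 : ℝ) else 0) * (Real.log (G r) - Real.log (1 - G r)) +
        Real.log (1 - G r)) ≤
      Real.log (if τ k = true then siteParam N B Δ G k else 1 - siteParam N B Δ G k) ∧
      0 < if τ k = true then siteParam N B Δ G k else 1 - siteParam N B Δ G k := by
    intro k
    split_ifs with h
    · have := hlog k G fun r hr => (hG r hr).1
      simpa [siteParam] using this
    · rw [hone]
      have := hlog k (fun r => 1 - G r) fun r hr => sub_pos.2 (hG r hr).2
      simpa using this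
  unfold likelihood
  rw [← Real.exp_log (Finset.prod_pos fun k _ => (hsite k).2),
    Real.log_prod fun k _ => (hsite k).2.ne', Real.exp_le_exp]
  refine le_trans (le_of_eq ?_) (Finset.sum_le_sum fun k _ => (hsite k).1)
  rw [Finset.sum_comm, Finset.mul_sum]
  refine Finset.sum_congr rfl fun r hr => ?_
  rw [Finset.mem_range] at hr
  have h1 := sum_blockShare_particles hΔ0 hΔ1 hN τ hr
  have h2 := sum_blockShare_sites (N := N) hΔ0 hΔ1 hr
  rw [hτ _ hr, hτ _ hr.le, Finset.sum_range_succ, add_sub_cancel_left] at h1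
  calc _ = (N * (Δ r * ρ r)) * (Real.log (G r) - Real.log (1 - G r)) +
        (N * Δ r) * Real.log (1 - G r) := by ring
    _ = _ := by
      rw [← h1, ← h2, Finset.sum_mul, Finset.sum_mul, ← Finset.sum_add_distrib]
      exact Finset.sum_congr rfl fun k _ => by ring

lemma siteParam_mem (hΔ0 : ∀ r < B, 0 < Δ r) (hΔ1 : ∑ r ∈ Finset.range B, Δ r = 1) {G : ℕ → ℝ}
    {S : Set ℝ} (hS : Convex ℝ S) (hG : ∀ r < B, G r ∈ S) {k : ℕ} (hk : k < N) :
    siteParam N B Δ G k ∈ S :=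
  hS.sum_mem (fun _ hr => blockShare_nonneg hΔ0 k (Finset.mem_range.1 hr)) (sum_blockShare hΔ1 hk)
    fun r hr => hG r (Finset.mem_range.1 hr)

lemma siteParam_mono (hΔ1 : ∑ r ∈ Finset.range B, Δ r = 1) {G : ℕ → ℝ}
    (hG : ∀ i j, i ≤ j → j < B → G i ≤ G j) {k l : ℕ} (hkl : k ≤ l) (hl : l < N) :
    siteParam N B Δ G k ≤ siteParam N B Δ G l := by
  have abel : ∀ (u : ℕ → ℝ) (n : ℕ), ∑ r ∈ Finset.range (n + 1), (u (r + 1) - u r) * G r =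
      u (n + 1) * G n - u 0 * G 0 - ∑ r ∈ Finset.range n, u (r + 1) * (G (r + 1) - G r) := by
    intro u n
    induction n with
    | zero => simp; ring
    | succ n ih => rw [Finset.sum_range_succ, ih, Finset.sum_range_succ]; ring
  obtain ⟨n, rfl⟩ : ∃ n, B = n + 1 := ⟨B - 1, by
    rcases B with _ | n
    · simp at hΔ1
    · omega⟩
  unfold siteParam blockShare
  rw [abel (fun r => ramp (N * (∑ i ∈ Finset.range r, Δ i) - k)),
    abel (fun r => ramp (N * (∑ i ∈ Finset.range r, Δ i) - l))]
  have hkl' : (k : ℝ) ≤ l := by exact_mod_cast hkl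
  have hl' : (l : ℝ) + 1 ≤ N := by exact_mod_cast hl
  have hk0 : (0 : ℝ) ≤ k := k.cast_nonneg
  simp only [hΔ1, Finset.sum_range_zero, mul_zero, mul_one]
  rw [ramp_of_one_le (by linarith : (1 : ℝ) ≤ N - k), ramp_of_one_le (by linarith : (1 : ℝ) ≤ N - l),
    ramp_of_nonpos (by linarith : (0 : ℝ) - k ≤ 0), ramp_of_nonpos (by linarith : (0 : ℝ) - l ≤ 0)]
  refine sub_le_sub_left (Finset.sum_le_sum fun r hr => ?_) _
  rw [Finset.mem_range] at hr
  exact mul_le_mul_of_nonneg_right (ramp_mono (by linarith))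
    (sub_nonneg.2 (hG r (r + 1) (by omega) (by omega)))

end Share

section Upper

variable {a b c d q : ℝ} {F : List Bool → ℝ}

lemma IsMPA.le_inv_likelihood (h : IsMPA a b c d q F) (hP : FanParams a b c d q) {N : ℕ}
    {g : ℕ → ℝ} (hg0 : ∀ k < N, 0 < g k ∧ g k < 1)
    (hg1 : ∀ k < N, g k ∈ Set.Icc (a / (1 + a)) (1 / (1 + b)))
    (hg : ∀ k l, k ≤ l → l < N → g k ≤ g l) (τ : Fin N → Bool) :
    F (List.ofFn τ) ≤ (likelihood N g τ)⁻¹ := by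
  have hA : Admissible a b (List.ofFn fun k => (τ k, g k)) := by
    refine ⟨?_, ?_⟩
    · rw [List.map_ofFn, List.pairwise_ofFn]
      exact fun i j hij => hg i j hij.le j.isLt
    · intro p hp
      rw [List.mem_ofFn] at hp
      obtain ⟨k, rfl⟩ := hp
      obtain ⟨h1, h2⟩ := hg1 k k.isLt
      have ha := hP.ha
      have hb := hP.hb
      rw [div_le_iff₀ (by linarith)] at h1
      rw [le_div_iff₀ (by linarith)] at h2
      exact ⟨(hg0 k k.isLt).1, (hg0 k k.isLt).2, by linarith, by linarith⟩
  have := h.le_prodWeight hP hA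
  rw [prodWeight_ofFn, List.map_ofFn] at this
  exact this

variable {B : ℕ} {Δ : ℕ → ℝ}

lemma IsMPA.sum_heights_le (h : IsMPA a b c d q F) (hP : FanParams a b c d q)
    (hΔ0 : ∀ r < B, 0 < Δ r) (hΔ1 : ∑ r ∈ Finset.range B, Δ r = 1) {N : ℕ} (hN : 1 ≤ N)
    {ρ P G : ℕ → ℝ} (hPr : ∀ r < B, 0 < P r ∧ P r < 1) (hG0 : ∀ r < B, 0 < G r ∧ G r < 1)
    (hG1 : ∀ r < B, G r ∈ Set.Icc (a / (1 + a)) (1 / (1 + b)))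
    (hG : ∀ i j, i ≤ j → j < B → G i ≤ G j) :
    (∑ τ : Fin N → Bool, if ∀ j ≤ B, evalC0 (heightC0 N τ) (∑ i ∈ Finset.range j, Δ i) =
        ∑ i ∈ Finset.range j, Δ i * ρ i then F (List.ofFn τ) else 0) ≤
      Real.exp (-(N * ∑ r ∈ Finset.range B,
          Δ r * (ρ r * Real.log (P r) + (1 - ρ r) * Real.log (1 - P r))) -
        N * ∑ r ∈ Finset.range B,
          Δ r * (ρ r * Real.log (G r) + (1 - ρ r) * Real.log (1 - G r))) := by
  set EP := (N : ℝ) * ∑ r ∈ Finset.range B,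
    Δ r * (ρ r * Real.log (P r) + (1 - ρ r) * Real.log (1 - P r)) with hEP
  set EG := (N : ℝ) * ∑ r ∈ Finset.range B,
    Δ r * (ρ r * Real.log (G r) + (1 - ρ r) * Real.log (1 - G r)) with hEG
  have hpos : ∀ τ : Fin N → Bool, 0 ≤ likelihood N (siteParam N B Δ P) τ := fun τ =>
    Finset.prod_nonneg fun k _ => by
      have := siteParam_mem hΔ0 hΔ1 (convex_Ioo (0 : ℝ) 1) hPr k.isLt
      split_ifs
      exacts [this.1.le, sub_nonneg.2 this.2.le]
  have key : ∀ τ : Fin N → Bool,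
      (if ∀ j ≤ B, evalC0 (heightC0 N τ) (∑ i ∈ Finset.range j, Δ i) =
        ∑ i ∈ Finset.range j, Δ i * ρ i then F (List.ofFn τ) else 0) ≤
      likelihood N (siteParam N B Δ P) τ * Real.exp (-EP - EG) := by
    intro τ
    split_ifs with hτ
    · have h1 := exp_le_likelihood hΔ0 hΔ1 hN hτ hPr
      have h2 := exp_le_likelihood hΔ0 hΔ1 hN hτ hG0
      rw [← hEP] at h1
      rw [← hEG] at h2
      have h3 := h.le_inv_likelihood hP (g := siteParam N B Δ G)
        (fun k hk => siteParam_mem hΔ0 hΔ1 (convex_Ioo (0 : ℝ) 1) hG0 hk)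
        (fun k hk => siteParam_mem hΔ0 hΔ1 (convex_Icc _ _) hG1 hk)
        (fun k l => siteParam_mono hΔ1 hG) τ
      have h4 := inv_anti₀ (Real.exp_pos _) h2
      rw [← Real.exp_neg] at h4
      calc F (List.ofFn τ) ≤ Real.exp EP * Real.exp (-EP - EG) := by
            rw [← Real.exp_add, add_sub_assoc', add_neg_cancel, zero_sub]
            exact h3.trans h4
        _ ≤ _ := mul_le_mul_of_nonneg_right h1 (Real.exp_pos _).le
    · exact mul_nonneg (hpos τ) (Real.exp_pos _).le
  refine (Finset.sum_le_sum fun τ _ => key τ).trans (le_of_eq ?_)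
  rw [← Finset.sum_mul, sum_likelihood, one_mul]

/-- Upper bound for the total weight of the configurations with the heights of a given one. -/
lemma IsMPA.exists_rate_upper (h : IsMPA a b c d q F) (hP : FanParams a b c d q)
    (hΔ0 : ∀ r < B, 0 < Δ r) (hΔ1 : ∑ r ∈ Finset.range B, Δ r = 1) {N : ℕ} (hN : 1 ≤ N)
    (σ : Fin N → Bool) :
    ∃ (f : C0Sp) (v : ℝ), rateI a b f = (v : EReal) ∧
      (∀ j ≤ B, evalC0 f (∑ i ∈ Finset.range j, Δ i) =
        evalC0 (heightC0 N σ) (∑ i ∈ Finset.range j, Δ i)) ∧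
      ∀ η ∈ Set.Ioo (0 : ℝ) 1,
        (∑ τ : Fin N → Bool, if ∀ j ≤ B, evalC0 (heightC0 N τ) (∑ i ∈ Finset.range j, Δ i) =
          evalC0 (heightC0 N σ) (∑ i ∈ Finset.range j, Δ i) then F (List.ofFn τ) else 0) ≤
        Real.exp (-(N * (v + Real.log (Jfun a b) + 2 * Real.log (1 - η)))) := by
  have ha := hP.ha
  have hb := hP.hb
  have hab := hP.hab
  have h00 : (0 : ℝ) * 0 < 1 := by norm_num
  obtain ⟨ρ, hρ, hσ⟩ := exists_height_slopes hΔ0 hΔ1 hN σ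
  obtain ⟨f, s, hf, hs, hsm, hL, hI⟩ := exists_polygonal_profile (a := a) (b := b) hΔ0 hΔ1 hρ
  refine ⟨f, _, hI, fun j hj => by rw [hf j hj, hσ j hj], fun η hη => ?_⟩
  have hmain := h.sum_heights_le hP hΔ0 hΔ1 hN (ρ := ρ) (P := fun r => softSlope 0 0 η (ρ r))
    (G := fun r => softSlope a b η (s r))
    (fun r _ => ⟨softSlope_pos le_rfl le_rfl h00 hη.1 hη.2.le _,
      softSlope_lt_one le_rfl le_rfl h00 hη.1 hη.2.le _⟩)
    (fun r _ => ⟨softSlope_pos ha hb hab hη.1 hη.2.le _, softSlope_lt_one ha hb hab hη.1 hη.2.le _⟩)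
    (fun r _ => softSlope_mem ha hb hab hη.1.le hη.2.le _)
    (fun i j hij hj => softSlope_mono hη.2.le (hsm i j hij hj))
  have hset : ∀ τ : Fin N → Bool, (∀ j ≤ B, evalC0 (heightC0 N τ) (∑ i ∈ Finset.range j, Δ i) =
      evalC0 (heightC0 N σ) (∑ i ∈ Finset.range j, Δ i)) ↔
      ∀ j ≤ B, evalC0 (heightC0 N τ) (∑ i ∈ Finset.range j, Δ i) =
        ∑ i ∈ Finset.range j, Δ i * ρ i := fun τ =>
    forall₂_congr fun j hj => by rw [hσ j hj]
  simp only [hset]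
  refine hmain.trans (Real.exp_le_exp.2 ?_)
  have e1 : ∑ r ∈ Finset.range B, Δ r * (envRate 0 0 (ρ r) + Real.log (1 - η)) ≤
      ∑ r ∈ Finset.range B, Δ r * (ρ r * Real.log (softSlope 0 0 η (ρ r)) +
        (1 - ρ r) * Real.log (1 - softSlope 0 0 η (ρ r))) :=
    Finset.sum_le_sum fun r hr => mul_le_mul_of_nonneg_left
      (envRate_add_log_le le_rfl le_rfl h00 hη.1 hη.2 (hρ r (Finset.mem_range.1 hr)))
      (hΔ0 r (Finset.mem_range.1 hr)).le
  have e2 : ∑ r ∈ Finset.range B, Δ r * (envRate a b (s r) + Real.log (1 - η)) ≤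
      ∑ r ∈ Finset.range B, Δ r * (s r * Real.log (softSlope a b η (s r)) +
        (1 - s r) * Real.log (1 - softSlope a b η (s r))) :=
    Finset.sum_le_sum fun r hr => mul_le_mul_of_nonneg_left
      (envRate_add_log_le ha hb hab hη.1 hη.2 (hs r (Finset.mem_range.1 hr)))
      (hΔ0 r (Finset.mem_range.1 hr)).le
  have e3 : ∑ r ∈ Finset.range B, Δ r * (ρ r * Real.log (softSlope a b η (s r)) +
        (1 - ρ r) * Real.log (1 - softSlope a b η (s r))) =
      ∑ r ∈ Finset.range B, Δ r * (s r * Real.log (softSlope a b η (s r)) +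
        (1 - s r) * Real.log (1 - softSlope a b η (s r))) := by
    rw [← sub_eq_zero, ← Finset.sum_sub_distrib, ← hL fun x =>
      Real.log (softSlope a b η x) - Real.log (1 - softSlope a b η x)]
    exact Finset.sum_congr rfl fun r _ => by ring
  rw [← e3] at e2
  simp only [mul_add, Finset.sum_add_distrib, ← Finset.sum_mul, hΔ1, one_mul] at e1 e2 ⊢
  have hN0 : (0 : ℝ) ≤ N := N.cast_nonneg
  have e1' := mul_le_mul_of_nonneg_left e1 hN0
  have e2' := mul_le_mul_of_nonneg_left e2 hN0
  linarith

end Upper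

/-- The possible values of the height at time `t`. -/
noncomputable def heightValues (N : ℕ) (t : ℝ) : Finset ℝ :=
  (Finset.range (N + 1) ×ˢ (Finset.univ : Finset Bool)).image fun p =>
    (N : ℝ)⁻¹ * (p.1 + (if p.2 = true then (1 : ℝ) else 0) * (N * t - ⌊N * t⌋₊))

lemma card_heightValues_le (N : ℕ) (t : ℝ) : (heightValues N t).card ≤ (N + 1) * 2 :=
  Finset.card_image_le.trans (by simp)

lemma evalC0_heightC0_mem (N : ℕ) (τ : Fin N → Bool) {t : ℝ} (ht : t ∈ Set.Icc (0 : ℝ) 1) :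
    evalC0 (heightC0 N τ) t ∈ heightValues N t := by
  have h0 : 0 ≤ (N : ℝ) * t := mul_nonneg N.cast_nonneg ht.1
  set m := ⌊(N : ℝ) * t⌋₊ with hm
  have hm1 : (m : ℝ) ≤ N * t := Nat.floor_le h0
  have hm2 : (N : ℝ) * t < m + 1 := Nat.lt_floor_add_one _
  have hr : ∀ k : Fin N, (if τ k = true then (1 : ℝ) else 0) * ramp (N * t - (k : ℕ)) =
      (if τ k = true ∧ (k : ℕ) < m then (1 : ℝ) else 0) +
        (if τ k = true ∧ (k : ℕ) = m then (N * t - m) else 0) := by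
    intro k
    rcases lt_trichotomy (k : ℕ) m with h | h | h
    · have : ((k : ℕ) : ℝ) + 1 ≤ m := by exact_mod_cast h
      rw [ramp_of_one_le (by linarith)]
      simp [h, h.ne]
    · have : ramp (N * t - m) = N * t - m := by
        rw [ramp, max_eq_right (by linarith), min_eq_right (by linarith)]
      rw [h, this]
      simp
    · have : (m : ℝ) + 1 ≤ (k : ℕ) := by exact_mod_cast h
      rw [ramp_of_nonpos (by linarith)]
      simp [h.not_gt, h.ne']
  rw [evalC0_heightC0 N τ ht, Finset.sum_congr rfl fun k _ => hr k, Finset.sum_add_distrib,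
    heightValues, Finset.mem_image]
  refine ⟨((Finset.univ.filter fun k : Fin N => τ k = true ∧ (k : ℕ) < m).card,
    decide (∃ k : Fin N, τ k = true ∧ (k : ℕ) = m)), ?_, ?_⟩
  · rw [Finset.mem_product, Finset.mem_range, Nat.lt_succ_iff]
    exact ⟨(Finset.card_filter_le _ _).trans (Finset.card_fin N).le, Finset.mem_univ _⟩
  · congr 2
    · simp
    · simp only [decide_eq_true_eq]
      split_ifs with h
      · obtain ⟨k, hk, hkm⟩ := h
        rw [one_mul, Finset.sum_eq_single k]
        · rw [if_pos ⟨hk, hkm⟩]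
        · intro l _ hl
          rw [if_neg]
          rintro ⟨-, h2⟩
          exact hl (Fin.ext (h2.trans hkm.symm))
        · simp
      · rw [zero_mul]
        refine (Finset.sum_eq_zero fun k _ => if_neg fun hk => h ⟨k, hk⟩).symm

lemma eventually_count_le (n : ℕ) {ε : ℝ} (hε : 0 < ε) :
    ∀ᶠ N : ℕ in Filter.atTop, ((((N + 1) * 2) ^ n : ℕ) : ℝ) ≤ Real.exp (N * ε) := by
  have h1 := tendsto_pow_const_mul_const_pow_of_abs_lt_one n (r := Real.exp (-ε))
    (by rw [abs_of_pos (Real.exp_pos _), Real.exp_lt_one_iff]; linarith)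
  have h2 : (0 : ℝ) < (4 ^ n)⁻¹ := by positivity
  filter_upwards [h1.eventually (gt_mem_nhds h2), Filter.eventually_ge_atTop 1] with N hN hN1
  rw [← Real.exp_nat_mul] at hN
  have h3 : (((N : ℝ) + 1) * 2) ^ n ≤ 4 ^ n * (N : ℝ) ^ n := by
    rw [← mul_pow]
    have : (1 : ℝ) ≤ N := by exact_mod_cast hN1
    exact pow_le_pow_left₀ (by positivity) (by linarith) n
  have h4 : (N : ℝ) * -ε = -(N * ε) := by ring
  rw [h4, Real.exp_neg, ← div_eq_mul_inv, div_lt_iff₀ (Real.exp_pos _)] at hN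
  push_cast
  calc _ ≤ 4 ^ n * (N : ℝ) ^ n := h3
    _ ≤ 4 ^ n * ((4 ^ n)⁻¹ * Real.exp (N * ε)) := by gcongr
    _ = _ := by rw [mul_inv_cancel_left₀ (by positivity)]

/-- The density of the phase, as seen through the reservoir bounds. -/
lemma exists_phase {a b : ℝ} (ha : 0 ≤ a) (hb : 0 ≤ b) (hab : a * b < 1) :
    ∃ x ∈ Set.Ioo (0 : ℝ) 1, x * (1 - x) = Jfun a b ∧ truncSlope a b x = 1 - x := by
  have h := lower_lt_upper ha hb hab
  have ha1 : a / (1 + a) = 1 - 1 / (1 + a) := by field_simp; ring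
  have hb1 : b / (1 + b) = 1 - 1 / (1 + b) := by field_simp; ring
  unfold Jfun truncSlope
  by_cases h1 : 1 < a
  · have h2 : 1 / (1 + a) < 1 / 2 := one_div_lt_one_div_of_lt (by norm_num) (by linarith)
    refine ⟨1 / (1 + a), ⟨by positivity, by linarith⟩, ?_, ?_⟩
    · rw [if_pos h1]
      field_simp
      ring
    · rw [max_eq_right (by linarith), min_eq_left h.le, ha1]
  · have h3 : 1 / 2 ≤ 1 / (1 + a) := one_div_le_one_div_of_le (by linarith) (by linarith)
    by_cases h2 : 1 < b
    · have h4 : 1 / (1 + b) < 1 / 2 := one_div_lt_one_div_of_lt (by norm_num) (by linarith)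
      have h5 : 0 < 1 / (1 + b) := by positivity
      refine ⟨b / (1 + b), ⟨by positivity, by linarith⟩, ?_, ?_⟩
      · rw [if_neg h1, if_pos h2]
        field_simp
        ring
      · rw [max_eq_left (by linarith), min_eq_right (by linarith), hb1]
        ring
    · have h4 : 1 / 2 ≤ 1 / (1 + b) := one_div_le_one_div_of_le (by linarith) (by linarith)
      refine ⟨1 / 2, ⟨by norm_num, by norm_num⟩, ?_, ?_⟩
      · rw [if_neg h1, if_neg h2]
        norm_num
      · rw [max_eq_left (by linarith), min_eq_left h4]
        norm_num

section Partition

variable {a b c d q : ℝ} {F : List Bool → ℝ}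

lemma IsMPA.partition_le (h : IsMPA a b c d q F) (hP : FanParams a b c d q) (N : ℕ) :
    ∑ τ : Fin N → Bool, F (List.ofFn τ) ≤ Real.exp (-(N * Real.log (Jfun a b))) := by
  obtain ⟨x, hx, hJ, ht⟩ := exists_phase hP.ha hP.hb hP.hab
  have hmem := truncSlope_mem hP.ha hP.hb hP.hab x
  rw [ht] at hmem
  have h1 : ∀ τ : Fin N → Bool, F (List.ofFn τ) ≤
      ∏ k : Fin N, if τ k = true then (1 - x)⁻¹ else x⁻¹ := fun τ => by
    have := h.le_inv_likelihood hP (g := fun _ => 1 - x)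
      (fun _ _ => ⟨sub_pos.2 hx.2, by linarith [hx.1]⟩) (fun _ _ => hmem)
      (fun _ _ _ _ => le_rfl) τ
    rw [likelihood, ← Finset.prod_inv_distrib] at this
    refine this.trans (le_of_eq (Finset.prod_congr rfl fun k _ => ?_))
    split_ifs <;> simp
  refine (Finset.sum_le_sum fun τ _ => h1 τ).trans (le_of_eq ?_)
  have h2 := Finset.prod_univ_sum (fun _ : Fin N => (Finset.univ : Finset Bool))
    (fun _ y => if y = true then (1 - x)⁻¹ else x⁻¹)
  rw [Fintype.piFinset_univ] at h2
  have hx0 := hx.1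
  have hx1 := sub_pos.2 hx.2
  rw [← h2, ← mul_neg, Real.exp_nat_mul, Real.exp_neg, Real.exp_log (hJ ▸ mul_pos hx0 hx1), ← hJ]
  simp only [Fintype.univ_bool, Finset.prod_const, Finset.card_univ, Fintype.card_fin]
  congr 1
  simp
  field_simp
  ring

lemma IsMPA.partition_lower (h : IsMPA a b c d q F) (hP : FanParams a b c d q) :
    ExpLB (fun N => ∑ τ : Fin N → Bool, F (List.ofFn τ)) (-Real.log (Jfun a b)) := by
  obtain ⟨x, hx, hJ, ht⟩ := exists_phase hP.ha hP.hb hP.hab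
  have hx' : x ∈ Set.Icc (0 : ℝ) 1 := ⟨hx.1.le, hx.2.le⟩
  have h1 := h.profile_lower hP (B := 1) (Δ := fun _ => 1) (ρ := fun _ => x) (s := fun _ => x)
    zero_lt_one (fun _ _ => zero_le_one) (by simp) (fun _ _ => hx') (fun _ _ => hx')
    (fun _ _ => le_rfl) rfl
  have h2 : Hent x + envRate a b x = Real.log (Jfun a b) := by
    rw [← hJ, Real.log_mul hx.1.ne' (sub_pos.2 hx.2).ne', envRate, ht, Hent]
    ring_nf
  simp only [Finset.sum_range_one, one_mul, h2] at h1
  intro ε hε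
  filter_upwards [h1 ε hε] with N hN
  refine hN.trans (Finset.sum_le_sum fun τ _ => ?_)
  split_ifs
  exacts [le_rfl, h.nonneg hP _]

end Partition

lemma exists_mesh {k : ℕ} {θ : Fin (k + 1) → ℝ} (hθ0 : 0 < θ 0) (hθ : StrictMono θ)
    (hθl : θ (Fin.last k) = 1) :
    ∃ Δ : ℕ → ℝ, (∀ r < k + 1, 0 < Δ r) ∧ ∑ r ∈ Finset.range (k + 1), Δ r = 1 ∧
      ∀ j : Fin (k + 1), ∑ r ∈ Finset.range ((j : ℕ) + 1), Δ r = θ j := by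
  set t : ℕ → ℝ := fun n => if n = 0 then 0 else θ (Fin.ofNat (k + 1) (n - 1)) with ht
  have hts : ∀ j : Fin (k + 1), t ((j : ℕ) + 1) = θ j := fun j => by
    simp [ht]
  have hsum : ∀ n, ∑ r ∈ Finset.range n, (t (r + 1) - t r) = t n := fun n => by
    rw [Finset.sum_range_sub]
    simp [ht]
  refine ⟨fun r => t (r + 1) - t r, fun r hr => ?_, ?_, fun j => by rw [hsum, hts]⟩
  · rw [sub_pos, hts ⟨r, hr⟩]
    rcases r with _ | r
    · simpa [ht] using hθ0
    · rw [hts ⟨r, by omega⟩]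
      exact hθ (by simp)
  · rw [hsum]
    exact (hts (Fin.last k)).trans hθl

lemma forall_mesh_iff {k : ℕ} {θ : Fin (k + 1) → ℝ} {Δ : ℕ → ℝ}
    (hT : ∀ j : Fin (k + 1), ∑ r ∈ Finset.range ((j : ℕ) + 1), Δ r = θ j) {f g : C0Sp} :
    (∀ j ≤ k + 1, evalC0 f (∑ r ∈ Finset.range j, Δ r) = evalC0 g (∑ r ∈ Finset.range j, Δ r)) ↔
      (fun j => evalC0 f (θ j)) = fun j => evalC0 g (θ j) := by
  constructor
  · intro h
    funext j
    rw [← hT j]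
    exact h _ (by omega)
  · rintro h (_ | j) hj
    · simp [evalC0, extendF_zero]
    · rw [hT ⟨j, by omega⟩]
      exact congrFun h _

section Elog

variable {N : ℕ} {S z : ℝ}

lemma inv_mul_elog_le (hN : 1 ≤ N) (h : S ≤ Real.exp (N * z)) :
    (((N : ℝ)⁻¹ : ℝ) : EReal) * elog S ≤ z := by
  have hN0 : (0 : ℝ) < N := by exact_mod_cast hN
  unfold elog
  split_ifs with hS
  · rw [EReal.coe_mul_bot_of_pos (inv_pos.2 hN0)]
    exact bot_le
  · rw [← EReal.coe_mul, EReal.coe_le_coe_iff, inv_mul_le_iff₀ hN0]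
    exact (Real.log_le_iff_le_exp (not_le.1 hS)).2 h

lemma le_inv_mul_elog (hN : 1 ≤ N) (h : Real.exp (N * z) ≤ S) :
    (z : EReal) ≤ (((N : ℝ)⁻¹ : ℝ) : EReal) * elog S := by
  have hN0 : (0 : ℝ) < N := by exact_mod_cast hN
  have hS : 0 < S := (Real.exp_pos _).trans_le h
  rw [elog, if_neg hS.not_ge, ← EReal.coe_mul, EReal.coe_le_coe_iff, le_inv_mul_iff₀ hN0]
  exact (Real.le_log_iff_exp_le hS).2 h

end Elog

section LargeDeviations

variable {a b c d q : ℝ} {F : List Bool → ℝ} {k : ℕ} {θ : Fin (k + 1) → ℝ}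

lemma IsMPA.weight_le (h : IsMPA a b c d q F) (hP : FanParams a b c d q) (hθ0 : 0 < θ 0)
    (hθ : StrictMono θ) (hθl : θ (Fin.last k) = 1) {C : Set (Fin (k + 1) → ℝ)} {w ε : ℝ}
    (hw : ∀ (f : C0Sp) (v : ℝ), rateI a b f = (v : EReal) → (fun j => evalC0 f (θ j)) ∈ C → -w ≤ v)
    (hε : 0 < ε) :
    ∀ᶠ N : ℕ in Filter.atTop,
      (∑ τ : Fin N → Bool, if (fun j => evalC0 (heightC0 N τ) (θ j)) ∈ C
        then F (List.ofFn τ) else 0) ≤ Real.exp (N * (w - Real.log (Jfun a b) + ε)) := by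
  obtain ⟨Δ, hΔ0, hΔ1, hT⟩ := exists_mesh hθ0 hθ hθl
  have hθmem : ∀ j, θ j ∈ Set.Icc (0 : ℝ) 1 := fun j => by
    rw [← hT j]
    exact mesh_mem hΔ0 hΔ1 (by omega)
  filter_upwards [eventually_count_le (k + 1) (half_pos hε), Filter.eventually_ge_atTop 1]
    with N hcount hN
  set X : (Fin N → Bool) → Fin (k + 1) → ℝ := fun τ j => evalC0 (heightC0 N τ) (θ j) with hX
  set S := Fintype.piFinset fun j => heightValues N (θ j) with hS
  have hmaps : ∀ τ ∈ (Finset.univ : Finset (Fin N → Bool)), X τ ∈ S := fun τ _ =>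
    Fintype.mem_piFinset.2 fun j => evalC0_heightC0_mem N τ (hθmem j)
  have hcard : S.card ≤ ((N + 1) * 2) ^ (k + 1) := by
    rw [hS, Fintype.card_piFinset]
    exact (Finset.prod_le_pow_card _ _ _ fun j _ => card_heightValues_le N (θ j)).trans (by simp)
  set M := Real.exp (N * (w - Real.log (Jfun a b) + ε / 2)) with hM
  have hfib : ∀ y ∈ S, (∑ τ ∈ Finset.univ.filter (fun τ => X τ = y),
      if X τ ∈ C then F (List.ofFn τ) else 0) ≤ M := by
    intro y _
    by_cases hy : ∃ σ, X σ = y ∧ y ∈ C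
    · obtain ⟨σ, hσ, hyC⟩ := hy
      obtain ⟨f, v, hfv, hfσ, hle⟩ := h.exists_rate_upper hP hΔ0 hΔ1 hN σ
      have hv := hw f v hfv (by
        rw [(forall_mesh_iff hT).1 hfσ]
        exact Set.mem_of_eq_of_mem hσ hyC)
      have hη : Real.exp (-(ε / 4)) < 1 := by
        rw [Real.exp_lt_one_iff]
        linarith
      refine le_trans (le_of_eq ?_) ((hle (1 - Real.exp (-(ε / 4)))
        ⟨by linarith, by linarith [Real.exp_pos (-(ε / 4))]⟩).trans ?_)
      · rw [Finset.sum_filter]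
        refine Finset.sum_congr rfl fun τ _ => ?_
        simp only [forall_mesh_iff hT]
        by_cases hτ : X τ = y
        · rw [if_pos hτ, if_pos (hτ ▸ hyC), if_pos (hτ.trans hσ.symm)]
        · rw [if_neg hτ, if_neg fun h' => hτ (Eq.trans h' hσ)]
      · rw [sub_sub_cancel, Real.log_exp, hM, Real.exp_le_exp, ← mul_neg]
        exact mul_le_mul_of_nonneg_left (by linarith) N.cast_nonneg
    · refine le_trans (le_of_eq (Finset.sum_eq_zero fun τ hτ => if_neg fun h' => hy ?_))
        (Real.exp_pos _).le
      have hτ := (Finset.mem_filter.1 hτ).2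
      exact ⟨τ, hτ, hτ ▸ h'⟩
  rw [← Finset.sum_fiberwise_of_maps_to hmaps]
  refine (Finset.sum_le_card_nsmul S _ M hfib).trans ?_
  rw [nsmul_eq_mul]
  calc (S.card : ℝ) * M ≤ Real.exp (N * (ε / 2)) * M := by
        refine mul_le_mul_of_nonneg_right (le_trans ?_ hcount) (Real.exp_pos _).le
        exact_mod_cast hcard
    _ = _ := by
        rw [hM, ← Real.exp_add]
        congr 1
        ring

lemma IsMPA.le_weight (h : IsMPA a b c d q F) (hP : FanParams a b c d q) (hθ0 : 0 < θ 0)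
    (hθ : StrictMono θ) (hθl : θ (Fin.last k) = 1) {U : Set (Fin (k + 1) → ℝ)} (hU : IsOpen U)
    {f : C0Sp} {v : ℝ} (hv : rateI a b f = (v : EReal)) (hf : (fun j => evalC0 f (θ j)) ∈ U) :
    ExpLB (fun N => ∑ τ : Fin N → Bool, if (fun j => evalC0 (heightC0 N τ) (θ j)) ∈ U
      then F (List.ofFn τ) else 0) (-(v + Real.log (Jfun a b))) := by
  obtain ⟨Δ, hΔ0, hΔ1, hT⟩ := exists_mesh hθ0 hθ hθl
  have hprof := isProfile_of_rateI_ne_top f (hv ▸ EReal.coe_ne_top v)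
  have henv := hprof.convEnv_isProfile
  rw [rateI_eq f hprof, EReal.coe_eq_coe_iff] at hv
  set T : ℕ → ℝ := fun r => ∑ i ∈ Finset.range r, Δ i with hTdef
  have hTs : ∀ r, T (r + 1) - T r = Δ r := fun r => by simp [hTdef, Finset.sum_range_succ]
  have hT0 : T 0 = 0 := by simp [hTdef]
  have hTB : T (k + 1) = 1 := hΔ1
  have hTm : ∀ r ≤ k + 1, T r ∈ Set.Icc (0 : ℝ) 1 := fun r hr => mesh_mem hΔ0 hΔ1 hr
  have slope : ∀ (G : ℝ → ℝ), ∀ r < k + 1, Δ r * ((G (T (r + 1)) - G (T r)) / Δ r) =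
      G (T (r + 1)) - G (T r) := fun G r hr => mul_div_cancel₀ _ (hΔ0 r hr).ne'
  have slope_mem : ∀ G : ℝ → ℝ, IsProfile G → ∀ r < k + 1,
      (G (T (r + 1)) - G (T r)) / Δ r ∈ Set.Icc (0 : ℝ) 1 := fun G hG r hr =>
    hG.slope_mem (hTm r hr.le).1 (sub_pos.1 (by rw [hTs]; exact hΔ0 r hr))
      (hTm (r + 1) hr).2 (by rw [hTs]; exact slope G r hr)
  have slope_sum : ∀ G : ℝ → ℝ, IsProfile G → ∀ r ≤ k + 1,
      ∑ i ∈ Finset.range r, Δ i * ((G (T (i + 1)) - G (T i)) / Δ i) = G (T r) := fun G hG r hr => by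
    rw [Finset.sum_congr rfl fun i hi => slope G i ((Finset.mem_range.1 hi).trans_le hr),
      Finset.sum_range_sub (fun i => G (T i)), hT0, hG.zero, sub_zero]
  set E := extendF f.val with hE
  obtain ⟨ε, hε, hball⟩ := Metric.isOpen_iff.1 hU _ hf
  have hlow := h.profile_lower hP (Δ := Δ) (B := k + 1)
    (ρ := fun r => (E (T (r + 1)) - E (T r)) / Δ r)
    (s := fun r => (convEnv E (T (r + 1)) - convEnv E (T r)) / Δ r) hε
    (fun r hr => (hΔ0 r hr).le) hΔ1 (slope_mem E hprof) (slope_mem _ henv)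
    (fun r hr => by
      rw [slope_sum E hprof r hr, slope_sum _ henv r hr]
      exact hprof.convEnv_le (hTm r hr))
    (by rw [slope_sum E hprof _ le_rfl, slope_sum _ henv _ le_rfl, hTB, hprof.convEnv_one])
  have h1 := hprof.sum_envRate_le le_rfl le_rfl (by norm_num : (0 : ℝ) * 0 < 1) hΔ0 hΔ1 (slope E)
  have h2 := henv.sum_envRate_le hP.ha hP.hb hP.hab hΔ0 hΔ1 (slope (convEnv E))
  have h3 : ∑ r ∈ Finset.range (k + 1), Δ r * (Hent ((E (T (r + 1)) - E (T r)) / Δ r) +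
      envRate a b ((convEnv E (T (r + 1)) - convEnv E (T r)) / Δ r)) ≤
      v + Real.log (Jfun a b) := by
    simp only [mul_add, Finset.sum_add_distrib]
    rw [Finset.sum_congr rfl fun r hr => by
      rw [Hent_eq_envRate (slope_mem E hprof r (Finset.mem_range.1 hr))]]
    linarith
  intro ε' hε'
  filter_upwards [hlow ε' hε'] with N hN
  refine le_trans (Real.exp_le_exp.2
    (mul_le_mul_of_nonneg_left (by linarith) N.cast_nonneg)) (hN.trans ?_)
  refine Finset.sum_le_sum fun τ _ => ?_
  have hF := h.nonneg hP (List.ofFn τ)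
  split_ifs with hA hB hB
  · exact le_rfl
  · refine absurd (hball ?_) hB
    rw [Metric.mem_ball, dist_pi_lt_iff hε]
    intro j
    have := hA ((j : ℕ) + 1) (by omega)
    rw [slope_sum E hprof _ (by omega), hT j] at this
    rw [Real.dist_eq]
    have h4 : T ((j : ℕ) + 1) = θ j := hT j
    rw [h4] at this
    exact this
  · exact hF
  · exact le_rfl

end LargeDeviations

/-- The stationary measure is the normalised matrix product weight. -/
lemma stationary_eq_div {a b c d q α β γ δ : ℝ} {F : List Bool → ℝ} (h : IsMPA a b c d q F)
    (hP : FanParams a b c d q) (hα : 0 < α) (hβ : 0 < β) (hγ : 0 ≤ γ) (hδ : 0 ≤ δ)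
    (hαe : α * ((1 + a) * (1 + c)) = 1 - q) (hγe : γ = -(a * c) * α)
    (hβe : β * ((1 + b) * (1 + d)) = 1 - q) (hδe : δ = -(b * d) * β)
    {N : ℕ} (hN : 1 ≤ N) {μ : (Fin N → Bool) → ℝ} (hsum : ∑ τ, μ τ = 1)
    (hμ : IsStationaryASEP N α β γ δ q μ) (τ : Fin N → Bool) :
    μ τ = F (List.ofFn τ) / ∑ σ : Fin N → Bool, F (List.ofFn σ) := by
  obtain ⟨n, rfl⟩ : ∃ n, N = n + 1 := ⟨N - 1, by omega⟩
  obtain ⟨t, ht⟩ := stationary_eq hα hβ hγ hδ hP.hq0 (fun σ => h.pos hP (List.ofFn σ)) hμ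
    (h.isStationary hαe hγe hβe hδe)
  rw [Finset.sum_congr rfl fun σ _ => ht σ, ← Finset.mul_sum] at hsum
  rw [ht τ, eq_one_div_of_mul_eq_one_left hsum]
  ring

end

/-- Step 1 of the proof of Theorem 1.2 (finite-dimensional LDP): in the fan region `ab < 1`,
for fixed `0 < θ₁ < … < θ_{d+1} = 1`, the random vectors `(h_N(θ₁),…,h_N(θ_{d+1})) ∈ ℝ^{d+1}`
under the open ASEP stationary measures satisfy the LDP with the good rate function
`I^{(a,b)}_{θ₁,…,θ_{d+1}}`. -/
theorem stmt1 (α β γ δ q : ℝ)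
    (hα : 0 < α) (hβ : 0 < β) (hγ : 0 ≤ γ) (hδ : 0 ≤ δ) (hq0 : 0 ≤ q) (hq1 : q < 1)
    (a b c d : ℝ)
    (ha : a = phiPlus q α γ) (hb : b = phiPlus q β δ)
    (hc : c = phiMinus q α γ) (hd : d = phiMinus q β δ)
    (hab : a * b < 1)
    (k : ℕ) (hk : 1 ≤ k) (θ : Fin (k+1) → ℝ)
    (hθ0 : 0 < θ 0) (hθmono : StrictMono θ) (hθlast : θ (Fin.last k) = 1)
    (μ : (N : ℕ) → (Fin N → Bool) → ℝ)
    (hμ : ∀ N : ℕ, 1 ≤ N →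
      (∀ τ, 0 ≤ μ N τ) ∧ (∑ τ : Fin N → Bool, μ N τ = 1) ∧
        IsStationaryASEP N α β γ δ q (μ N)) :
    (∀ C : Set (Fin (k+1) → ℝ), IsClosed C →
      Filter.limsup
          (fun N : ℕ => (((N : ℝ)⁻¹ : ℝ) : EReal) *
            elog (∑ τ : Fin N → Bool,
              if (fun j => evalC0 (heightC0 N τ) (θ j)) ∈ C then μ N τ else 0))
          Filter.atTop ≤
        -(⨅ x ∈ C, rateFd a b k θ x)) ∧
    (∀ U : Set (Fin (k+1) → ℝ), IsOpen U →
      -(⨅ x ∈ U, rateFd a b k θ x) ≤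
        Filter.liminf
          (fun N : ℕ => (((N : ℝ)⁻¹ : ℝ) : EReal) *
            elog (∑ τ : Fin N → Bool,
              if (fun j => evalC0 (heightC0 N τ) (θ j)) ∈ U then μ N τ else 0))
          Filter.atTop) := by
  obtain ⟨hs1, hs2, hs3, hs4, hs5⟩ := phi_spec hα hγ hq1
  obtain ⟨ht1, ht2, ht3, ht4, ht5⟩ := phi_spec hβ hδ hq1
  rw [← ha, ← hc] at hs4 hs5
  rw [← hb, ← hd] at ht4 ht5
  rw [← ha] at hs1
  rw [← hb] at ht1
  rw [← hc] at hs2 hs3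
  rw [← hd] at ht2 ht3
  have hP : FanParams a b c d q := ⟨hs1, ht1, hs3, hs2, ht3, ht2, hab, hq0, hq1⟩
  have hM := isMPA_mpaWeight hP
  set F := mpaWeight a b c d q
  have hZ : ∀ N : ℕ, 0 < ∑ σ : Fin N → Bool, F (List.ofFn σ) := fun N =>
    Finset.sum_pos (fun σ _ => hM.pos hP _) ⟨fun _ => false, Finset.mem_univ _⟩
  have hsum : ∀ N : ℕ, 1 ≤ N → ∀ A : Set (Fin (k + 1) → ℝ),
      (∑ τ : Fin N → Bool, if (fun j => evalC0 (heightC0 N τ) (θ j)) ∈ A then μ N τ else 0) =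
      (∑ τ : Fin N → Bool, if (fun j => evalC0 (heightC0 N τ) (θ j)) ∈ A
        then F (List.ofFn τ) else 0) / ∑ σ : Fin N → Bool, F (List.ofFn σ) := by
    intro N hN A
    rw [Finset.sum_div]
    refine Finset.sum_congr rfl fun τ _ => ?_
    rw [stationary_eq_div hM hP hα hβ hγ hδ hs4 hs5 ht4 ht5 hN (hμ N hN).2.1 (hμ N hN).2.2 τ,
      ite_div, zero_div]
  refine ⟨fun C _ => ?_, fun U hU => ?_⟩
  · refine EReal.le_of_forall_lt_iff_le.1 fun z hz => ?_
    obtain ⟨w, hw, hwz⟩ := EReal.lt_iff_exists_real_btwn.1 hz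
    rw [EReal.coe_lt_coe_iff] at hwz
    have hε : 0 < (z - w) / 2 := by linarith
    have hrate : ∀ (f : C0Sp) (v : ℝ), rateI a b f = (v : EReal) →
        (fun j => evalC0 f (θ j)) ∈ C → -w ≤ v := by
      intro f v hv hf
      have h1 : (⨅ x ∈ C, rateFd a b k θ x) ≤ (v : EReal) := by
        refine (iInf₂_le _ hf).trans ?_
        rw [← hv]
        exact iInf_le (fun g : {g : C0Sp // ∀ j, evalC0 g (θ j) = evalC0 f (θ j)} =>
          rateI a b g.val) ⟨f, fun _ => rfl⟩
      have h2 := (EReal.neg_le_neg_iff.2 h1).trans_lt hw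
      rw [← EReal.coe_neg, EReal.coe_lt_coe_iff] at h2
      linarith
    refine Filter.limsup_le_of_le (by isBoundedDefault) ?_
    filter_upwards [hM.weight_le hP hθ0 hθmono hθlast hrate hε, hM.partition_lower hP _ hε,
      Filter.eventually_ge_atTop 1] with N h1 h2 hN
    refine inv_mul_elog_le hN ?_
    rw [hsum N hN, div_le_iff₀ (hZ N)]
    refine h1.trans (le_trans (le_of_eq ?_) (mul_le_mul_of_nonneg_left h2 (Real.exp_pos _).le))
    rw [← Real.exp_add]
    congr 1
    ring
  · refine EReal.ge_of_forall_gt_iff_ge.1 fun z hz => ?_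
    rw [EReal.lt_neg_comm] at hz
    simp only [rateFd, iInf_lt_iff] at hz
    obtain ⟨x, hx, ⟨f, hf⟩, hlt⟩ := hz
    have hprof := isProfile_of_rateI_ne_top f (hlt.trans_le le_top).ne
    obtain ⟨v, hv⟩ : ∃ v : ℝ, rateI a b f = (v : EReal) := ⟨_, rateI_eq f hprof⟩
    simp only [hv] at hlt
    rw [← EReal.coe_neg, EReal.coe_lt_coe_iff] at hlt
    have hε : 0 < -z - v := by linarith
    refine Filter.le_liminf_of_le (by isBoundedDefault) ?_
    filter_upwards [hM.le_weight hP hθ0 hθmono hθlast hU hv (by rw [funext hf]; exact hx) _ hε,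
      Filter.eventually_ge_atTop 1] with N h1 hN
    refine le_inv_mul_elog hN ?_
    rw [hsum N hN, le_div_iff₀ (hZ N)]
    refine (mul_le_mul_of_nonneg_left (hM.partition_le hP N) (Real.exp_pos _).le).trans
      (le_trans (le_of_eq ?_) h1)
    rw [← Real.exp_add]
    congr 1
    ring
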